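/- arXiv:2105.02827 — 6 statements merged into one kernel-verified Lean document; each statement's English description precedes it below -/
import Mathlib

section
/- Let ε ∈ (0,1) with 1/ε ∈ ℤ, and let δ_W, δ_H ∈ (0,1). Let I be a finite set of items each of which has width ≤ δ_W or height ≤ δ_H. Define Δ := (1/2)·(δ_H/(1−δ_H) + δ_W/(1−δ_W)), α := (4/3)·(1+4Δ)·(1+3ε), and β := 2Δ(1+ε)/ε² + 10/3 + 19Δ/3 + 16Δε/3. Then opt_g(I) < α·(1+ε)·opt(I) + 2β. -/
/-- An axis-aligned, non-rotated packing of items (item `i` has width `w i`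
and height `h i`) into `N` unit square bins: each item gets a bin index and
coordinates for its bottom-left corner, each item lies inside its bin, and
the interiors of any two items placed in the same bin are disjoint. -/
structure BinPacking {ι : Type} [Fintype ι] (w h : ι → ℝ) (N : ℕ) where
  bin : ι → Fin N
  x : ι → ℝ
  y : ι → ℝ
  x_nonneg : ∀ i, 0 ≤ x i
  y_nonneg : ∀ i, 0 ≤ y i
  x_add_le : ∀ i, x i + w i ≤ 1
  y_add_le : ∀ i, y i + h i ≤ 1
  disj : ∀ i j, i ≠ j → bin i = bin j →
    (Set.Ioo (x i) (x i + w i) ×ˢ Set.Ioo (y i) (y i + h i)) ∩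
      (Set.Ioo (x j) (x j + w j) ×ˢ Set.Ioo (y j) (y j + h j)) = ∅

/-- The minimum number of unit square bins needed to pack the items. -/
noncomputable def opt {ι : Type} [Fintype ι] (w h : ι → ℝ) : ℕ :=
  sInf {N | Nonempty (BinPacking w h N)}

/-- An axis-aligned rectangle given by the coordinates of its left, bottom,
right and top edges. -/
structure Rect where
  x1 : ℝ
  y1 : ℝ
  x2 : ℝ
  y2 : ℝ

/-- The open interior of a rectangle. -/
def Rect.interior (r : Rect) : Set (ℝ × ℝ) := Set.Ioo r.x1 r.x2 ×ˢ Set.Ioo r.y1 r.y2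

/-- `Guillotine p S R` : the rectangles `p i` for `i ∈ S`, packed inside the
region `R`, are guillotine-separable: either `S` has at most one element, or
there is a vertical or horizontal end-to-end cut of `R` meeting the interior
of no rectangle of `S` such that the induced packings in the two resulting
subregions are recursively guillotine-separable. -/
inductive Guillotine {ι : Type} (p : ι → Rect) : Finset ι → Rect → Prop
  | leaf (S : Finset ι) (R : Rect) (hcard : S.card ≤ 1) : Guillotine p S R
  | vert (S : Finset ι) (R : Rect) (c : ℝ) (h1 : R.x1 ≤ c) (h2 : c ≤ R.x2)
      (hsep : ∀ i ∈ S, (p i).x2 ≤ c ∨ c ≤ (p i).x1)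
      (hleft : Guillotine p (S.filter fun i => (p i).x2 ≤ c) ⟨R.x1, R.y1, c, R.y2⟩)
      (hright : Guillotine p (S.filter fun i => ¬ (p i).x2 ≤ c) ⟨c, R.y1, R.x2, R.y2⟩) :
      Guillotine p S R
  | horiz (S : Finset ι) (R : Rect) (c : ℝ) (h1 : R.y1 ≤ c) (h2 : c ≤ R.y2)
      (hsep : ∀ i ∈ S, (p i).y2 ≤ c ∨ c ≤ (p i).y1)
      (hbot : Guillotine p (S.filter fun i => (p i).y2 ≤ c) ⟨R.x1, R.y1, R.x2, c⟩)
      (htop : Guillotine p (S.filter fun i => ¬ (p i).y2 ≤ c) ⟨R.x1, c, R.x2, R.y2⟩) :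
      Guillotine p S R

/-- The placed rectangle of item `i` in the packing `P`. -/
noncomputable def BinPacking.rect {ι : Type} [Fintype ι] {w h : ι → ℝ} {N : ℕ}
    (P : BinPacking w h N) (i : ι) : Rect :=
  ⟨P.x i, P.y i, P.x i + w i, P.y i + h i⟩

/-- A bin packing is guillotinable if the packing inside every bin is
guillotine-separable. -/
def BinPacking.Guillotinable {ι : Type} [Fintype ι] {w h : ι → ℝ} {N : ℕ}
    (P : BinPacking w h N) : Prop :=
  ∀ b : Fin N, Guillotine P.rect (Finset.univ.filter fun i => P.bin i = b) ⟨0, 0, 1, 1⟩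

/-- The minimum number of unit square bins in a guillotinable packing. -/
noncomputable def optg {ι : Type} [Fintype ι] (w h : ι → ℝ) : ℕ :=
  sInf {N | ∃ P : BinPacking w h N, P.Guillotinable}

section Boxes

variable {ι : Type} [DecidableEq ι]

/-- `BoxPack w h S a b`: the items of `S` can be arranged in a box of width `a` and height `b` by
recursively placing boxes side by side or on top of each other. -/
inductive BoxPack (w h : ι → ℝ) : Finset ι → ℝ → ℝ → Prop
  | empty (a b : ℝ) (ha : 0 ≤ a) (hb : 0 ≤ b) : BoxPack w h ∅ a b
  | single (i : ι) (a b : ℝ) (ha : w i ≤ a) (hb : h i ≤ b) : BoxPack w h {i} a b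
  | beside (S T : Finset ι) (a a' b : ℝ) (hST : Disjoint S T)
      (hS : BoxPack w h S a b) (hT : BoxPack w h T a' b) : BoxPack w h (S ∪ T) (a + a') b
  | above (S T : Finset ι) (a b b' : ℝ) (hST : Disjoint S T)
      (hS : BoxPack w h S a b) (hT : BoxPack w h T a b') : BoxPack w h (S ∪ T) a (b + b')

/-- `BinPack w h S M`: the items of `S` can be distributed over at most `M` unit boxes, each of
them arranged as in `BoxPack`. -/
inductive BinPack (w h : ι → ℝ) : Finset ι → ℕ → Prop
  | nil (M : ℕ) : BinPack w h ∅ M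
  | cons (S T : Finset ι) (M : ℕ) (hST : Disjoint S T) (hS : BoxPack w h S 1 1)
      (hT : BinPack w h T M) : BinPack w h (S ∪ T) (M + 1)

variable {w h : ι → ℝ}

lemma BoxPack.swap {S : Finset ι} {a b : ℝ} (H : BoxPack w h S a b) : BoxPack h w S b a := by
  induction H with
  | empty a b ha hb => exact .empty _ _ hb ha
  | single i a b ha hb => exact .single _ _ _ hb ha
  | beside S T a a' b hST _ _ ih1 ih2 => exact .above _ _ _ _ _ hST ih1 ih2
  | above S T a b b' hST _ _ ih1 ih2 => exact .beside _ _ _ _ _ hST ih1 ih2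

lemma BinPack.swap {S : Finset ι} {M : ℕ} (H : BinPack w h S M) : BinPack h w S M := by
  induction H with
  | nil M => exact .nil M
  | cons S T M hST hS _ ih => exact .cons S T M hST hS.swap ih

lemma BoxPack.nonneg (hw : ∀ i, 0 < w i) (hh : ∀ i, 0 < h i) {S : Finset ι} {a b : ℝ}
    (H : BoxPack w h S a b) : 0 ≤ a ∧ 0 ≤ b := by
  induction H with
  | empty a b ha hb => exact ⟨ha, hb⟩
  | single i a b ha hb => exact ⟨(hw i).le.trans ha, (hh i).le.trans hb⟩
  | beside S T a a' b hST _ _ ih1 ih2 => exact ⟨add_nonneg ih1.1 ih2.1, ih1.2⟩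
  | above S T a b b' hST _ _ ih1 ih2 => exact ⟨ih1.1, add_nonneg ih1.2 ih2.2⟩

lemma BoxPack.mono_left (hw : ∀ i, 0 < w i) (hh : ∀ i, 0 < h i) {S : Finset ι} {a a' b : ℝ}
    (H : BoxPack w h S a b) (haa : a ≤ a') : BoxPack w h S a' b := by
  simpa using BoxPack.beside S ∅ a (a' - a) b (Finset.disjoint_empty_right S) H
    (.empty _ _ (sub_nonneg.2 haa) (H.nonneg hw hh).2)

lemma BoxPack.mono_right (hw : ∀ i, 0 < w i) (hh : ∀ i, 0 < h i) {S : Finset ι} {a b b' : ℝ}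
    (H : BoxPack w h S a b) (hbb : b ≤ b') : BoxPack w h S a b' :=
  (H.swap.mono_left hh hw hbb).swap

lemma Guillotine.congr {ι : Type} {p p' : ι → Rect} {S : Finset ι} {R : Rect}
    (H : Guillotine p S R) : (∀ i ∈ S, p i = p' i) → Guillotine p' S R := by
  induction H with
  | leaf S R hc => intro _; exact .leaf S R hc
  | vert S R c h1 h2 hsep _ _ ih1 ih2 =>
    intro hp
    have e1 : S.filter (fun i => (p i).x2 ≤ c) = S.filter (fun i => (p' i).x2 ≤ c) :=
      Finset.filter_congr fun i hi => by rw [hp i hi]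
    have e2 : S.filter (fun i => ¬ (p i).x2 ≤ c) = S.filter (fun i => ¬ (p' i).x2 ≤ c) :=
      Finset.filter_congr fun i hi => by rw [hp i hi]
    refine .vert S R c h1 h2 (fun i hi => by rw [← hp i hi]; exact hsep i hi) ?_ ?_
    · rw [← e1]; exact ih1 fun i hi => hp i (Finset.mem_of_mem_filter i hi)
    · rw [← e2]; exact ih2 fun i hi => hp i (Finset.mem_of_mem_filter i hi)
  | horiz S R c h1 h2 hsep _ _ ih1 ih2 =>
    intro hp
    have e1 : S.filter (fun i => (p i).y2 ≤ c) = S.filter (fun i => (p' i).y2 ≤ c) :=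
      Finset.filter_congr fun i hi => by rw [hp i hi]
    have e2 : S.filter (fun i => ¬ (p i).y2 ≤ c) = S.filter (fun i => ¬ (p' i).y2 ≤ c) :=
      Finset.filter_congr fun i hi => by rw [hp i hi]
    refine .horiz S R c h1 h2 (fun i hi => by rw [← hp i hi]; exact hsep i hi) ?_ ?_
    · rw [← e1]; exact ih1 fun i hi => hp i (Finset.mem_of_mem_filter i hi)
    · rw [← e2]; exact ih2 fun i hi => hp i (Finset.mem_of_mem_filter i hi)

/-- The placement `(x, y)` of the items of `S` is a guillotine-separable packing of the
rectangle with bottom-left corner `(x₀, y₀)`, width `a` and height `b`. -/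
def IsPlacement (w h : ι → ℝ) (S : Finset ι) (a b x₀ y₀ : ℝ) (x y : ι → ℝ) : Prop :=
  (∀ i ∈ S, x₀ ≤ x i ∧ x i + w i ≤ x₀ + a ∧ y₀ ≤ y i ∧ y i + h i ≤ y₀ + b) ∧
  (∀ i ∈ S, ∀ j ∈ S, i ≠ j →
    x i + w i ≤ x j ∨ x j + w j ≤ x i ∨ y i + h i ≤ y j ∨ y j + h j ≤ y i) ∧
  Guillotine (fun i => (⟨x i, y i, x i + w i, y i + h i⟩ : Rect)) S ⟨x₀, y₀, x₀ + a, y₀ + b⟩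

lemma BoxPack.exists_placement (hw : ∀ i, 0 < w i) (hh : ∀ i, 0 < h i) {S : Finset ι} {a b : ℝ}
    (H : BoxPack w h S a b) : ∀ x₀ y₀ : ℝ, ∃ x y : ι → ℝ, IsPlacement w h S a b x₀ y₀ x y := by
  induction H with
  | empty a b ha hb =>
    intro x₀ y₀
    exact ⟨0, 0, by simp, by simp, .leaf _ _ (by simp)⟩
  | single i a b ha hb =>
    intro x₀ y₀
    refine ⟨fun _ => x₀, fun _ => y₀, ?_, ?_, .leaf _ _ (by simp)⟩
    · simp [ha, hb]
    · intro j hj k hk hjk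
      simp_all
  | beside S T a a' b hST hS hT ih1 ih2 =>
    intro x₀ y₀
    obtain ⟨x1, y1, hin1, hd1, hg1⟩ := ih1 x₀ y₀
    obtain ⟨x2, y2, hin2, hd2, hg2⟩ := ih2 (x₀ + a) y₀
    have hS0 := hS.nonneg hw hh
    have hT0 := hT.nonneg hw hh
    have hnot : ∀ i ∈ T, i ∉ S := fun i hi hi' => Finset.disjoint_left.1 hST hi' hi
    refine ⟨fun i => if i ∈ S then x1 i else x2 i, fun i => if i ∈ S then y1 i else y2 i,
      ?_, ?_, ?_⟩
    · intro i hi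
      rcases Finset.mem_union.1 hi with hi | hi
      · have := hin1 i hi
        simp only [hi, if_true]
        refine ⟨this.1, by linarith [this.2.1], this.2.2.1, this.2.2.2⟩
      · have := hin2 i hi
        simp only [hnot i hi, if_false]
        refine ⟨by linarith [this.1], by linarith [this.2.1], this.2.2.1, this.2.2.2⟩
    · intro i hi j hj hij
      rcases Finset.mem_union.1 hi with hi | hi <;> rcases Finset.mem_union.1 hj with hj | hj
      · simp only [hi, hj, if_true]; exact hd1 i hi j hj hij
      · simp only [hi, hnot j hj, if_true, if_false]
        left; linarith [(hin1 i hi).2.1, (hin2 j hj).1]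
      · simp only [hj, hnot i hi, if_true, if_false]
        right; left; linarith [(hin1 j hj).2.1, (hin2 i hi).1]
      · simp only [hnot i hi, hnot j hj, if_false]; exact hd2 i hi j hj hij
    · have e1 : (S ∪ T).filter (fun i => (if i ∈ S then x1 i else x2 i) + w i ≤ x₀ + a) = S := by
        ext i
        simp only [Finset.mem_filter, Finset.mem_union]
        constructor
        · rintro ⟨hi | hi, hle⟩
          · exact hi
          · rw [if_neg (hnot i hi)] at hle
            linarith [(hin2 i hi).1, hw i]
        · intro hi
          exact ⟨Or.inl hi, by rw [if_pos hi]; exact (hin1 i hi).2.1⟩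
      have e2 : (S ∪ T).filter (fun i => ¬ (if i ∈ S then x1 i else x2 i) + w i ≤ x₀ + a) = T := by
        ext i
        simp only [Finset.mem_filter, Finset.mem_union]
        constructor
        · rintro ⟨hi | hi, hle⟩
          · rw [if_pos hi] at hle
            exact absurd (hin1 i hi).2.1 hle
          · exact hi
        · intro hi
          refine ⟨Or.inr hi, ?_⟩
          rw [if_neg (hnot i hi)]
          linarith [(hin2 i hi).1, hw i]
      refine .vert _ _ (x₀ + a) (by simpa using hS0.1) (by simp only; linarith) ?_ ?_ ?_
      · intro i hi
        rcases Finset.mem_union.1 hi with hi | hi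
        · left; simp only [hi, if_true]; exact (hin1 i hi).2.1
        · right; simp only [hnot i hi, if_false]; exact (hin2 i hi).1
      · simp only [e1]
        exact hg1.congr fun i hi => by simp [hi]
      · simp only [e2, ← add_assoc]
        exact hg2.congr fun i hi => by simp [hnot i hi]
  | above S T a b b' hST hS hT ih1 ih2 =>
    intro x₀ y₀
    obtain ⟨x1, y1, hin1, hd1, hg1⟩ := ih1 x₀ y₀
    obtain ⟨x2, y2, hin2, hd2, hg2⟩ := ih2 x₀ (y₀ + b)
    have hS0 := hS.nonneg hw hh
    have hT0 := hT.nonneg hw hh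
    have hnot : ∀ i ∈ T, i ∉ S := fun i hi hi' => Finset.disjoint_left.1 hST hi' hi
    refine ⟨fun i => if i ∈ S then x1 i else x2 i, fun i => if i ∈ S then y1 i else y2 i,
      ?_, ?_, ?_⟩
    · intro i hi
      rcases Finset.mem_union.1 hi with hi | hi
      · have := hin1 i hi
        simp only [hi, if_true]
        refine ⟨this.1, this.2.1, this.2.2.1, by linarith [this.2.2.2]⟩
      · have := hin2 i hi
        simp only [hnot i hi, if_false]
        refine ⟨this.1, this.2.1, by linarith [this.2.2.1], by linarith [this.2.2.2]⟩
    · intro i hi j hj hij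
      rcases Finset.mem_union.1 hi with hi | hi <;> rcases Finset.mem_union.1 hj with hj | hj
      · simp only [hi, hj, if_true]; exact hd1 i hi j hj hij
      · simp only [hi, hnot j hj, if_true, if_false]
        right; right; left; linarith [(hin1 i hi).2.2.2, (hin2 j hj).2.2.1]
      · simp only [hj, hnot i hi, if_true, if_false]
        right; right; right; linarith [(hin1 j hj).2.2.2, (hin2 i hi).2.2.1]
      · simp only [hnot i hi, hnot j hj, if_false]; exact hd2 i hi j hj hij
    · have e1 : (S ∪ T).filter (fun i => (if i ∈ S then y1 i else y2 i) + h i ≤ y₀ + b) = S := by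
        ext i
        simp only [Finset.mem_filter, Finset.mem_union]
        constructor
        · rintro ⟨hi | hi, hle⟩
          · exact hi
          · rw [if_neg (hnot i hi)] at hle
            linarith [(hin2 i hi).2.2.1, hh i]
        · intro hi
          exact ⟨Or.inl hi, by rw [if_pos hi]; exact (hin1 i hi).2.2.2⟩
      have e2 : (S ∪ T).filter (fun i => ¬ (if i ∈ S then y1 i else y2 i) + h i ≤ y₀ + b) = T := by
        ext i
        simp only [Finset.mem_filter, Finset.mem_union]
        constructor
        · rintro ⟨hi | hi, hle⟩
          · rw [if_pos hi] at hle
            exact absurd (hin1 i hi).2.2.2 hle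
          · exact hi
        · intro hi
          refine ⟨Or.inr hi, ?_⟩
          rw [if_neg (hnot i hi)]
          linarith [(hin2 i hi).2.2.1, hh i]
      refine .horiz _ _ (y₀ + b) (by simpa using hS0.2) (by simp only; linarith) ?_ ?_ ?_
      · intro i hi
        rcases Finset.mem_union.1 hi with hi | hi
        · left; simp only [hi, if_true]; exact (hin1 i hi).2.2.2
        · right; simp only [hnot i hi, if_false]; exact (hin2 i hi).2.2.1
      · simp only [e1]
        exact hg1.congr fun i hi => by simp [hi]
      · simp only [e2, ← add_assoc]
        exact hg2.congr fun i hi => by simp [hnot i hi]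

lemma BinPack.exists_placement (hw : ∀ i, 0 < w i) (hh : ∀ i, 0 < h i) {S : Finset ι} {M : ℕ}
    (H : BinPack w h S M) : ∃ (bin : ι → ℕ) (x y : ι → ℝ), (∀ i ∈ S, bin i < M) ∧
      ∀ b, IsPlacement w h (S.filter fun i => bin i = b) 1 1 0 0 x y := by
  induction H with
  | nil M => exact ⟨0, 0, 0, by simp, fun b => ⟨by simp, by simp, .leaf _ _ (by simp)⟩⟩
  | cons S T M hST hS hT ih =>
    obtain ⟨bin, x, y, hbin, hp⟩ := ih
    obtain ⟨x', y', hp'⟩ := hS.exists_placement hw hh 0 0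
    have hnot : ∀ i ∈ T, i ∉ S := fun i hi hi' => Finset.disjoint_left.1 hST hi' hi
    have key : ∀ (U : Finset ι) (x₁ y₁ x₂ y₂ : ι → ℝ), (∀ i ∈ U, x₁ i = x₂ i ∧ y₁ i = y₂ i) →
        IsPlacement w h U 1 1 0 0 x₁ y₁ → IsPlacement w h U 1 1 0 0 x₂ y₂ := by
      rintro U x₁ y₁ x₂ y₂ he ⟨h1, h2, h3⟩
      refine ⟨fun i hi => ?_, fun i hi j hj hij => ?_, h3.congr fun i hi => ?_⟩
      · rw [← (he i hi).1, ← (he i hi).2]; exact h1 i hi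
      · rw [← (he i hi).1, ← (he i hi).2, ← (he j hj).1, ← (he j hj).2]; exact h2 i hi j hj hij
      · rw [(he i hi).1, (he i hi).2]
    refine ⟨fun i => if i ∈ S then M else bin i, fun i => if i ∈ S then x' i else x i,
      fun i => if i ∈ S then y' i else y i, ?_, ?_⟩
    · intro i hi
      by_cases hiS : i ∈ S
      · simp [hiS]
      · simp only [hiS, if_false]
        exact (hbin i ((Finset.mem_union.1 hi).resolve_left hiS)).trans (Nat.lt_succ_self M)
    · intro b
      by_cases hb : b = M
      · have e : (S ∪ T).filter (fun i => (if i ∈ S then M else bin i) = b) = S := by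
          ext i
          simp only [Finset.mem_filter, Finset.mem_union]
          constructor
          · rintro ⟨hi | hi, he⟩
            · exact hi
            · rw [if_neg (hnot i hi)] at he
              have := hbin i hi
              omega
          · intro hi
            exact ⟨Or.inl hi, by rw [if_pos hi, hb]⟩
        rw [e]
        exact key _ _ _ _ _ (fun i hi => by simp [hi]) hp'
      · have e : (S ∪ T).filter (fun i => (if i ∈ S then M else bin i) = b) =
            T.filter (fun i => bin i = b) := by
          ext i
          simp only [Finset.mem_filter, Finset.mem_union]
          constructor
          · rintro ⟨hi, he⟩
            by_cases hiS : i ∈ S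
            · rw [if_pos hiS] at he
              exact absurd he.symm hb
            · rw [if_neg hiS] at he
              exact ⟨hi.resolve_left hiS, he⟩
          · rintro ⟨hi, he⟩
            exact ⟨Or.inr hi, by rw [if_neg (hnot i hi), he]⟩
        rw [e]
        refine key _ _ _ _ _ (fun i hi => ?_) (hp b)
        simp [hnot i (Finset.mem_of_mem_filter i hi)]

lemma BinPack.optg_le [Fintype ι] (hw : ∀ i, 0 < w i) (hh : ∀ i, 0 < h i) {M : ℕ}
    (H : BinPack w h Finset.univ M) : optg w h ≤ M := by
  obtain ⟨bin, x, y, hbin, hp⟩ := H.exists_placement hw hh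
  have hin := fun i => (hp (bin i)).1 i (by simp)
  refine Nat.sInf_le ⟨⟨fun i => ⟨bin i, hbin i (Finset.mem_univ i)⟩, x, y, fun i => (hin i).1,
    fun i => (hin i).2.2.1, fun i => by simpa using (hin i).2.1,
    fun i => by simpa using (hin i).2.2.2, ?_⟩, ?_⟩
  · intro i j hij hb
    have hb' : bin i = bin j := by simpa using hb
    have hsep := (hp (bin i)).2.1 i (by simp) j (by simp [hb']) hij
    ext ⟨u, v⟩
    simp only [Set.mem_inter_iff, Set.mem_prod, Set.mem_Ioo, Set.mem_empty_iff_false, iff_false]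
    rintro ⟨⟨⟨h1, h2⟩, h3, h4⟩, ⟨h5, h6⟩, h7, h8⟩
    rcases hsep with h | h | h | h <;> linarith
  · intro b
    have := (hp b.1).2.2
    simp only [zero_add] at this
    have e : (Finset.univ.filter fun i => (⟨bin i, hbin i (Finset.mem_univ i)⟩ : Fin M) = b) =
        Finset.univ.filter fun i => bin i = b.1 := by
      ext i
      simp [Fin.ext_iff]
    rw [← e] at this
    exact this

end Boxes

section Greedy

variable {ι : Type} [DecidableEq ι] {w h : ι → ℝ}

/-- Greedy selection in order of decreasing key `k` under a capacity `g`. -/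
lemma exists_greedy_subset (k u : ι → ℝ) (g : ℝ) (hg : 0 ≤ g) (T : Finset ι) :
    ∃ Q ⊆ T, (∀ i ∈ Q, ∀ j ∈ T \ Q, k j ≤ k i) ∧ ∑ i ∈ Q, u i ≤ g ∧
      (Q = T ∨ ∃ j ∈ T \ Q, (∀ i ∈ T \ Q, k i ≤ k j) ∧ g < ∑ i ∈ Q, u i + u j) := by
  induction T using Finset.induction_on_min_value k with
  | empty => exact ⟨∅, by simp, by simp, by simpa using hg, Or.inl rfl⟩
  | insert a s ha hmin ih =>
    obtain ⟨Q, hQs, htop, hsum, hQ⟩ := ih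
    have haQ : a ∉ Q := fun h => ha (hQs h)
    have htop' : ∀ i ∈ Q, ∀ j ∈ insert a s \ Q, k j ≤ k i := by
      intro i hi j hj
      rw [Finset.mem_sdiff, Finset.mem_insert] at hj
      rcases hj.1 with rfl | hjs
      · exact hmin i (hQs hi)
      · exact htop i hi j (Finset.mem_sdiff.2 ⟨hjs, hj.2⟩)
    rcases hQ with rfl | ⟨j, hj, hjmax, hjg⟩
    · by_cases hc : ∑ i ∈ Q, u i + u a ≤ g
      · refine ⟨insert a Q, subset_rfl, by simp, ?_, Or.inl rfl⟩
        rw [Finset.sum_insert haQ]; linarith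
      · refine ⟨Q, Finset.subset_insert _ _, htop', hsum, Or.inr ⟨a, by simp [haQ], ?_, by
          linarith⟩⟩
        intro i hi
        rw [Finset.mem_sdiff, Finset.mem_insert] at hi
        rcases hi.1 with rfl | his
        · exact le_rfl
        · exact absurd his hi.2
    · refine ⟨Q, hQs.trans (Finset.subset_insert _ _), htop', hsum, Or.inr ⟨j, ?_, ?_, hjg⟩⟩
      · rw [Finset.mem_sdiff] at hj ⊢
        exact ⟨Finset.mem_insert_of_mem hj.1, hj.2⟩
      · intro i hi
        rw [Finset.mem_sdiff, Finset.mem_insert] at hi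
        rcases hi.1 with rfl | his
        · exact hmin j (Finset.mem_sdiff.1 hj).1
        · exact hjmax i (Finset.mem_sdiff.2 ⟨his, hi.2⟩)

lemma BoxPack.stack (hw : ∀ i, 0 < w i) (hh : ∀ i, 0 < h i) {r : ℝ} (hr : 0 ≤ r)
    (P : Finset ι) (hP : ∀ i ∈ P, w i ≤ r) {b : ℝ} (hb : ∑ i ∈ P, h i ≤ b) :
    BoxPack w h P r b := by
  suffices H : BoxPack w h P r (∑ i ∈ P, h i) from H.mono_right hw hh hb
  clear hb
  induction P using Finset.induction_on with
  | empty => exact .empty _ _ hr (by simp)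
  | insert a s ha ih =>
    rw [Finset.sum_insert ha, Finset.insert_eq]
    exact .above _ _ _ _ _ (Finset.disjoint_singleton_left.2 ha)
      (.single _ _ _ (hP a (by simp)) le_rfl) (ih fun i hi => hP i (by simp [hi]))

lemma BoxPack.row (hw : ∀ i, 0 < w i) (hh : ∀ i, 0 < h i) {b : ℝ} (hb : 0 ≤ b)
    (P : Finset ι) (hP : ∀ i ∈ P, h i ≤ b) {g : ℝ} (hg : ∑ i ∈ P, w i ≤ g) :
    BoxPack w h P g b :=
  (BoxPack.stack hh hw hb P hP hg).swap

/-- Shelf packing of items of width at most `ρ` by decreasing height. -/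
lemma exists_shelf_subset (hw : ∀ i, 0 < w i) (hh : ∀ i, 0 < h i) {ρ g : ℝ} (hg : 0 ≤ g)
    (T : Finset ι) (hρ : ∀ i ∈ T, w i ≤ ρ) {H : ℝ} (hH : ∀ i ∈ T, h i ≤ H) {t : ℝ} (ht : 0 ≤ t) :
    ∃ P ⊆ T, BoxPack w h P g t ∧
      (P = T ∨ (t - H) * max 0 (g - ρ) ≤ ∑ i ∈ P, w i * h i) := by
  induction hn : T.card using Nat.strong_induction_on generalizing T H t with
  | _ n ih =>
  rcases T.eq_empty_or_nonempty with rfl | hT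
  · exact ⟨∅, subset_rfl, .empty _ _ hg ht, Or.inl rfl⟩
  obtain ⟨i₀, hi₀, hmax⟩ := T.exists_max_image h hT
  have hm : 0 ≤ max 0 (g - ρ) := le_max_left _ _
  by_cases h0 : t < h i₀
  · refine ⟨∅, by simp, .empty _ _ hg ht, Or.inr ?_⟩
    rw [Finset.sum_empty]
    exact mul_nonpos_of_nonpos_of_nonneg (by linarith [hH i₀ hi₀]) hm
  push Not at h0
  obtain ⟨Q, hQT, htop, hsum, hQ⟩ := exists_greedy_subset h w g hg T
  have hQbox : BoxPack w h Q g (h i₀) :=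
    .row hw hh (hh i₀).le Q (fun i hi => hmax i (hQT hi)) hsum
  rcases hQ with rfl | ⟨j, hj, hjmax, hjg⟩
  · exact ⟨Q, subset_rfl, hQbox.mono_right hw hh h0, Or.inl rfl⟩
  have hjT := (Finset.mem_sdiff.1 hj).1
  rcases Q.eq_empty_or_nonempty with rfl | hQne
  · refine ⟨∅, by simp, .empty _ _ hg ht, Or.inr ?_⟩
    rw [Finset.sum_empty] at hjg ⊢
    rw [max_eq_left (by linarith [hρ j hjT]), mul_zero]
  have hcard : (T \ Q).card < n := by
    rw [← hn]
    exact Finset.card_lt_card (Finset.sdiff_ssubset hQT hQne)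
  obtain ⟨P, hPT, hPbox, hP⟩ := ih _ hcard (T \ Q)
    (fun i hi => hρ i (Finset.mem_sdiff.1 hi).1) (H := h j) hjmax
    (t := t - h i₀) (by linarith) rfl
  have hdisj : Disjoint Q P := Finset.disjoint_of_subset_right hPT Finset.disjoint_sdiff
  refine ⟨Q ∪ P, Finset.union_subset hQT (hPT.trans Finset.sdiff_subset), ?_, ?_⟩
  · have := BoxPack.above _ _ _ _ _ hdisj hQbox hPbox
    rwa [add_sub_cancel] at this
  rcases hP with rfl | hP
  · exact Or.inl (Finset.union_sdiff_of_subset hQT)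
  right
  rw [Finset.sum_union hdisj]
  have hQa : h j * max 0 (g - ρ) ≤ ∑ i ∈ Q, w i * h i := by
    have h1 : ∑ i ∈ Q, w i * h j ≤ ∑ i ∈ Q, w i * h i :=
      Finset.sum_le_sum fun i hi => mul_le_mul_of_nonneg_left (htop i hi j hj) (hw i).le
    rw [← Finset.sum_mul] at h1
    have h2 : max 0 (g - ρ) ≤ ∑ i ∈ Q, w i :=
      max_le (Finset.sum_nonneg fun i _ => (hw i).le) (by linarith [hρ j hjT])
    calc h j * max 0 (g - ρ) ≤ h j * ∑ i ∈ Q, w i := mul_le_mul_of_nonneg_left h2 (hh j).le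
      _ = (∑ i ∈ Q, w i) * h j := mul_comm _ _
      _ ≤ _ := h1
  have : (t - H) * max 0 (g - ρ) ≤ (t - h i₀) * max 0 (g - ρ) :=
    mul_le_mul_of_nonneg_right (by linarith [hH i₀ hi₀]) hm
  nlinarith

/-- Bin packing of shelves of width one by next fit. -/
lemma exists_binPack_of_shelves (hw : ∀ i, 0 < w i) (hh : ∀ i, 0 < h i)
    (l : List (Finset ι × ℝ)) : ∀ (S : Finset ι) (u : ℝ), u ≤ 1 → BoxPack w h S 1 u →
    (∀ c ∈ l, BoxPack w h c.1 1 c.2 ∧ c.2 ≤ 1 ∧ Disjoint S c.1) →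
    l.Pairwise (fun c c' => Disjoint c.1 c'.1) →
    ∃ M : ℕ, BinPack w h (S ∪ (l.map Prod.fst).foldr (· ∪ ·) ∅) M ∧
      (M : ℝ) ≤ 1 + 2 * (l.map Prod.snd).sum + u := by
  induction l with
  | nil =>
    intro S u hu hS _ _
    refine ⟨1, ?_, ?_⟩
    · simpa using BinPack.cons S ∅ 0 (by simp) (hS.mono_right hw hh hu) (.nil 0)
    · have := (hS.nonneg hw hh).2
      simpa using this
  | cons c l ih =>
    intro S u hu hS hl hp
    rw [List.pairwise_cons] at hp
    obtain ⟨hc, hc1, hSc⟩ := hl c (by simp)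
    have hc0 := (hc.nonneg hw hh).2
    by_cases hfit : u + c.2 ≤ 1
    · obtain ⟨M, hM, hM'⟩ := ih (S ∪ c.1) (u + c.2) hfit (.above _ _ _ _ _ hSc hS hc)
        (fun d hd => ⟨(hl d (by simp [hd])).1, (hl d (by simp [hd])).2.1,
          Finset.disjoint_union_left.2 ⟨(hl d (by simp [hd])).2.2, hp.1 d hd⟩⟩) hp.2
      refine ⟨M, ?_, ?_⟩
      · simpa [Finset.union_assoc] using hM
      · simp only [List.map_cons, List.sum_cons]; linarith
    · obtain ⟨M, hM, hM'⟩ := ih c.1 c.2 hc1 hc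
        (fun d hd => ⟨(hl d (by simp [hd])).1, (hl d (by simp [hd])).2.1, hp.1 d hd⟩) hp.2
      refine ⟨M + 1, ?_, ?_⟩
      · simp only [List.map_cons, List.foldr_cons]
        refine .cons _ _ _ ?_ (hS.mono_right hw hh hu) hM
        rw [Finset.disjoint_union_right]
        refine ⟨hSc, ?_⟩
        have hall : ∀ d ∈ l, Disjoint S d.1 := fun d hd => (hl d (by simp [hd])).2.2
        clear hM hM' ih hp hl
        induction l with
        | nil => simp
        | cons d l ih =>
          simp only [List.map_cons, List.foldr_cons, Finset.disjoint_union_right]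
          exact ⟨hall d (by simp), ih fun e he => hall e (by simp [he])⟩
      · simp only [List.map_cons, List.sum_cons]; push_cast; linarith

/-- Any set of items can be split into shelves of total height at most twice its area plus the
largest height. -/
lemma exists_shelves (hw : ∀ i, 0 < w i ∧ w i ≤ 1) (hh : ∀ i, 0 < h i)
    (T : Finset ι) {H : ℝ} (hH0 : 0 ≤ H) (hH1 : H ≤ 1) (hH : ∀ i ∈ T, h i ≤ H) :
    ∃ l : List (Finset ι × ℝ), (∀ c ∈ l, BoxPack w h c.1 1 c.2 ∧ c.2 ≤ 1 ∧ c.1 ⊆ T) ∧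
      l.Pairwise (fun c c' => Disjoint c.1 c'.1) ∧
      (l.map Prod.fst).foldr (· ∪ ·) ∅ = T ∧
      (l.map Prod.snd).sum ≤ H + 2 * ∑ i ∈ T, w i * h i := by
  induction hn : T.card using Nat.strong_induction_on generalizing T H with
  | _ n ih =>
  have hpos : ∀ i, 0 ≤ w i * h i := fun i => mul_nonneg (hw i).1.le (hh i).le
  by_cases hwide : ∃ i ∈ T, 1 / 2 < w i
  · obtain ⟨i, hi, hiw⟩ := hwide
    obtain ⟨l, hl, hp, hU, hs⟩ := ih _ (by rw [← hn]; exact Finset.card_erase_lt_of_mem hi)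
      (T.erase i) hH0 hH1 (fun j hj => hH j (Finset.mem_of_mem_erase hj)) rfl
    refine ⟨({i}, h i) :: l, ?_, ?_, ?_, ?_⟩
    · rintro c (_ | ⟨_, hc⟩)
      · exact ⟨.single i _ _ (hw i).2 le_rfl, (hH i hi).trans hH1, by simpa using hi⟩
      · exact ⟨(hl c hc).1, (hl c hc).2.1, (hl c hc).2.2.trans (Finset.erase_subset _ _)⟩
    · rw [List.pairwise_cons]
      refine ⟨fun c hc => Finset.disjoint_singleton_left.2 fun hic => ?_, hp⟩
      simpa using (hl c hc).2.2 hic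
    · simp only [List.map_cons, List.foldr_cons, hU]
      rw [← Finset.insert_eq, Finset.insert_erase hi]
    · rw [← Finset.add_sum_erase T _ hi]
      simp only [List.map_cons, List.sum_cons]
      nlinarith [hh i]
  push Not at hwide
  obtain ⟨Q, hQT, htop, hsum, hQ⟩ := exists_greedy_subset h w 1 zero_le_one T
  have hQbox : BoxPack w h Q 1 H :=
    .row (fun i => (hw i).1) hh hH0 Q (fun i hi => hH i (hQT hi)) hsum
  rcases hQ with rfl | ⟨j, hj, hjmax, hjg⟩
  · refine ⟨[(Q, H)], by simp [hQbox, hH1], by simp, by simp, ?_⟩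
    have : 0 ≤ ∑ i ∈ Q, w i * h i := Finset.sum_nonneg fun i _ => hpos i
    simp only [List.map_cons, List.map_nil, List.sum_cons, List.sum_nil]
    linarith
  have hjT := (Finset.mem_sdiff.1 hj).1
  have hQne : Q.Nonempty := by
    rw [Finset.nonempty_iff_ne_empty]
    rintro rfl
    rw [Finset.sum_empty] at hjg
    linarith [(hw j).2]
  obtain ⟨l, hl, hp, hU, hs⟩ := ih _ (by
      rw [← hn]; exact Finset.card_lt_card (Finset.sdiff_ssubset hQT hQne))
    (T \ Q) (hh j).le ((hH j hjT).trans hH1) hjmax rfl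
  refine ⟨(Q, H) :: l, ?_, ?_, ?_, ?_⟩
  · rintro c (_ | ⟨_, hc⟩)
    · exact ⟨hQbox, hH1, hQT⟩
    · exact ⟨(hl c hc).1, (hl c hc).2.1, (hl c hc).2.2.trans Finset.sdiff_subset⟩
  · rw [List.pairwise_cons]
    exact ⟨fun c hc => Finset.disjoint_of_subset_right (hl c hc).2.2 Finset.disjoint_sdiff, hp⟩
  · simp only [List.map_cons, List.foldr_cons, hU]
    exact Finset.union_sdiff_of_subset hQT
  · rw [← Finset.sum_sdiff hQT]
    simp only [List.map_cons, List.sum_cons]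
    have h1 : ∑ i ∈ Q, w i * h j ≤ ∑ i ∈ Q, w i * h i :=
      Finset.sum_le_sum fun i hi => mul_le_mul_of_nonneg_left (htop i hi j hj) (hw i).1.le
    rw [← Finset.sum_mul] at h1
    nlinarith [hwide j hjT, hh j]

lemma exists_binPack_of_area (hw : ∀ i, 0 < w i ∧ w i ≤ 1) (hh : ∀ i, 0 < h i ∧ h i ≤ 1)
    (T : Finset ι) : ∃ M : ℕ, BinPack w h T M ∧ (M : ℝ) ≤ 3 + 4 * ∑ i ∈ T, w i * h i := by
  obtain ⟨l, hl, hp, hU, hs⟩ := exists_shelves hw (fun i => (hh i).1) T zero_le_one le_rfl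
    (fun i _ => (hh i).2)
  obtain ⟨M, hM, hM'⟩ := exists_binPack_of_shelves (fun i => (hw i).1) (fun i => (hh i).1) l ∅ 0
    zero_le_one (.empty _ _ zero_le_one le_rfl)
    (fun c hc => ⟨(hl c hc).1, (hl c hc).2.1, Finset.disjoint_empty_left _⟩) hp
  refine ⟨M, by rwa [hU, Finset.empty_union] at hM, by linarith⟩

end Greedy

section Lines

variable {ι : Type} [Fintype ι] {w h : ι → ℝ} {N : ℕ}

/-- Exchanging the two coordinates of a packing. -/
def BinPacking.transpose (P : BinPacking w h N) : BinPacking h w N where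
  bin := P.bin
  x := P.y
  y := P.x
  x_nonneg := P.y_nonneg
  y_nonneg := P.x_nonneg
  x_add_le := P.y_add_le
  y_add_le := P.x_add_le
  disj i j hij hb := by
    have := P.disj i j hij hb
    rw [Set.prod_inter_prod, Set.prod_eq_empty_iff] at this ⊢
    exact this.symm

lemma nonempty_binPacking_opt (hw : ∀ i, w i ≤ 1) (hh : ∀ i, h i ≤ 1) :
    Nonempty (BinPacking w h (opt w h)) := by
  refine Nat.sInf_mem (s := {N | Nonempty (BinPacking w h N)}) ⟨Fintype.card ι, ⟨?_⟩⟩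
  exact
    { bin := Fintype.equivFin ι
      x := 0
      y := 0
      x_nonneg := fun _ => le_rfl
      y_nonneg := fun _ => le_rfl
      x_add_le := by simpa using hw
      y_add_le := by simpa using hh
      disj := fun i j hij hb => absurd ((Fintype.equivFin ι).injective hb) hij }

lemma sum_width_le_one {C : Finset ι} (hw : ∀ i, 0 < w i) (P : BinPacking w h N) {b : Fin N} {t : ℝ}
    (hC : ∀ i ∈ C, P.bin i = b ∧ t ∈ Set.Ioo (P.y i) (P.y i + h i)) : ∑ i ∈ C, w i ≤ 1 := by
  have hd : Set.PairwiseDisjoint (C : Set ι) fun i => Set.Ioo (P.x i) (P.x i + w i) := by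
    intro i hi j hj hij
    have hi' := hC i hi
    have hj' := hC j hj
    have := P.disj i j hij (hi'.1.trans hj'.1.symm)
    rw [Set.prod_inter_prod, Set.prod_eq_empty_iff] at this
    rcases this with h' | h'
    · exact Set.disjoint_iff_inter_eq_empty.2 h'
    · have ht : t ∈ Set.Ioo (P.y i) (P.y i + h i) ∩ Set.Ioo (P.y j) (P.y j + h j) :=
        ⟨hi'.2, hj'.2⟩
      simp [h'] at ht
  have h1 := MeasureTheory.measureReal_biUnion_finset (μ := MeasureTheory.volume) hd
    (fun i _ => measurableSet_Ioo) (fun i _ => by simp)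
  have h2 : MeasureTheory.volume.real (⋃ i ∈ C, Set.Ioo (P.x i) (P.x i + w i)) ≤
      MeasureTheory.volume.real (Set.Icc (0 : ℝ) 1) := by
    refine MeasureTheory.measureReal_mono ?_ (by simp)
    refine Set.iUnion₂_subset fun i _ z hz => ⟨(P.x_nonneg i).trans hz.1.le, hz.2.le.trans
      (P.x_add_le i)⟩
  rw [h1] at h2
  simpa [(hw _).le] using h2

variable [DecidableEq ι]

/-- The horizontal lines through a packing, grouped by the set of items that they cross. -/
lemma BinPacking.exists_lines (hw : ∀ i, 0 < w i) (hh : ∀ i, 0 < h i) (P : BinPacking w h N) :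
    ∃ lam : Finset ι → ℝ, (∀ C, 0 ≤ lam C) ∧ ∑ C, lam C ≤ N ∧
      (∀ i, ∑ C with i ∈ C, lam C = h i) ∧ ∀ C, lam C ≠ 0 → ∑ i ∈ C, w i ≤ 1 := by
  classical
  let μ : MeasureTheory.Measure ℝ := MeasureTheory.volume.restrict (Set.Ioo 0 1)
  let c : Fin N → ℝ → Finset ι := fun b t =>
    Finset.univ.filter fun i => P.bin i = b ∧ t ∈ Set.Ioo (P.y i) (P.y i + h i)
  have hpre : ∀ b i, {t | i ∈ c b t} = if P.bin i = b then Set.Ioo (P.y i) (P.y i + h i) else ∅ := by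
    intro b i
    ext t
    by_cases hb : P.bin i = b <;> simp [c, hb]
  have hmeas1 : ∀ b i, MeasurableSet {t | i ∈ c b t} := by
    intro b i
    rw [hpre]
    split_ifs
    · exact measurableSet_Ioo
    · exact MeasurableSet.empty
  have hmeas : ∀ b C, MeasurableSet (c b ⁻¹' {C}) := by
    intro b C
    have : c b ⁻¹' {C} = ⋂ i, {t | i ∈ c b t ↔ i ∈ C} := by
      ext t
      simp [Finset.ext_iff]
    rw [this]
    refine MeasurableSet.iInter fun i => ?_
    by_cases hi : i ∈ C
    · simpa [hi] using hmeas1 b i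
    · simp only [hi, iff_false]
      exact (hmeas1 b i).compl
  have hsum : ∀ b (s : Finset (Finset ι)), ∑ C ∈ s, μ.real (c b ⁻¹' {C}) = μ.real (c b ⁻¹' ↑s) :=
    fun b s => MeasureTheory.sum_measureReal_preimage_singleton s (fun C _ => hmeas b C)
  refine ⟨fun C => ∑ b, μ.real (c b ⁻¹' {C}), fun C => Finset.sum_nonneg fun b _ =>
    MeasureTheory.measureReal_nonneg, ?_, ?_, ?_⟩
  · rw [Finset.sum_comm]
    simp only [hsum]
    simp [μ]
  · intro i
    rw [Finset.sum_comm]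
    simp only [hsum]
    have : ∀ b, μ.real (c b ⁻¹' ↑(Finset.univ.filter fun C : Finset ι => i ∈ C)) =
        if P.bin i = b then h i else 0 := by
      intro b
      have e : c b ⁻¹' ↑(Finset.univ.filter fun C : Finset ι => i ∈ C) = {t | i ∈ c b t} := by
        ext t; simp
      rw [e, hpre]
      split_ifs
      · have hsub : Set.Ioo (P.y i) (P.y i + h i) ⊆ Set.Ioo 0 1 :=
          Set.Ioo_subset_Ioo (P.y_nonneg i) (P.y_add_le i)
        simp [μ, MeasureTheory.measureReal_restrict_apply measurableSet_Ioo,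
          Set.inter_eq_left.2 hsub, (hh i).le]
      · simp
    rw [Finset.sum_congr rfl fun b _ => this b]
    simp
  · intro C hC
    obtain ⟨b, -, hb⟩ := Finset.exists_ne_zero_of_sum_ne_zero hC
    have : (c b ⁻¹' {C}).Nonempty := by
      rw [Set.nonempty_iff_ne_empty]
      intro he
      exact hb (by simp [he])
    obtain ⟨t, ht⟩ := this
    refine sum_width_le_one hw P (b := b) (t := t) fun i hi => ?_
    rw [Set.mem_preimage, Set.mem_singleton_iff] at ht
    rw [← ht] at hi
    simpa [c] using hi

lemma BinPacking.area_le (hw : ∀ i, 0 < w i) (hh : ∀ i, 0 < h i) (P : BinPacking w h N) :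
    ∑ i, w i * h i ≤ N := by
  obtain ⟨lam, h0, hN, hlam, hwid⟩ := P.exists_lines hw hh
  calc ∑ i, w i * h i = ∑ i, ∑ C, if i ∈ C then w i * lam C else 0 := by
        refine Finset.sum_congr rfl fun i _ => ?_
        rw [← hlam i, Finset.mul_sum, Finset.sum_filter]
    _ = ∑ C, (∑ i ∈ C, w i) * lam C := by
        rw [Finset.sum_comm]
        refine Finset.sum_congr rfl fun C _ => ?_
        rw [Finset.sum_mul]
        simp
    _ ≤ ∑ C, lam C := by
        refine Finset.sum_le_sum fun C _ => ?_
        by_cases hC : lam C = 0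
        · simp [hC]
        · nlinarith [hwid C hC, h0 C]
    _ ≤ N := hN

end Lines

section Grouping

variable {ι : Type} [DecidableEq ι] {w h : ι → ℝ}

/-- Linear grouping of the items of `S` into groups of total height at least `q`. The items of `E`
are exceptional, and `r (j + 1)` separates the widths of the groups `j` and `j + 1`. -/
lemma exists_grouping (hh : ∀ i, 0 < h i) {q : ℝ} (hq : 0 ≤ q) (K : ℕ) :
    ∀ S : Finset ι, (∀ i ∈ S, 1 / 4 ≤ w i ∧ w i ≤ 1) → ∑ i ∈ S, h i ≤ K * q →
    ∃ (g : ι → ℕ) (E : Finset ι) (r : ℕ → ℝ), E ⊆ S ∧ E.card ≤ K ∧ (∀ i ∈ S, g i < K) ∧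
      (∀ j, 1 / 4 ≤ r j) ∧ (∀ i ∈ S \ E, w i ≤ r (g i)) ∧ (∀ i ∈ S, r (g i + 1) ≤ w i) ∧
      ∑ i ∈ S \ E with g i = 0, h i ≤ q ∧
      ∀ j, ∑ i ∈ S \ E with g i = j + 1, h i ≤ ∑ i ∈ S with g i = j, h i := by
  have hsub : ∀ {A B : Finset ι}, A ⊆ B → ∑ i ∈ A, h i ≤ ∑ i ∈ B, h i := fun hAB =>
    Finset.sum_le_sum_of_subset_of_nonneg hAB fun i _ _ => (hh i).le
  induction K with
  | zero =>
    intro S _ hS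
    rcases S.eq_empty_or_nonempty with rfl | hne
    · exact ⟨fun _ => 0, ∅, fun _ => 1, by simp, by simp, by simp, by norm_num, by simp, by simp,
        by simpa using hq, by simp⟩
    · have := Finset.sum_pos (fun i _ => hh i) hne
      norm_num at hS
      linarith
  | succ K ih =>
    intro S hw hS
    obtain ⟨Q, hQS, htop, hsum, hQ⟩ := exists_greedy_subset w h q hq S
    rcases hQ with rfl | ⟨j₀, hj₀, hjmax, hjq⟩
    · refine ⟨fun _ => 0, ∅, fun j => if j = 0 then 1 else 1 / 4, by simp, by simp, by simp,
        fun j => by dsimp only; split_ifs <;> norm_num, fun i hi => ?_, fun i hi => ?_, ?_, ?_⟩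
      · simpa using (hw i (Finset.mem_sdiff.1 hi).1).2
      · simpa using (hw i hi).1
      · simpa using hsum
      · intro j
        simpa using Finset.sum_nonneg fun i (_ : i ∈ Q.filter fun _ => 0 = j) => (hh i).le
    rw [Finset.mem_sdiff] at hj₀
    have hAS : insert j₀ Q ⊆ S := Finset.insert_subset hj₀.1 hQS
    have hA : q < ∑ i ∈ insert j₀ Q, h i := by
      rw [Finset.sum_insert hj₀.2]; linarith
    have hsplit := Finset.sum_sdiff (f := h) hAS
    have hmemA : ∀ i ∈ S \ insert j₀ Q, i ∈ S ∧ i ≠ j₀ ∧ i ∉ Q := by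
      intro i hi
      simpa using hi
    obtain ⟨g, E, r, hES, hEK, hg, hr, hup, hlow, h0, hj⟩ := ih (S \ insert j₀ Q)
      (fun i hi => hw i (hmemA i hi).1) (by push_cast at hS; linarith)
    refine ⟨fun i => if i ∈ insert j₀ Q then 0 else g i + 1, insert j₀ E,
      fun j => if j = 0 then 1 else if j = 1 then w j₀ else r (j - 1), ?_, ?_, ?_, ?_, ?_, ?_, ?_,
      ?_⟩
    · exact Finset.insert_subset hj₀.1 (hES.trans Finset.sdiff_subset)
    · exact (Finset.card_insert_le _ _).trans (by omega)
    · intro i hi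
      dsimp only
      split_ifs with hiA
      · omega
      · have := hg i (Finset.mem_sdiff.2 ⟨hi, hiA⟩)
        omega
    · intro j
      dsimp only
      split_ifs
      · norm_num
      · exact (hw j₀ hj₀.1).1
      · exact hr _
    · intro i hi
      rw [Finset.mem_sdiff, Finset.mem_insert] at hi
      dsimp only
      by_cases hiA : i ∈ insert j₀ Q
      · simpa [hiA] using (hw i hi.1).2
      · simp only [hiA, if_false]
        have hiS : i ∈ S \ insert j₀ Q := Finset.mem_sdiff.2 ⟨hi.1, hiA⟩
        by_cases hgi : g i = 0
        · simpa [hgi] using hjmax i (Finset.mem_sdiff.2 ⟨hi.1, (hmemA i hiS).2.2⟩)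
        · simpa [hgi] using hup i (Finset.mem_sdiff.2 ⟨hiS, fun h => hi.2 (Or.inr h)⟩)
    · intro i hi
      dsimp only
      by_cases hiA : i ∈ insert j₀ Q
      · simp only [hiA, if_true]
        rw [Finset.mem_insert] at hiA
        rcases hiA with rfl | hiQ
        · simp
        · simpa using htop i hiQ j₀ (Finset.mem_sdiff.2 hj₀)
      · simpa [hiA] using hlow i (Finset.mem_sdiff.2 ⟨hi, hiA⟩)
    · refine (hsub fun i hi => ?_).trans hsum
      simp only [Finset.mem_filter, Finset.mem_sdiff, Finset.mem_insert, ite_eq_left_iff] at hi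
      by_contra hiQ
      have := hi.2 (by tauto)
      omega
    · intro j
      rcases Nat.eq_zero_or_pos j with rfl | hjpos
      · calc _ ≤ ∑ i ∈ (S \ insert j₀ Q) \ E with g i = 0, h i := by
              refine hsub fun i hi => ?_
              simp only [Finset.mem_filter, Finset.mem_sdiff, Finset.mem_insert] at hi ⊢
              split_ifs at hi with hiA <;> simp_all
          _ ≤ q := h0
          _ ≤ ∑ i ∈ insert j₀ Q, h i := hA.le
          _ ≤ _ := by
              refine hsub fun i hi => ?_
              rw [Finset.mem_filter]
              exact ⟨hAS hi, by simp [hi]⟩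
      · calc _ ≤ ∑ i ∈ (S \ insert j₀ Q) \ E with g i = (j - 1) + 1, h i := by
              refine hsub fun i hi => ?_
              simp only [Finset.mem_filter, Finset.mem_sdiff, Finset.mem_insert] at hi ⊢
              split_ifs at hi with hiA
              · exact hi.2.elim
              · exact ⟨⟨⟨hi.1.1, hiA⟩, fun h => hi.1.2 (Or.inr h)⟩, by omega⟩
          _ ≤ _ := hj (j - 1)
          _ ≤ _ := by
              refine hsub fun i hi => ?_
              simp only [Finset.mem_filter, Finset.mem_sdiff, Finset.mem_insert] at hi ⊢
              refine ⟨hi.1.1, ?_⟩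
              rw [if_neg hi.1.2]
              omega

end Grouping

section Configurations

variable {J : Type} [Fintype J]

/-- The total width of the slots of a configuration. -/
noncomputable def configWidth (r : J → ℝ) (n : J → ℕ) : ℝ := ∑ j, (n j : ℝ) * r j

lemma exists_multiple_width {a : ℝ} (ha0 : 0 < a) (ha1 : a ≤ 1) :
    ∃ m : ℕ, 1 ≤ m ∧ 1 / 2 ≤ m * a ∧ m * a ≤ 1 := by
  have h1 : 1 ≤ 1 / a := by rw [le_div_iff₀ ha0]; linarith
  refine ⟨⌊1 / a⌋₊, Nat.le_floor (by simpa using h1), ?_, ?_⟩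
  · have h2 := Nat.lt_floor_add_one (1 / a)
    rw [div_lt_iff₀ ha0] at h2
    have h3 : (1 : ℝ) ≤ ⌊1 / a⌋₊ := by exact_mod_cast Nat.le_floor (by simpa using h1)
    nlinarith
  · have h2 := Nat.floor_le (by positivity : 0 ≤ 1 / a)
    rwa [le_div_iff₀ ha0] at h2

/-- A conic combination of configurations of width at most one is a conic combination of few
configurations that are at least half full. -/
lemma exists_configs {r : J → ℝ} (hr : ∀ j, 0 < r j) {α : Type} (s : Finset α) (lam : α → ℝ)
    (hlam : ∀ C ∈ s, 0 ≤ lam C) (v : α → J → ℕ)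
    (hv : ∀ C ∈ s, lam C ≠ 0 → configWidth r (v C) ≤ 1) :
    ∃ l : List ((J → ℕ) × ℝ), l.length ≤ Fintype.card J + 1 ∧
      (∀ c ∈ l, 1 / 2 ≤ configWidth r c.1 ∧ configWidth r c.1 ≤ 1 ∧ 0 ≤ c.2) ∧
      (l.map fun c => c.2).sum ≤ ∑ C ∈ s, lam C ∧
      ∀ j, (l.map fun c => c.2 * (c.1 j : ℝ)).sum = ∑ C ∈ s, lam C * v C j := by
  classical
  let Z : Set (J → ℝ) := {z | ∃ n : J → ℕ, (1 / 2 ≤ configWidth r n ∧ configWidth r n ≤ 1) ∧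
    z = fun j => (n j : ℝ)}
  let A := s.filter fun C => lam C ≠ 0 ∧ v C ≠ 0
  have hwpos : ∀ n : J → ℕ, n ≠ 0 → 0 < configWidth r n := by
    intro n hn
    obtain ⟨j, hj⟩ := Function.ne_iff.1 hn
    refine Finset.sum_pos' (fun i _ => mul_nonneg (Nat.cast_nonneg _) (hr i).le) ⟨j, by simp, ?_⟩
    exact mul_pos (by exact_mod_cast Nat.pos_of_ne_zero hj) (hr j)
  have hm : ∀ C : α, ∃ m : ℕ, 1 ≤ m ∧ (C ∈ A → 1 / 2 ≤ configWidth r (m • v C) ∧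
      configWidth r (m • v C) ≤ 1) := by
    intro C
    by_cases hC : C ∈ A
    · have hC' := Finset.mem_filter.1 hC
      obtain ⟨m, h1, h2, h3⟩ := exists_multiple_width (hwpos _ hC'.2.2) (hv C hC'.1 hC'.2.1)
      have e : configWidth r (m • v C) = m * configWidth r (v C) := by
        simp [configWidth, Finset.mul_sum, mul_assoc]
      exact ⟨m, h1, fun _ => by rw [e]; exact ⟨h2, h3⟩⟩
    · exact ⟨1, le_rfl, fun h => absurd h hC⟩
  choose m hm1 hm2 using hm
  have hmpos : ∀ C, (1 : ℝ) ≤ m C := fun C => by exact_mod_cast hm1 C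
  let Λ : ℝ := ∑ C ∈ A, lam C / m C
  have hA0 : ∀ C ∈ A, 0 ≤ lam C / m C := fun C hC =>
    div_nonneg (hlam C (Finset.mem_filter.1 hC).1) (by linarith [hmpos C])
  have hΛ : Λ ≤ ∑ C ∈ s, lam C := by
    calc Λ ≤ ∑ C ∈ A, lam C := Finset.sum_le_sum fun C hC =>
          div_le_self (hlam C (Finset.mem_filter.1 hC).1) (hmpos C)
      _ ≤ _ := Finset.sum_le_sum_of_subset_of_nonneg (Finset.filter_subset _ _)
          fun C hC _ => hlam C hC
  have hsA : ∀ j, ∑ C ∈ s, lam C * v C j = ∑ C ∈ A, (lam C / m C) * ((m C • v C) j : ℕ) := by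
    intro j
    rw [Finset.sum_filter]
    refine Finset.sum_congr rfl fun C hC => ?_
    have := hmpos C
    split_ifs with hA
    · simp only [Pi.smul_apply, smul_eq_mul, Nat.cast_mul]
      field_simp
    · rw [not_and_or, not_not, not_not] at hA
      rcases hA with h | h <;> simp [h]
  rcases A.eq_empty_or_nonempty with hAe | hAne
  · refine ⟨[], by simp, by simp, ?_, ?_⟩
    · simpa using Finset.sum_nonneg hlam
    · intro j
      rw [hsA, hAe]
      simp
  have hΛpos : 0 < Λ := Finset.sum_pos (fun C hC => div_pos
    (lt_of_le_of_ne (hlam C (Finset.mem_filter.1 hC).1) (Finset.mem_filter.1 hC).2.1.symm)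
    (by linarith [hmpos C])) hAne
  have hmem := Finset.centerMass_mem_convexHull (R := ℝ) (s := Z) A (w := fun C => lam C / m C)
    (z := fun C j => ((m C • v C) j : ℝ)) hA0 hΛpos
    (fun C hC => ⟨m C • v C, hm2 C hC, rfl⟩)
  obtain ⟨β, _, z, ω, hz, haff, hω0, hω1, hsum⟩ := eq_pos_convex_span_of_mem_convexHull hmem
  choose nz hnz hnz' using fun b : β => hz (Set.mem_range_self b)
  refine ⟨Finset.univ.toList.map fun b => (nz b, Λ * ω b), ?_, ?_, ?_, ?_⟩
  · have h1 := haff.card_le_finrank_succ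
    have h2 := Submodule.finrank_le (vectorSpan ℝ (Set.range z))
    rw [Module.finrank_fintype_fun_eq_card] at h2
    simp only [List.length_map, Finset.length_toList, Finset.card_univ]
    omega
  · intro c hc
    simp only [List.mem_map, Finset.mem_toList, Finset.mem_univ, true_and] at hc
    obtain ⟨b, rfl⟩ := hc
    exact ⟨(hnz b).1, (hnz b).2, mul_nonneg hΛpos.le (hω0 b).le⟩
  · rw [List.map_map, Finset.sum_map_toList]
    simp only [Function.comp_def, ← Finset.mul_sum, hω1, mul_one]
    exact hΛ
  · intro j
    rw [List.map_map, Finset.sum_map_toList, hsA]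
    have h1 := congrFun hsum j
    rw [Finset.centerMass] at h1
    simp only [Finset.sum_apply, Pi.smul_apply, smul_eq_mul, hnz'] at h1
    simp only [Function.comp_def, mul_assoc, ← Finset.mul_sum]
    rw [h1, ← mul_assoc]
    change Λ * Λ⁻¹ * _ = _
    rw [mul_inv_cancel₀ hΛpos.ne', one_mul]
    simp

end Configurations

section Cut

variable {J : Type} [Fintype J]

/-- A list of configurations with multiplicities, sorted by width, each of which is at least half
full. -/
def ConfigList (r : J → ℝ) (l : List ((J → ℕ) × ℝ)) : Prop :=
  (∀ c ∈ l, 1 / 2 ≤ configWidth r c.1 ∧ configWidth r c.1 ≤ 1 ∧ 0 ≤ c.2) ∧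
    l.Pairwise fun c c' => configWidth r c'.1 ≤ configWidth r c.1

/-- The total height of the configurations, when each of them is enlarged by `δ`. -/
noncomputable def configLen (δ : ℝ) (l : List ((J → ℕ) × ℝ)) : ℝ := (l.map fun c => c.2 + δ).sum

/-- The total area of the configurations, plus `δ` for each of them. -/
noncomputable def configArea (δ : ℝ) (r : J → ℝ) (l : List ((J → ℕ) × ℝ)) : ℝ :=
  (l.map fun c => configWidth r c.1 * c.2 + δ).sum

/-- The total height of the slots of type `j`. -/
noncomputable def configCap (l : List ((J → ℕ) × ℝ)) (j : J) : ℝ :=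
  (l.map fun c => c.2 * (c.1 j : ℝ)).sum

/-- Lower bound for the area of the small items next to the configurations in a bin of width one. -/
noncomputable def configGap (r : J → ℝ) (W : ℝ) (l : List ((J → ℕ) × ℝ)) : ℝ :=
  (l.map fun c => c.2 * max 0 (W - 1 / 4 - configWidth r c.1)).sum

lemma ConfigList.exists_cut {δ : ℝ} (hδ : 0 < δ) {r : J → ℝ} (l : List ((J → ℕ) × ℝ)) :
    ConfigList r l → ∀ t : ℝ, 0 ≤ t → ∃ l₁ l₂ : List ((J → ℕ) × ℝ),
      (∀ c ∈ l₁, 0 ≤ c.2 ∧ ∃ c₀ ∈ l, c₀.1 = c.1) ∧ (∀ c ∈ l₂, ∃ c₀ ∈ l, c₀.1 = c.1) ∧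
      ConfigList r l₂ ∧ configLen δ l₁ ≤ t ∧
      (∀ j, configCap l j = configCap l₁ j + configCap l₂ j) ∧
      (l₂ = [] ∨ configLen δ l₂ ≤ configLen δ l - (t - δ)) ∧
      (∀ c l', l₂ = c :: l' →
        configArea δ r l₂ ≤ configArea δ r l - configWidth r c.1 * (t - δ)) ∧
      configArea δ r l₂ + 3 / 4 * (t - δ) ≤ configArea δ r l + configGap r 1 l₁ +
        3 / 4 * max 0 (t - configLen δ l₁ - δ) := by
  induction l with
  | nil =>
    intro _ t ht
    refine ⟨[], [], by simp, by simp, ⟨by simp, by simp⟩, by simpa [configLen] using ht,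
      by simp [configCap], by simp, by simp, ?_⟩
    have := le_max_right 0 (t - δ)
    simp only [configArea, configGap, configLen, List.map_nil, List.sum_nil]
    rw [sub_zero]
    linarith
  | cons c l ih =>
    rintro ⟨hval, hsort⟩ t ht
    rw [List.pairwise_cons] at hsort
    obtain ⟨hc, hc1, hμ⟩ := hval c (by simp)
    have hl : ConfigList r l := ⟨fun c hc => hval c (by simp [hc]), hsort.2⟩
    by_cases hfull : c.2 + δ ≤ t
    · obtain ⟨l₁, l₂, h1, h2, h3, h4, h5, h6, h7, h8⟩ := ih hl (t - (c.2 + δ)) (by linarith)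
      refine ⟨c :: l₁, l₂, ?_, ?_, h3, ?_, ?_, ?_, ?_, ?_⟩
      · rintro d (_ | ⟨_, hd⟩)
        · exact ⟨hμ, c, by simp, rfl⟩
        · obtain ⟨hd0, c₀, hc₀, e⟩ := h1 d hd
          exact ⟨hd0, c₀, by simp [hc₀], e⟩
      · intro d hd
        obtain ⟨c₀, hc₀, e⟩ := h2 d hd
        exact ⟨c₀, by simp [hc₀], e⟩
      · simp only [configLen, List.map_cons, List.sum_cons] at h4 ⊢
        linarith
      · intro j
        have := h5 j
        simp only [configCap, List.map_cons, List.sum_cons] at this ⊢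
        linarith
      · refine h6.imp id fun h6 => ?_
        simp only [configLen, List.map_cons, List.sum_cons] at h6 ⊢
        linarith
      · intro d l' he
        have := h7 d l' he
        obtain ⟨c₀, hc₀, e⟩ := h2 d (by simp [he])
        have hd := hsort.1 c₀ hc₀
        rw [e] at hd
        simp only [configArea, List.map_cons, List.sum_cons] at this ⊢
        nlinarith
      · have hmax := le_max_right 0 (1 - 1 / 4 - configWidth r c.1)
        have h4' : t - configLen δ (c :: l₁) - δ = t - (c.2 + δ) - configLen δ l₁ - δ := by
          simp only [configLen, List.map_cons, List.sum_cons]; ring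
        rw [h4']
        simp only [configArea, configGap, List.map_cons, List.sum_cons] at h8 ⊢
        nlinarith
    by_cases hδt : δ ≤ t
    · refine ⟨[(c.1, t - δ)], (c.1, c.2 - (t - δ)) :: l, ?_, ?_, ⟨?_, ?_⟩, ?_, ?_, ?_, ?_, ?_⟩
      · simp [hδt]
      · rintro d (_ | ⟨_, hd⟩)
        · exact ⟨c, by simp, rfl⟩
        · exact ⟨d, .tail _ hd, rfl⟩
      · rintro d (_ | ⟨_, hd⟩)
        · exact ⟨hc, hc1, by simp only; linarith⟩
        · exact hval d (.tail _ hd)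
      · rw [List.pairwise_cons]
        exact hsort
      · simp [configLen]
      · intro j
        simp only [configCap, List.map_cons, List.sum_cons, List.map_nil, List.sum_nil]
        ring
      · right
        simp only [configLen, List.map_cons, List.sum_cons]
        linarith
      · intro d l' he
        obtain ⟨rfl, rfl⟩ := List.cons.inj he
        simp only [configArea, List.map_cons, List.sum_cons]
        linarith
      · have hmax := le_max_right 0 (1 - 1 / 4 - configWidth r c.1)
        have hmax' := le_max_left 0 (t - configLen δ [(c.1, t - δ)] - δ)
        simp only [configArea, configGap, List.map_cons, List.sum_cons, List.map_nil,
          List.sum_nil]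
        nlinarith
    · push Not at hδt
      refine ⟨[], c :: l, by simp, fun d hd => ⟨d, hd, rfl⟩, ⟨hval, List.pairwise_cons.2 hsort⟩,
        by simpa [configLen] using ht, by simp [configCap], ?_, ?_, ?_⟩
      · right; linarith
      · intro d l' he
        obtain ⟨rfl, rfl⟩ := List.cons.inj he
        nlinarith
      · have hmax' := le_max_left 0 (t - configLen δ ([] : List ((J → ℕ) × ℝ)) - δ)
        simp only [configGap, List.map_nil, List.sum_nil]
        linarith

variable {ι : Type} [DecidableEq ι] {w h : ι → ℝ}

lemma exists_slot_subset {δ : ℝ} (hδ : 0 < δ) (D : Finset ι) (hD : ∀ i ∈ D, h i ≤ δ) {x : ℝ}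
    (hx : 0 ≤ x) : ∃ P ⊆ D, ∑ i ∈ P, h i ≤ x + δ ∧ (P = D ∨ x ≤ ∑ i ∈ P, h i) := by
  obtain ⟨Q, hQ, -, hsum, hor⟩ := exists_greedy_subset h h (x + δ) (by linarith) D
  refine ⟨Q, hQ, hsum, hor.imp id ?_⟩
  rintro ⟨j, hj, -, hlt⟩
  linarith [hD j (Finset.mem_sdiff.1 hj).1]

lemma exists_slots_subset (hw : ∀ i, 0 < w i) (hh : ∀ i, 0 < h i) {δ : ℝ} (hδ : 0 < δ) {ρ : ℝ}
    (hρ : 0 ≤ ρ) {x : ℝ} (hx : 0 ≤ x) (n : ℕ) (D : Finset ι)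
    (hD : ∀ i ∈ D, w i ≤ ρ ∧ h i ≤ δ) :
    ∃ P ⊆ D, BoxPack w h P (n * ρ) (x + δ) ∧ (P = D ∨ n * x ≤ ∑ i ∈ P, h i) := by
  induction n generalizing D with
  | zero => exact ⟨∅, by simp, by simpa using .empty _ _ le_rfl (by linarith), by simp⟩
  | succ n ih =>
    obtain ⟨P, hP, hsum, hor⟩ := exists_slot_subset hδ D (fun i hi => (hD i hi).2) hx
    obtain ⟨P', hP', hbox, hor'⟩ := ih (D \ P) fun i hi => hD i (Finset.mem_sdiff.1 hi).1
    have hdisj : Disjoint P P' := Finset.disjoint_of_subset_right hP' Finset.disjoint_sdiff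
    refine ⟨P ∪ P', Finset.union_subset hP (hP'.trans Finset.sdiff_subset), ?_, ?_⟩
    · have := BoxPack.beside _ _ _ _ _ hdisj
        (BoxPack.stack hw hh hρ P (fun i hi => (hD i (hP hi)).1) hsum) hbox
      have e : ((n + 1 : ℕ) : ℝ) * ρ = ρ + n * ρ := by push_cast; ring
      rwa [e]
    · rcases hor with rfl | hor
      · left
        rw [Finset.sdiff_self, Finset.subset_empty] at hP'
        simp [hP']
      rcases hor' with rfl | hor'
      · exact Or.inl (Finset.union_sdiff_of_subset hP)
      · right
        rw [Finset.sum_union hdisj]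
        push_cast
        linarith

variable [DecidableEq J]

lemma exists_config_subset (hw : ∀ i, 0 < w i) (hh : ∀ i, 0 < h i) {δ : ℝ} (hδ : 0 < δ)
    {r : J → ℝ} (hr : ∀ j, 0 < r j) (ty : ι → J) {x : ℝ} (hx : 0 ≤ x) (n : J → ℕ) (D : Finset ι)
    (hD : ∀ i ∈ D, w i ≤ r (ty i) ∧ h i ≤ δ) :
    ∃ P ⊆ D, BoxPack w h P (configWidth r n) (x + δ) ∧
      ∀ j, ∀ y : ℝ, 0 ≤ y → ∑ i ∈ D with ty i = j, h i ≤ n j * x + y →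
        ∑ i ∈ D \ P with ty i = j, h i ≤ y := by
  suffices H : ∀ s : Finset J, ∃ P ⊆ D, (∀ i ∈ P, ty i ∈ s) ∧
      BoxPack w h P (∑ j ∈ s, n j * r j) (x + δ) ∧
      ∀ j ∈ s, ∀ y : ℝ, 0 ≤ y → ∑ i ∈ D with ty i = j, h i ≤ n j * x + y →
        ∑ i ∈ D \ P with ty i = j, h i ≤ y by
    obtain ⟨P, h1, -, h2, h3⟩ := H Finset.univ
    exact ⟨P, h1, h2, fun j => h3 j (Finset.mem_univ j)⟩
  intro s
  induction s using Finset.induction_on with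
  | empty => exact ⟨∅, by simp, by simp, by simpa using .empty _ _ le_rfl (by linarith), by simp⟩
  | insert j s hj ih =>
    obtain ⟨P, hPD, hPs, hbox, hP⟩ := ih
    obtain ⟨P', hPD', hbox', hP'⟩ := exists_slots_subset hw hh hδ (hr j).le hx (n j)
      (D.filter fun i => ty i = j) (by
        intro i hi
        rw [Finset.mem_filter] at hi
        rw [← hi.2]
        exact hD i hi.1)
    have hty : ∀ i ∈ P', ty i = j := fun i hi => (Finset.mem_filter.1 (hPD' hi)).2
    have hdisj : Disjoint P' P := by
      rw [Finset.disjoint_left]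
      intro i hi hi'
      exact hj (hty i hi ▸ hPs i hi')
    refine ⟨P' ∪ P, Finset.union_subset (hPD'.trans (Finset.filter_subset _ _)) hPD, ?_, ?_, ?_⟩
    · intro i hi
      rw [Finset.mem_insert]
      exact (Finset.mem_union.1 hi).imp (hty i) (hPs i)
    · rw [Finset.sum_insert hj]
      exact .beside _ _ _ _ _ hdisj hbox' hbox
    · intro j' hj' y hy hle
      by_cases hjj : j' = j
      · subst hjj
        have e : (D \ (P' ∪ P)).filter (fun i => ty i = j') =
            (D.filter fun i => ty i = j') \ P' := by
          ext i
          simp only [Finset.mem_filter, Finset.mem_sdiff, Finset.mem_union]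
          constructor
          · tauto
          · rintro ⟨⟨hiD, hi⟩, hiP'⟩
            refine ⟨⟨hiD, ?_⟩, hi⟩
            rintro (h | h)
            · exact hiP' h
            · exact hj (hi ▸ hPs i h)
        rw [e]
        rcases hP' with rfl | hP'
        · simpa using hy
        · have := Finset.sum_sdiff (f := h) hPD'
          linarith
      · have hjs : j' ∈ s := (Finset.mem_insert.1 hj').resolve_left hjj
        refine le_trans ?_ (hP j' hjs y hy hle)
        refine Finset.sum_le_sum_of_subset_of_nonneg ?_ fun i _ _ => (hh i).le
        intro i hi
        simp only [Finset.mem_filter, Finset.mem_sdiff, Finset.mem_union] at hi ⊢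
        tauto

lemma exists_config_list_subset (hw : ∀ i, 0 < w i) (hh : ∀ i, 0 < h i) {δ : ℝ} (hδ : 0 < δ)
    {r : J → ℝ} (hr : ∀ j, 0 < r j) (ty : ι → J) {W : ℝ} (hW : 0 ≤ W)
    (l : List ((J → ℕ) × ℝ)) : (∀ c ∈ l, configWidth r c.1 ≤ W ∧ 0 ≤ c.2) →
    ∀ L T : Finset ι, Disjoint L T → (∀ i ∈ L, w i ≤ r (ty i) ∧ h i ≤ δ) →
    (∀ i ∈ T, w i ≤ 1 / 4 ∧ h i ≤ δ) →
    ∃ P ⊆ L, ∃ Q ⊆ T, BoxPack w h (P ∪ Q) W (configLen δ l) ∧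
      (∀ j, ∀ y : ℝ, 0 ≤ y → ∑ i ∈ L with ty i = j, h i ≤ configCap l j + y →
        ∑ i ∈ L \ P with ty i = j, h i ≤ y) ∧
      (Q = T ∨ configGap r W l ≤ ∑ i ∈ Q, w i * h i) := by
  induction l with
  | nil =>
    intro _ L T _ _ _
    exact ⟨∅, by simp, ∅, by simp, by simpa [configLen] using .empty _ _ hW le_rfl,
      by simp [configCap], by simp [configGap]⟩
  | cons c l ih =>
    intro hl L T hLT hL hT
    obtain ⟨hcW, hc⟩ := hl c (by simp)
    obtain ⟨P, hPL, hbox, hP⟩ := exists_config_subset hw hh hδ hr ty hc c.1 L hL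
    obtain ⟨Q, hQT, hboxQ, hQ⟩ := exists_shelf_subset hw hh (g := W - configWidth r c.1)
      (sub_nonneg.2 hcW) T (fun i hi => (hT i hi).1) (fun i hi => (hT i hi).2) (t := c.2 + δ)
      (by linarith)
    obtain ⟨P', hPL', Q', hQT', hbox', hP', hQ'⟩ := ih (fun c hc => hl c (by simp [hc]))
      (L \ P) (T \ Q) (hLT.mono Finset.sdiff_subset Finset.sdiff_subset)
      (fun i hi => hL i (Finset.mem_sdiff.1 hi).1) (fun i hi => hT i (Finset.mem_sdiff.1 hi).1)
    have hdQ : Disjoint Q Q' := Finset.disjoint_of_subset_right hQT' Finset.disjoint_sdiff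
    have hdP : Disjoint P P' := Finset.disjoint_of_subset_right hPL' Finset.disjoint_sdiff
    have hPL'' := hPL'.trans (Finset.sdiff_subset (s := L) (t := P))
    have hQT'' := hQT'.trans (Finset.sdiff_subset (s := T) (t := Q))
    refine ⟨P ∪ P', Finset.union_subset hPL hPL'', Q ∪ Q', Finset.union_subset hQT hQT'', ?_, ?_,
      ?_⟩
    · have h1 := BoxPack.beside _ _ _ _ _ (hLT.mono hPL hQT) hbox hboxQ
      rw [add_sub_cancel] at h1
      have h2 := BoxPack.above _ _ _ _ _ (by
        rw [Finset.disjoint_union_left, Finset.disjoint_union_right, Finset.disjoint_union_right]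
        exact ⟨⟨hdP, hLT.mono hPL hQT''⟩, (hLT.mono hPL'' hQT).symm, hdQ⟩) h1 hbox'
      rwa [Finset.union_union_union_comm] at h2
    · intro j y hy hle
      rw [show L \ (P ∪ P') = (L \ P) \ P' from sdiff_sdiff_left.symm]
      refine hP' j y hy (hP j _ ?_ ?_)
      · have : 0 ≤ configCap l j := List.sum_nonneg fun z hz => by
          obtain ⟨d, hd, rfl⟩ := List.mem_map.1 hz
          exact mul_nonneg (hl d (by simp [hd])).2 (Nat.cast_nonneg _)
        linarith
      · simp only [configCap, List.map_cons, List.sum_cons] at hle ⊢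
        linarith
    · rcases hQ with rfl | hQ
      · left
        rw [Finset.sdiff_self, Finset.subset_empty] at hQT'
        simp [hQT']
      rcases hQ' with rfl | hQ'
      · exact Or.inl (Finset.union_sdiff_of_subset hQT)
      · right
        rw [Finset.sum_union hdQ]
        have e : W - configWidth r c.1 - 1 / 4 = W - 1 / 4 - configWidth r c.1 := by ring
        rw [e] at hQ
        simp only [configGap, List.map_cons, List.sum_cons] at hQ' ⊢
        linarith

end Cut

section Strip

variable {ι : Type} [DecidableEq ι] {w h : ι → ℝ} {J : Type} [Fintype J]

lemma configLen_nonneg {δ : ℝ} (hδ : 0 < δ) {r : J → ℝ} {l : List ((J → ℕ) × ℝ)}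
    (hl : ConfigList r l) : 0 ≤ configLen δ l :=
  List.sum_nonneg fun z hz => by
    obtain ⟨c, hc, rfl⟩ := List.mem_map.1 hz
    linarith [(hl.1 c hc).2.2]

lemma configLen_le_configArea {δ : ℝ} (hδ : 0 < δ) {r : J → ℝ} {l : List ((J → ℕ) × ℝ)}
    (hl : ConfigList r l) : configLen δ l / 2 ≤ configArea δ r l := by
  rw [configLen, configArea, div_eq_mul_inv, ← List.sum_map_mul_right]
  refine List.sum_le_sum fun c hc => ?_
  obtain ⟨h1, h2, h3⟩ := hl.1 c hc
  nlinarith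

lemma union_sdiff_union_sdiff {L T P Q Q' : Finset ι} (hLT : Disjoint L T) (hP : P ⊆ L)
    (hQ : Q ⊆ T) (hQ' : Q' ⊆ T) : (L ∪ T) \ ((L \ P) ∪ ((T \ Q) \ Q')) = P ∪ Q ∪ Q' := by
  ext i
  have hd : i ∈ L → i ∉ T := fun hi hi' => Finset.disjoint_left.1 hLT hi hi'
  have hPi := @hP i
  have hQi := @hQ i
  have hQi' := @hQ' i
  simp only [Finset.mem_sdiff, Finset.mem_union]
  tauto

variable [DecidableEq J]

/-- The items of `L` (large) fit fractionally into the slots of the configurations `l`, the items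
of `T` are small, and all items have height at most `δ`. -/
structure StripState (w h : ι → ℝ) (δ : ℝ) (r : J → ℝ) (ty : ι → J) (L T : Finset ι)
    (l : List ((J → ℕ) × ℝ)) : Prop where
  disjoint : Disjoint L T
  large : ∀ i ∈ L, w i ≤ r (ty i) ∧ h i ≤ δ
  small : ∀ i ∈ T, w i ≤ 1 / 4 ∧ h i ≤ δ
  configs : ConfigList r l
  cap : ∀ j, ∑ i ∈ L with ty i = j, h i ≤ configCap l j

/-- Items to be packed into a strip of current width `ω`. Here `Φ` bounds the height of the strip
and `B` bounds the total area that is needed for it. -/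
def Strip (w h : ι → ℝ) (δ : ℝ) (r : J → ℝ) (ty : ι → J) (S : Finset ι) (Φ B ω : ℝ) : Prop :=
  ∃ (L T : Finset ι) (l : List ((J → ℕ) × ℝ)), StripState w h δ r ty L T l ∧ S = L ∪ T ∧
    1 / 2 ≤ ω ∧ ω ≤ 1 ∧ (∀ c ∈ l, configWidth r c.1 ≤ ω) ∧ (T.Nonempty → ω = 1) ∧
    configLen δ l ≤ Φ ∧
    (T.Nonempty → 4 / 3 * (configArea δ r l + ∑ i ∈ T, w i * h i) ≤ Φ) ∧
    Φ / 2 ≤ configArea δ r l + ∑ i ∈ T, w i * h i ∧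
    B = configArea δ r l + ∑ i ∈ T, w i * h i + ω

lemma Strip.bounds {δ : ℝ} (hδ : 0 < δ) {r : J → ℝ} {ty : ι → J} {S : Finset ι} {Φ B ω : ℝ}
    (H : Strip w h δ r ty S Φ B ω) :
    0 ≤ Φ ∧ 1 / 2 ≤ ω ∧ ω ≤ 1 ∧ Φ / 2 + ω ≤ B := by
  obtain ⟨L, T, l, hst, -, hω, hω1, -, -, hlen, -, hA, hB⟩ := H
  exact ⟨(configLen_nonneg hδ hst.configs).trans hlen, hω, hω1, by linarith⟩

lemma StripState.exists_cut (hw : ∀ i, 0 < w i) (hh : ∀ i, 0 < h i) {δ : ℝ} (hδ : 0 < δ)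
    {r : J → ℝ} (hr : ∀ j, 0 < r j) {ty : ι → J} {L T : Finset ι} {l : List ((J → ℕ) × ℝ)}
    (H : StripState w h δ r ty L T l) {ω : ℝ} (hω : 1 / 2 ≤ ω)
    (hl : ∀ c ∈ l, configWidth r c.1 ≤ ω) (hT : T.Nonempty → ω = 1) {t : ℝ} (ht : 0 ≤ t) :
    ∃ (L' T' : Finset ι) (l' : List ((J → ℕ) × ℝ)), L' ⊆ L ∧ T' ⊆ T ∧
      StripState w h δ r ty L' T' l' ∧ BoxPack w h ((L ∪ T) \ (L' ∪ T')) ω t ∧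
      (∀ c ∈ l', configWidth r c.1 ≤ ω) ∧
      (l' = [] ∨ configLen δ l' ≤ configLen δ l - (t - δ)) ∧
      (∀ c l'', l' = c :: l'' →
        configArea δ r l' ≤ configArea δ r l - configWidth r c.1 * (t - δ)) ∧
      (T'.Nonempty → configArea δ r l' + ∑ i ∈ T', w i * h i + 3 / 4 * (t - δ) ≤
        configArea δ r l + ∑ i ∈ T, w i * h i) := by
  obtain ⟨l₁, l₂, h1, h2, h3, h4, h5, h6, h7, h8⟩ := H.configs.exists_cut hδ l t ht
  have hω0 : 0 ≤ ω := by linarith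
  obtain ⟨P, hP, Q, hQ, hbox, hcap, hgap⟩ := exists_config_list_subset hw hh hδ hr ty hω0 l₁
    (fun c hc => by
      obtain ⟨hc0, c₀, hc₀, e⟩ := h1 c hc
      exact ⟨e ▸ hl c₀ hc₀, hc0⟩) L T H.disjoint H.large H.small
  obtain ⟨Q', hQ', hbox', hgap'⟩ := exists_shelf_subset hw hh hω0 (T \ Q)
    (fun i hi => (H.small i (Finset.mem_sdiff.1 hi).1).1)
    (fun i hi => (H.small i (Finset.mem_sdiff.1 hi).1).2) (sub_nonneg.2 h4)
  have hQ'' : Q' ⊆ T := hQ'.trans Finset.sdiff_subset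
  have hQd : Disjoint Q Q' := Finset.disjoint_of_subset_right hQ' Finset.disjoint_sdiff
  refine ⟨L \ P, (T \ Q) \ Q', l₂, Finset.sdiff_subset,
    Finset.sdiff_subset.trans Finset.sdiff_subset, ⟨?_, ?_, ?_, h3, ?_⟩, ?_, ?_, h6, h7, ?_⟩
  · exact H.disjoint.mono Finset.sdiff_subset (Finset.sdiff_subset.trans Finset.sdiff_subset)
  · exact fun i hi => H.large i (Finset.mem_sdiff.1 hi).1
  · exact fun i hi => H.small i (Finset.mem_sdiff.1 (Finset.mem_sdiff.1 hi).1).1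
  · intro j
    refine hcap j _ ?_ ((H.cap j).trans (h5 j).le)
    refine List.sum_nonneg fun z hz => ?_
    obtain ⟨c, hc, rfl⟩ := List.mem_map.1 hz
    exact mul_nonneg (h3.1 c hc).2.2 (Nat.cast_nonneg _)
  · have hd : Disjoint (P ∪ Q) Q' := Finset.disjoint_union_left.2 ⟨H.disjoint.mono hP hQ'', hQd⟩
    have := BoxPack.above _ _ _ _ _ hd hbox hbox'
    rw [add_sub_cancel] at this
    rwa [union_sdiff_union_sdiff H.disjoint hP hQ hQ'']
  · intro c hc
    obtain ⟨c₀, hc₀, e⟩ := h2 c hc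
    exact e ▸ hl c₀ hc₀
  · intro hne
    obtain ⟨i, hi⟩ := hne
    rw [Finset.mem_sdiff] at hi
    have hiTQ := Finset.mem_sdiff.1 hi.1
    have hω1 := hT ⟨i, hiTQ.1⟩
    subst hω1
    have hgap := hgap.resolve_left (by rintro rfl; exact hiTQ.2 hiTQ.1)
    have hgap' := hgap'.resolve_left (by rintro rfl; exact hi.2 hi.1)
    have e1 := Finset.sum_sdiff (f := fun i => w i * h i) hQ
    have e2 := Finset.sum_sdiff (f := fun i => w i * h i) hQ'
    have hpos : 0 ≤ ∑ i ∈ Q', w i * h i :=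
      Finset.sum_nonneg fun i _ => (mul_pos (hw i) (hh i)).le
    have hm : 3 / 4 * max 0 (t - configLen δ l₁ - δ) ≤ ∑ i ∈ Q', w i * h i := by
      rw [max_eq_right (by norm_num)] at hgap'
      rcases max_cases 0 (t - configLen δ l₁ - δ) with ⟨e, -⟩ | ⟨e, -⟩ <;> rw [e] <;> linarith
    linarith

/-- Cutting off the bottom part of height `t` of a strip. -/
lemma Strip.exists_cut (hw : ∀ i, 0 < w i) (hh : ∀ i, 0 < h i) {δ : ℝ} (hδ : 0 < δ)
    {r : J → ℝ} (hr : ∀ j, 0 < r j) {ty : ι → J} {S : Finset ι} {Φ B ω : ℝ}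
    (H : Strip w h δ r ty S Φ B ω) {t : ℝ} (htδ : δ ≤ t) (ht : t ≤ 1) :
    ∃ S' ⊆ S, BoxPack w h (S \ S') ω t ∧ (S' = ∅ ∨ ∃ Φ' B' ω', Strip w h δ r ty S' Φ' B' ω' ∧
      Φ' ≤ Φ - (t - δ) ∧ B' ≤ B - min ω (3 / 4) * (t - δ)) := by
  obtain ⟨L, T, l, hst, rfl, hω, hω1, hl, hT, hlen, hlenT, hA, rfl⟩ := H
  obtain ⟨L', T', l', hL', hT', hst', hbox, hl', hcut, hcutA, hcutT⟩ :=
    hst.exists_cut hw hh hδ hr hω hl hT (hδ.le.trans htδ)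
  refine ⟨L' ∪ T', Finset.union_subset_union hL' hT', hbox, ?_⟩
  have hlen0 := configLen_nonneg hδ hst'.configs
  have hlenA := configLen_le_configArea hδ hst'.configs
  have hmin1 := min_le_left ω (3 / 4)
  have hmin2 := min_le_right ω (3 / 4)
  have hT'0 : 0 ≤ ∑ i ∈ T', w i * h i := Finset.sum_nonneg fun i _ => (mul_pos (hw i) (hh i)).le
  have hT0 : 0 ≤ ∑ i ∈ T, w i * h i := Finset.sum_nonneg fun i _ => (mul_pos (hw i) (hh i)).le
  rcases T'.eq_empty_or_nonempty with rfl | hne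
  · rcases hl'' : l' with _ | ⟨c, l''⟩
    · left
      subst hl''
      rw [Finset.union_empty, Finset.eq_empty_iff_forall_notMem]
      intro i hi
      have h1 := hst'.cap (ty i)
      have h2 : 0 < ∑ k ∈ L' with ty k = ty i, h k :=
        Finset.sum_pos (fun k _ => hh k) ⟨i, by simp [hi]⟩
      simp only [configCap, List.map_nil, List.sum_nil] at h1
      linarith
    · right
      have hc : c ∈ l' := by simp [hl'']
      have hcω := hl' c hc
      obtain ⟨hc2, hc1, -⟩ := hst'.configs.1 c hc
      have hcut' := hcut.resolve_left (by simp [hl''])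
      have hcA := hcutA c l'' hl''
      refine ⟨configLen δ l', configArea δ r l' + 0 + configWidth r c.1, configWidth r c.1,
        ⟨L', ∅, l', hst', rfl, hc2, hc1, ?_, by simp, le_rfl, by simp, by simpa using hlenA,
          by simp⟩, by linarith, ?_⟩
      · intro d hd
        have hsort := hst'.configs.2
        rw [hl''] at hd hsort
        rw [List.pairwise_cons] at hsort
        rcases List.mem_cons.1 hd with rfl | hd
        · exact le_rfl
        · exact hsort.1 d hd
      · nlinarith
  · right
    have hω' : ω = 1 := hT (hne.mono hT')
    subst hω'
    have hc := hcutT hne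
    have hΦ := hlenT (hne.mono hT')
    refine ⟨max (configLen δ l') (4 / 3 * (configArea δ r l' + ∑ i ∈ T', w i * h i)),
      configArea δ r l' + ∑ i ∈ T', w i * h i + 1, 1,
      ⟨L', T', l', hst', rfl, hω, le_rfl, hl', fun _ => rfl, le_max_left _ _,
        fun _ => le_max_right _ _, ?_, rfl⟩, ?_, ?_⟩
    · rw [div_le_iff₀ two_pos]
      exact max_le (by linarith) (by linarith)
    · refine max_le ?_ (by linarith)
      rcases hcut with rfl | hcut
      · have : configLen δ ([] : List ((J → ℕ) × ℝ)) = 0 := by simp [configLen]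
        have h0 : configArea δ r ([] : List ((J → ℕ) × ℝ)) = 0 := by simp [configArea]
        rw [this]
        linarith
      · linarith
    · nlinarith

end Strip

section Combine

variable {ι : Type} [DecidableEq ι] {w h : ι → ℝ}

/-- `F S Φ B ω` describes strips with items `S` and current width `ω`, from which a piece of any
height `t ≥ δ` can be cut off, reducing `Φ` and `B`. -/
def Cuttable (w h : ι → ℝ) (δ : ℝ) (F : Finset ι → ℝ → ℝ → ℝ → Prop) : Prop :=
  ∀ S Φ B ω, F S Φ B ω → (0 ≤ Φ ∧ 1 / 2 ≤ ω ∧ ω ≤ 1 ∧ Φ / 2 + ω ≤ B) ∧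
    ∀ t, δ ≤ t → t ≤ 1 → ∃ S' ⊆ S, BoxPack w h (S \ S') ω t ∧
      (S' = ∅ ∨ ∃ Φ' B' ω', F S' Φ' B' ω' ∧ Φ' ≤ Φ - (t - δ) ∧ B' ≤ B - min ω (3 / 4) * (t - δ))

lemma Strip.cuttable {J : Type} [Fintype J] [DecidableEq J] (hw : ∀ i, 0 < w i)
    (hh : ∀ i, 0 < h i) {δ : ℝ} (hδ : 0 < δ) {r : J → ℝ} (hr : ∀ j, 0 < r j) (ty : ι → J) :
    Cuttable w h δ (Strip w h δ r ty) :=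
  fun _ _ _ _ H => ⟨H.bounds hδ, fun _ h1 h2 => H.exists_cut hw hh hδ hr h1 h2⟩

/-- The factor by which the restriction to skewed items increases the number of bins. -/
noncomputable def skewFactor (x y : ℝ) : ℝ := 1 + 2 * (x / (1 - x)) + 2 * (y / (1 - y))

lemma skewFactor_comm (x y : ℝ) : skewFactor x y = skewFactor y x := by
  unfold skewFactor; ring

lemma le_div_one_sub {x : ℝ} (hx0 : 0 < x) (hx1 : x < 1) : x ≤ x / (1 - x) := by
  rw [le_div_iff₀ (by linarith)]
  nlinarith

lemma one_add_le_skewFactor {x y : ℝ} (hx0 : 0 < x) (hx1 : x < 1) (hy0 : 0 < y) (hy1 : y < 1) :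
    1 + 2 * x + 2 * y ≤ skewFactor x y := by
  unfold skewFactor
  linarith [le_div_one_sub hx0 hx1, le_div_one_sub hy0 hy1]

lemma one_add_le_skewFactor_mul {x y : ℝ} (hx1 : x < 1) (hy0 : 0 < y)
    (hy1 : y < 1) : 1 + x ≤ skewFactor x y * (1 - x) := by
  have h1 : x / (1 - x) * (1 - x) = x := div_mul_cancel₀ _ (by linarith)
  have h2 : 0 ≤ y / (1 - y) * (1 - x) :=
    mul_nonneg (div_nonneg hy0.le (by linarith)) (by linarith)
  have h3 : skewFactor x y * (1 - x) =
      (1 - x) + 2 * (x / (1 - x) * (1 - x)) + 2 * (y / (1 - y) * (1 - x)) := by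
    unfold skewFactor; ring
  rw [h3, h1]
  linarith

lemma one_le_skewFactor_mul_area {x y ω : ℝ} (hx0 : 0 < x) (hx1 : x < 1) (hy0 : 0 < y)
    (hy1 : y < 1) (hω : 1 / 2 ≤ ω) :
    1 ≤ 4 / 3 * skewFactor x y * (min ω (3 / 4) * (1 - x) + max 0 (1 - ω - y) / 2) := by
  have h1 := one_add_le_skewFactor_mul hx1 hy0 hy1
  have h1' := one_add_le_skewFactor_mul hy1 hx0 hx1
  rw [skewFactor_comm] at h1'
  have h2 := one_add_le_skewFactor hx0 hx1 hy0 hy1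
  set κ := skewFactor x y with hκ
  have hm0 := le_max_left 0 (1 - ω - y)
  have hm1 := le_max_right 0 (1 - ω - y)
  have hκ0 : 0 ≤ κ := by linarith
  have hκm : 0 ≤ κ * max 0 (1 - ω - y) := mul_nonneg hκ0 hm0
  rcases le_total (3 / 4) ω with h | h
  · rw [min_eq_right h]
    nlinarith
  rw [min_eq_left h]
  by_cases hx : 1 / 2 ≤ x
  · have : ω * (1 + x) ≤ ω * (κ * (1 - x)) := mul_le_mul_of_nonneg_left h1 (by linarith)
    nlinarith
  push Not at hx
  by_cases hs : x + y ≤ 1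
  · have h3 : 3 / 4 - x / 2 - y / 2 ≤ ω * (1 - x) + max 0 (1 - ω - y) / 2 := by nlinarith
    have h4 : (3 / 4 - x / 2 - y / 2) * (1 + 2 * x + 2 * y) ≤
        (ω * (1 - x) + max 0 (1 - ω - y) / 2) * κ :=
      mul_le_mul h3 h2 (by linarith) (by linarith)
    nlinarith
  · have h3 : 3 ≤ κ := by nlinarith
    have h4 : 1 / 4 ≤ ω * (1 - x) := by nlinarith
    have h5 : 1 / 4 * 3 ≤ ω * (1 - x) * κ := mul_le_mul h4 h3 (by norm_num) (by linarith)
    nlinarith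

lemma Cuttable.binPack (hw : ∀ i, 0 < w i) (hh : ∀ i, 0 < h i) {δ κ : ℝ} (hδ1 : δ < 1)
    (hκ : 1 ≤ κ * (1 - δ)) {F : Finset ι → ℝ → ℝ → ℝ → Prop} (HF : Cuttable w h δ F) (M : ℕ) :
    ∀ S Φ B ω, F S Φ B ω → κ * Φ ≤ M → BinPack w h S (M + 1) := by
  induction M with
  | zero =>
    intro S Φ B ω hF hM
    obtain ⟨⟨hΦ, -, hω1, -⟩, hcut⟩ := HF S Φ B ω hF
    obtain ⟨S', hS', hbox, rfl | ⟨Φ', B', ω', hF', h1, -⟩⟩ := hcut 1 hδ1.le le_rfl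
    · simpa using BinPack.cons _ _ 0 (Finset.disjoint_empty_right _) (hbox.mono_left hw hh hω1)
        (.nil 0)
    · have := (HF S' Φ' B' ω' hF').1.1
      have hκ0 : 0 < κ := by nlinarith
      norm_num at hM
      nlinarith
  | succ M ih =>
    intro S Φ B ω hF hM
    obtain ⟨⟨hΦ, -, hω1, -⟩, hcut⟩ := HF S Φ B ω hF
    obtain ⟨S', hS', hbox, hor⟩ := hcut 1 hδ1.le le_rfl
    have hrest : BinPack w h S' (M + 1) := by
      rcases hor with rfl | ⟨Φ', B', ω', hF', h1, -⟩
      · exact .nil _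
      · refine ih S' Φ' B' ω' hF' ?_
        have hκ0 : 0 < κ := by nlinarith
        push_cast at hM
        nlinarith
    have := BinPack.cons _ _ _ Finset.sdiff_disjoint (hbox.mono_left hw hh hω1) hrest
    rwa [Finset.sdiff_union_of_subset hS'] at this

lemma Cuttable.exists_bin (hw : ∀ i, 0 < w i) (hh : ∀ i, 0 < h i) {x y : ℝ} (hx0 : 0 < x)
    (hx1 : x < 1) (hy0 : 0 < y) (hy1 : y < 1) {F G : Finset ι → ℝ → ℝ → ℝ → Prop}
    (HF : Cuttable w h x F) (HG : Cuttable h w y G) {M : ℕ} {S₁ S₂ : Finset ι}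
    {Φ₁ Φ₂ B₁ B₂ ω₁ ω₂ : ℝ} (hS : Disjoint S₁ S₂) (hF : F S₁ Φ₁ B₁ ω₁) (hG : G S₂ Φ₂ B₂ ω₂)
    (hΦ : Φ₂ ≤ Φ₁) (h₁ : skewFactor x y * Φ₁ ≤ M + 1)
    (hB : 4 / 3 * skewFactor x y * (B₁ + B₂) ≤ M + 1) :
    ∃ S₁' ⊆ S₁, ∃ S₂' ⊆ S₂, BoxPack w h ((S₁ \ S₁') ∪ (S₂ \ S₂')) 1 1 ∧
      ∃ Φ₁' B₁' ω₁' Φ₂' B₂' ω₂', (S₁' = ∅ ∨ F S₁' Φ₁' B₁' ω₁') ∧ (S₂' = ∅ ∨ G S₂' Φ₂' B₂' ω₂') ∧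
        skewFactor x y * Φ₁' ≤ M ∧ skewFactor x y * Φ₂' ≤ M ∧
        (S₁' = ∅ ∨ S₂' = ∅ ∨ 4 / 3 * skewFactor x y * (B₁' + B₂') ≤ M) := by
  obtain ⟨⟨hΦ₁, hω₁, hω₁', hB₁⟩, hcut₁⟩ := HF _ _ _ _ hF
  obtain ⟨⟨hΦ₂, hω₂, hω₂', hB₂⟩, hcut₂⟩ := HG _ _ _ _ hG
  have hκ1 := one_add_le_skewFactor hx0 hx1 hy0 hy1
  have hκx := one_add_le_skewFactor_mul hx1 hy0 hy1
  have harea := one_le_skewFactor_mul_area hx0 hx1 hy0 hy1 hω₁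
  set κ := skewFactor x y
  have hM0 : (0 : ℝ) ≤ M := Nat.cast_nonneg M
  have hκ0 : 0 ≤ κ := by linarith
  have hκΦ₂ : κ * Φ₂ ≤ M := by
    have h3 : κ * Φ₂ ≤ κ * (B₁ + B₂ - 1) := mul_le_mul_of_nonneg_left (by linarith) hκ0
    nlinarith
  obtain ⟨S₁', hS₁', hbox₁, hor₁⟩ := hcut₁ 1 hx1.le le_rfl
  have key : ∃ S₂' ⊆ S₂, BoxPack w h (S₂ \ S₂') (1 - ω₁) 1 ∧ (S₂' = ∅ ∨
      ∃ Φ₂' B₂' ω₂', G S₂' Φ₂' B₂' ω₂' ∧ Φ₂' ≤ Φ₂ ∧ B₂' ≤ B₂ - max 0 (1 - ω₁ - y) / 2) := by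
    by_cases hy : y ≤ 1 - ω₁
    · obtain ⟨S₂', hS₂', hbox₂, hor₂⟩ := hcut₂ (1 - ω₁) hy (by linarith)
      refine ⟨S₂', hS₂', hbox₂.swap.mono_right hw hh hω₂', hor₂.imp id ?_⟩
      rintro ⟨Φ₂', B₂', ω₂', hG', h3, h4⟩
      refine ⟨Φ₂', B₂', ω₂', hG', by linarith, ?_⟩
      have hmin : 1 / 2 ≤ min ω₂ (3 / 4) := le_min hω₂ (by norm_num)
      rw [max_eq_right (by linarith)]
      nlinarith
    · push Not at hy
      refine ⟨S₂, subset_rfl, ?_, Or.inr ⟨Φ₂, B₂, ω₂, hG, le_rfl, ?_⟩⟩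
      · rw [Finset.sdiff_self]
        exact .empty _ _ (by linarith) zero_le_one
      · rw [max_eq_left (by linarith)]
        linarith
  obtain ⟨S₂', hS₂', hbox₂, hor₂⟩ := key
  have hbox := BoxPack.beside _ _ _ _ _ (hS.mono Finset.sdiff_subset Finset.sdiff_subset)
    hbox₁ hbox₂
  rw [add_sub_cancel] at hbox
  refine ⟨S₁', hS₁', S₂', hS₂', hbox, ?_⟩
  have hz : κ * 0 ≤ M := by simp
  have hG'' : ∀ {Φ : ℝ}, Φ ≤ Φ₂ → κ * Φ ≤ M := fun h =>
    (mul_le_mul_of_nonneg_left h hκ0).trans hκΦ₂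
  have hF'' : ∀ {Φ : ℝ}, Φ ≤ Φ₁ - (1 - x) → κ * Φ ≤ M := fun {Φ} h => by
    have := mul_le_mul_of_nonneg_left h hκ0
    nlinarith
  rcases hor₁ with h1 | ⟨Φ₁', B₁', ω₁', hF', h3, h4⟩ <;>
    rcases hor₂ with h2 | ⟨Φ₂', B₂', ω₂', hG', h5, h6⟩
  · exact ⟨0, 0, 0, 0, 0, 0, Or.inl h1, Or.inl h2, hz, hz, Or.inl h1⟩
  · exact ⟨0, 0, 0, Φ₂', B₂', ω₂', Or.inl h1, Or.inr hG', hz, hG'' h5, Or.inl h1⟩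
  · exact ⟨Φ₁', B₁', ω₁', 0, 0, 0, Or.inr hF', Or.inl h2, hF'' h3, hz, Or.inr (Or.inl h2)⟩
  · refine ⟨Φ₁', B₁', ω₁', Φ₂', B₂', ω₂', Or.inr hF', Or.inr hG', hF'' h3, hG'' h5,
      Or.inr (Or.inr ?_)⟩
    have : 4 / 3 * κ * (B₁' + B₂') ≤ 4 / 3 * κ *
        (B₁ + B₂ - (min ω₁ (3 / 4) * (1 - x) + max 0 (1 - ω₁ - y) / 2)) :=
      mul_le_mul_of_nonneg_left (by linarith) (by linarith)
    linarith

lemma Cuttable.binPack_union (hw : ∀ i, 0 < w i) (hh : ∀ i, 0 < h i) {x y : ℝ} (hx0 : 0 < x)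
    (hx1 : x < 1) (hy0 : 0 < y) (hy1 : y < 1) {F G : Finset ι → ℝ → ℝ → ℝ → Prop}
    (HF : Cuttable w h x F) (HG : Cuttable h w y G) (M : ℕ) :
    ∀ (S₁ S₂ : Finset ι) (Φ₁ Φ₂ B₁ B₂ ω₁ ω₂ : ℝ), Disjoint S₁ S₂ → F S₁ Φ₁ B₁ ω₁ →
      G S₂ Φ₂ B₂ ω₂ → skewFactor x y * Φ₁ ≤ M → skewFactor x y * Φ₂ ≤ M →
      4 / 3 * skewFactor x y * (B₁ + B₂) ≤ M → BinPack w h (S₁ ∪ S₂) (M + 1) := by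
  have hκ1 := one_add_le_skewFactor hx0 hx1 hy0 hy1
  have hκx := one_add_le_skewFactor_mul hx1 hy0 hy1
  have hκy := one_add_le_skewFactor_mul hy1 hx0 hx1
  rw [skewFactor_comm] at hκy
  induction M with
  | zero =>
    intro S₁ S₂ Φ₁ Φ₂ B₁ B₂ ω₁ ω₂ _ hF hG _ _ hB
    obtain ⟨hΦ₁, hω₁, -, hB₁⟩ := (HF _ _ _ _ hF).1
    obtain ⟨hΦ₂, hω₂, -, hB₂⟩ := (HG _ _ _ _ hG).1
    norm_num at hB
    nlinarith
  | succ M ih =>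
    intro S₁ S₂ Φ₁ Φ₂ B₁ B₂ ω₁ ω₂ hS hF hG h₁ h₂ hB
    push_cast at h₁ h₂ hB
    have step : ∃ S₁' ⊆ S₁, ∃ S₂' ⊆ S₂, BoxPack w h ((S₁ \ S₁') ∪ (S₂ \ S₂')) 1 1 ∧
        ∃ Φ₁' B₁' ω₁' Φ₂' B₂' ω₂', (S₁' = ∅ ∨ F S₁' Φ₁' B₁' ω₁') ∧
          (S₂' = ∅ ∨ G S₂' Φ₂' B₂' ω₂') ∧
          skewFactor x y * Φ₁' ≤ M ∧ skewFactor x y * Φ₂' ≤ M ∧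
          (S₁' = ∅ ∨ S₂' = ∅ ∨ 4 / 3 * skewFactor x y * (B₁' + B₂') ≤ M) := by
      rcases le_total Φ₂ Φ₁ with hΦ | hΦ
      · exact HF.exists_bin hw hh hx0 hx1 hy0 hy1 HG hS hF hG hΦ h₁ hB
      · obtain ⟨S₂', hS₂', S₁', hS₁', hbox, Φ₂', B₂', ω₂', Φ₁', B₁', ω₁', h3, h4, h5, h6, h7⟩ :=
          HG.exists_bin hh hw hy0 hy1 hx0 hx1 HF hS.symm hG hF hΦ
            (by rwa [skewFactor_comm]) (by rwa [skewFactor_comm, add_comm B₂])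
        rw [skewFactor_comm] at h5 h6 h7
        refine ⟨S₁', hS₁', S₂', hS₂', ?_, Φ₁', B₁', ω₁', Φ₂', B₂', ω₂', h4, h3, h6, h5, ?_⟩
        · rw [Finset.union_comm]
          exact hbox.swap
        · rw [add_comm B₁']
          tauto
    obtain ⟨S₁', hS₁', S₂', hS₂', hbox, Φ₁', B₁', ω₁', Φ₂', B₂', ω₂', h3, h4, h5, h6, h7⟩ := step
    have hrest : BinPack w h (S₁' ∪ S₂') (M + 1) := by
      rcases h3 with rfl | h3
      · rw [Finset.empty_union]
        rcases h4 with rfl | h4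
        · exact .nil _
        · exact (HG.binPack hh hw hy1 (by linarith) M _ _ _ _ h4 h6).swap
      rcases h4 with rfl | h4
      · rw [Finset.union_empty]
        exact HF.binPack hw hh hx1 (by linarith) M _ _ _ _ h3 h5
      rcases h7 with rfl | rfl | h7
      · rw [Finset.empty_union]
        exact (HG.binPack hh hw hy1 (by linarith) M _ _ _ _ h4 h6).swap
      · rw [Finset.union_empty]
        exact HF.binPack hw hh hx1 (by linarith) M _ _ _ _ h3 h5
      · exact ih S₁' S₂' _ _ _ _ _ _ (hS.mono hS₁' hS₂') h3 h4 h5 h6 h7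
    have hd : Disjoint (S₁ \ S₁' ∪ S₂ \ S₂') (S₁' ∪ S₂') := by
      rw [Finset.disjoint_union_left, Finset.disjoint_union_right, Finset.disjoint_union_right]
      exact ⟨⟨Finset.sdiff_disjoint, hS.mono Finset.sdiff_subset hS₂'⟩,
        (hS.mono hS₁' Finset.sdiff_subset).symm, Finset.sdiff_disjoint⟩
    have := BinPack.cons _ _ _ hd hbox hrest
    rwa [Finset.union_union_union_comm, Finset.sdiff_union_of_subset hS₁',
      Finset.sdiff_union_of_subset hS₂'] at this

end Combine

section Initial

lemma configWidth_cons {K : ℕ} (a : ℝ) (r : Fin K → ℝ) (m : ℕ) (n : Fin K → ℕ) :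
    configWidth (Fin.cons a r : Fin (K + 1) → ℝ) (Fin.cons m n : Fin (K + 1) → ℕ) =
      m * a + configWidth r n := by
  simp [configWidth, Fin.sum_univ_succ]

lemma sum_map_configWidth_mul {J : Type} [Fintype J] (r : J → ℝ) (l : List ((J → ℕ) × ℝ)) :
    (l.map fun c => configWidth r c.1 * c.2).sum = ∑ j, r j * configCap l j := by
  induction l with
  | nil => simp [configCap]
  | cons c l ih =>
    simp only [configCap, List.map_cons, List.sum_cons, mul_add, Finset.sum_add_distrib] at ih ⊢
    rw [ih, configWidth, Finset.sum_mul]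
    congr 1
    exact Finset.sum_congr rfl fun j _ => by ring

/-- A list of configurations can be extended by a single slot of width one and sorted. -/
lemma exists_configList_cons {K : ℕ} {r : Fin K → ℝ} (l₀ : List ((Fin K → ℕ) × ℝ))
    (hl₀ : ∀ c ∈ l₀, 1 / 2 ≤ configWidth r c.1 ∧ configWidth r c.1 ≤ 1 ∧ 0 ≤ c.2)
    {μ : ℝ} (hμ : 0 ≤ μ) (δ : ℝ) :
    ∃ l : List ((Fin (K + 1) → ℕ) × ℝ), ConfigList (Fin.cons 1 r) l ∧ configCap l 0 = μ ∧
      (∀ j : Fin K, configCap l j.succ = configCap l₀ j) ∧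
      configLen δ l = (l₀.map fun c => c.2).sum + μ + (l₀.length + 1) * δ ∧
      configArea δ (Fin.cons 1 r) l = ∑ j, r j * configCap l₀ j + μ + (l₀.length + 1) * δ := by
  let r' : Fin (K + 1) → ℝ := Fin.cons 1 r
  let l₁ : List ((Fin (K + 1) → ℕ) × ℝ) :=
    (Fin.cons 1 (fun _ => 0), μ) :: l₀.map fun c => (Fin.cons 0 c.1, c.2)
  let R : (Fin (K + 1) → ℕ) × ℝ → (Fin (K + 1) → ℕ) × ℝ → Prop :=
    fun c c' => configWidth r' c'.1 ≤ configWidth r' c.1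
  classical
  have hperm : (l₁.insertionSort R).Perm l₁ := l₁.perm_insertionSort R
  have : Std.Total R := ⟨fun a b => le_total _ _⟩
  have : IsTrans _ R := ⟨fun a b c hab hbc => le_trans hbc hab⟩
  have hsum : ∀ f : (Fin (K + 1) → ℕ) × ℝ → ℝ,
      ((l₁.insertionSort R).map f).sum = (l₁.map f).sum := fun f => (hperm.map f).sum_eq
  refine ⟨l₁.insertionSort R, ⟨?_, l₁.pairwise_insertionSort R⟩, ?_, ?_, ?_, ?_⟩
  · intro c hc
    rcases List.mem_cons.1 (hperm.mem_iff.1 hc) with rfl | hc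
    · rw [configWidth_cons]
      norm_num [configWidth, hμ]
    · obtain ⟨c, hc₀, rfl⟩ := List.mem_map.1 hc
      simpa [configWidth_cons] using hl₀ c hc₀
  · rw [configCap, hsum]
    simp [l₁, Function.comp_def]
  · intro j
    rw [configCap, hsum]
    simp [configCap, l₁, Function.comp_def]
  · simp only [configLen, hsum, l₁, List.map_cons, List.map_map, Function.comp_def,
      List.sum_cons, List.sum_map_add, List.map_const', List.sum_replicate, nsmul_eq_mul]
    ring
  · rw [← sum_map_configWidth_mul]
    simp only [configArea, hsum, l₁, List.map_cons, List.map_map, Function.comp_def,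
      List.sum_cons, List.sum_map_add, List.map_const', List.sum_replicate, nsmul_eq_mul,
      configWidth_cons]
    simp [configWidth]
    ring

variable {ι : Type} [Fintype ι] [DecidableEq ι] {w h : ι → ℝ} {N : ℕ}

/-- A packing into `N` bins yields few configurations of total height at most `N` with room for
the items of `S` after their widths are rounded down. -/
lemma BinPacking.exists_configs (hw : ∀ i, 0 < w i) (hh : ∀ i, 0 < h i) (P : BinPacking w h N)
    {K : ℕ} {r : Fin K → ℝ} (hr : ∀ j, 0 < r j) (S : Finset ι) (g : ι → Fin K)
    (hg : ∀ i ∈ S, r (g i) ≤ w i) :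
    ∃ l : List ((Fin K → ℕ) × ℝ), l.length ≤ K + 1 ∧
      (∀ c ∈ l, 1 / 2 ≤ configWidth r c.1 ∧ configWidth r c.1 ≤ 1 ∧ 0 ≤ c.2) ∧
      (l.map fun c => c.2).sum ≤ N ∧ ∀ j, configCap l j = ∑ i ∈ S with g i = j, h i := by
  obtain ⟨lam, h0, hN, hlam, hwid⟩ := P.exists_lines hw hh
  obtain ⟨l, hlen, hl, hsum, hcap⟩ := _root_.exists_configs hr Finset.univ lam (fun C _ => h0 C)
    (fun C j => ((C ∩ S).filter fun i => g i = j).card) fun C _ hC => by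
      calc configWidth r _ = ∑ j, ∑ i ∈ C ∩ S with g i = j, r (g i) := by
            refine Finset.sum_congr rfl fun j _ => ?_
            rw [← nsmul_eq_mul]
            refine (Finset.sum_eq_card_nsmul fun i hi => ?_).symm
            rw [(Finset.mem_filter.1 hi).2]
        _ = ∑ i ∈ C ∩ S, r (g i) := Finset.sum_fiberwise _ _ _
        _ ≤ ∑ i ∈ C ∩ S, w i := Finset.sum_le_sum fun i hi => hg i (Finset.mem_inter.1 hi).2
        _ ≤ ∑ i ∈ C, w i :=
          Finset.sum_le_sum_of_subset_of_nonneg Finset.inter_subset_left fun i _ _ => (hw i).le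
        _ ≤ 1 := hwid C hC
  refine ⟨l, by simpa using hlen, hl, hsum.trans hN, fun j => ?_⟩
  rw [configCap, hcap j]
  calc ∑ C, lam C * (((C ∩ S).filter fun i => g i = j).card : ℝ)
      = ∑ C, ∑ i ∈ S with g i = j, if i ∈ C then lam C else 0 := by
        refine Finset.sum_congr rfl fun C _ => ?_
        rw [← Finset.sum_filter, Finset.sum_const, nsmul_eq_mul, mul_comm]
        congr 3
        ext i
        simp only [Finset.mem_filter, Finset.mem_inter]
        tauto
    _ = ∑ i ∈ S with g i = j, h i := by
        rw [Finset.sum_comm]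
        refine Finset.sum_congr rfl fun i _ => ?_
        rw [← hlam i, Finset.sum_filter]

/-- Items of height at most `δ` can be arranged as a strip of nearly optimal height and area. -/
lemma BinPacking.exists_strip (hw : ∀ i, 0 < w i ∧ w i ≤ 1) (hh : ∀ i, 0 < h i)
    (P : BinPacking w h N) {δ : ℝ} (hδ : 0 < δ) {K : ℕ} (hK : 0 < K) (S : Finset ι)
    (hS : ∀ i ∈ S, h i ≤ δ) :
    ∃ (r : Fin (K + 1) → ℝ) (ty : ι → Fin (K + 1)) (Φ A : ℝ), (∀ j, 0 < r j) ∧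
      Strip w h δ r ty S Φ (A + 1) 1 ∧
      A ≤ (1 + 4 / K) * ∑ i ∈ S, w i * h i + (2 * K + 2) * δ ∧
      Φ ≤ max (N + 4 / K * ∑ i ∈ S, w i * h i + (2 * K + 2) * δ) (4 / 3 * A) := by
  have hK0 : (0 : ℝ) < K := Nat.cast_pos.2 hK
  let L := S.filter fun i => 1 / 4 < w i
  let T := S.filter fun i => ¬ 1 / 4 < w i
  have hLS : ∀ i ∈ L, i ∈ S ∧ 1 / 4 < w i := fun i hi => Finset.mem_filter.1 hi
  have hTS : ∀ i ∈ T, i ∈ S ∧ ¬ 1 / 4 < w i := fun i hi => Finset.mem_filter.1 hi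
  have hsplit : ∑ i ∈ L, w i * h i + ∑ i ∈ T, w i * h i = ∑ i ∈ S, w i * h i :=
    Finset.sum_filter_add_sum_filter_not _ _ _
  have hT0 : 0 ≤ ∑ i ∈ T, w i * h i :=
    Finset.sum_nonneg fun i _ => mul_nonneg (hw i).1.le (hh i).le
  have hLarea : ∑ i ∈ L, h i ≤ 4 * ∑ i ∈ L, w i * h i := by
    rw [Finset.mul_sum]
    exact Finset.sum_le_sum fun i hi => by nlinarith [(hLS i hi).2, hh i]
  set q := (∑ i ∈ L, h i) / K with hq
  have hq0 : 0 ≤ q := div_nonneg (Finset.sum_nonneg fun i _ => (hh i).le) hK0.le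
  have hqA : q ≤ 4 / K * ∑ i ∈ S, w i * h i := by
    rw [hq, div_mul_eq_mul_div]
    gcongr
    linarith
  obtain ⟨g, E, r, hEL, hEcard, hgK, hr4, hwr, hrw, hfirst, hgroup⟩ :=
    exists_grouping (w := w) hh hq0 K L
      (fun i hi => ⟨(hLS i hi).2.le, (hw i).2⟩) (by rw [hq, mul_div_cancel₀ _ hK0.ne'])
  let r₀ : Fin K → ℝ := fun j => r (j + 1)
  have hr₀ : ∀ j, 0 < r₀ j := fun j => by have := hr4 (j + 1); simp only [r₀]; linarith
  let g' : ι → Fin K := fun i => if hi : g i < K then ⟨g i, hi⟩ else ⟨0, hK⟩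
  have hg' : ∀ i ∈ L, (g' i : ℕ) = g i := fun i hi => by simp [g', hgK i hi]
  obtain ⟨l₀, hlen, hl₀, hsum, hcap⟩ := P.exists_configs (fun i => (hw i).1) hh hr₀ L g'
    fun i hi => by simpa [r₀, hg' i hi] using hrw i hi
  let ty : ι → Fin (K + 1) := fun i =>
    if i ∈ E then 0 else if hi : g i < K + 1 then ⟨g i, hi⟩ else 0
  have hty : ∀ i ∈ L, i ∉ E → (ty i : ℕ) = g i := fun i hi hiE => by
    simp [ty, hiE, (hgK i hi).le]
  have hE : ∑ i ∈ E, h i ≤ K * δ := by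
    calc ∑ i ∈ E, h i ≤ E.card * δ := by
          rw [← nsmul_eq_mul]
          exact Finset.sum_le_card_nsmul _ _ _ fun i hi => hS i (hLS i (hEL hi)).1
      _ ≤ K * δ := by gcongr
  have hslot0 : ∑ i ∈ L with ty i = 0, h i ≤ q + K * δ := by
    calc ∑ i ∈ L with ty i = 0, h i
        ≤ ∑ i ∈ (L \ E).filter (fun i => g i = 0) ∪ E, h i := by
          refine Finset.sum_le_sum_of_subset_of_nonneg (fun i hi => ?_) fun i _ _ => (hh i).le
          obtain ⟨hiL, hi0⟩ := Finset.mem_filter.1 hi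
          by_cases hiE : i ∈ E
          · exact Finset.mem_union_right _ hiE
          · have := hty i hiL hiE
            rw [hi0] at this
            simp [hiL, hiE, ← this]
      _ ≤ ∑ i ∈ L \ E with g i = 0, h i + ∑ i ∈ E, h i := by
          have := Finset.sum_union_inter (f := h) (s₁ := (L \ E).filter fun i => g i = 0) (s₂ := E)
          have h1 : 0 ≤ ∑ i ∈ (L \ E).filter (fun i => g i = 0) ∩ E, h i :=
            Finset.sum_nonneg fun i _ => (hh i).le
          linarith
      _ ≤ q + K * δ := add_le_add hfirst hE
  have hcapg : ∀ j : Fin K, configCap l₀ j = ∑ i ∈ L with g i = j, h i := fun j => by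
    rw [hcap j]
    refine Finset.sum_congr (Finset.filter_congr fun i hi => ?_) fun _ _ => rfl
    rw [← hg' i hi, Fin.ext_iff]
  obtain ⟨l, hl, hl0, hlsucc, hlLen, hlArea⟩ := exists_configList_cons l₀ hl₀
    (add_nonneg hq0 (mul_nonneg hK0.le hδ.le)) δ
  have hlen' : ((l₀.length : ℝ) + 1) * δ ≤ (K + 2) * δ := by
    have : (l₀.length : ℝ) ≤ K + 1 := by exact_mod_cast hlen
    exact mul_le_mul_of_nonneg_right (by linarith) hδ.le
  have hr0area : ∑ j, r₀ j * configCap l₀ j ≤ ∑ i ∈ L, w i * h i := by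
    calc ∑ j, r₀ j * configCap l₀ j = ∑ j, ∑ i ∈ L with g' i = j, r₀ (g' i) * h i := by
          refine Finset.sum_congr rfl fun j _ => ?_
          rw [hcap j, Finset.mul_sum]
          exact Finset.sum_congr rfl fun i hi => by rw [(Finset.mem_filter.1 hi).2]
      _ = ∑ i ∈ L, r₀ (g' i) * h i := Finset.sum_fiberwise _ _ _
      _ ≤ ∑ i ∈ L, w i * h i := Finset.sum_le_sum fun i hi =>
          mul_le_mul_of_nonneg_right (by simpa [r₀, hg' i hi] using hrw i hi) (hh i).le
  have hst : StripState w h δ (Fin.cons 1 r₀) ty L T l := by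
    refine ⟨Finset.disjoint_filter_filter_not _ _ _, fun i hi => ⟨?_, hS i (hLS i hi).1⟩,
      fun i hi => ⟨not_lt.1 (hTS i hi).2, hS i (hTS i hi).1⟩, hl, fun j => ?_⟩
    · rcases Fin.eq_zero_or_eq_succ (ty i) with h0 | ⟨j, hj⟩
      · rw [h0]
        exact (hw i).2
      · have hiE : i ∉ E := fun hiE => by simp [ty, hiE, Fin.ext_iff] at hj
        have h1 := hty i hi hiE
        rw [hj, Fin.val_succ] at h1
        rw [hj]
        simpa [r₀, h1] using hwr i (Finset.mem_sdiff.2 ⟨hi, hiE⟩)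
    · rcases Fin.eq_zero_or_eq_succ j with rfl | ⟨j, rfl⟩
      · rw [hl0]
        exact hslot0
      · rw [hlsucc, hcapg]
        refine le_trans ?_ (hgroup j)
        refine Finset.sum_le_sum_of_subset_of_nonneg (fun i hi => ?_) fun i _ _ => (hh i).le
        obtain ⟨hiL, hij⟩ := Finset.mem_filter.1 hi
        have hiE : i ∉ E := fun hiE => by simp [ty, hiE, Fin.ext_iff] at hij
        have h1 := hty i hiL hiE
        rw [hij, Fin.val_succ] at h1
        simp [hiL, hiE, ← h1]
  have hlenArea := configLen_le_configArea hδ hl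
  set A := configArea δ (Fin.cons 1 r₀ : Fin (K + 1) → ℝ) l + ∑ i ∈ T, w i * h i with hA
  have hpos : ∀ j, 0 < (Fin.cons 1 r₀ : Fin (K + 1) → ℝ) j := by
    intro j
    rcases Fin.eq_zero_or_eq_succ j with rfl | ⟨j, rfl⟩
    · exact one_pos
    · exact hr₀ j
  have hΦmax : configLen δ l ≤ N + 4 / K * ∑ i ∈ S, w i * h i + (2 * K + 2) * δ := by linarith
  have hA0 : 0 ≤ configLen δ l := configLen_nonneg hδ hl
  have hSLT : S = L ∪ T := (Finset.filter_union_filter_not_eq _ _).symm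
  refine ⟨Fin.cons 1 r₀, ty, max (configLen δ l) (4 / 3 * A), A, hpos,
    ⟨L, T, l, hst, hSLT, by norm_num, le_rfl, fun c hc => (hl.1 c hc).2.1, fun _ => rfl,
      le_max_left _ _, fun _ => le_max_right _ _, ?_, rfl⟩, by linarith, max_le_max_right _ hΦmax⟩
  rcases max_choice (configLen δ l) (4 / 3 * A) with h1 | h1 <;> rw [h1] <;> linarith

end Initial

section Bound

lemma skewFactor_mul_add_le {x y : ℝ} (hx0 : 0 < x) (hx1 : x < 1) (hy0 : 0 < y) (hy1 : y < 1)
    (h : skewFactor x y ≤ 3) : skewFactor x y * (x + y) ≤ 2 * (x / (1 - x) + y / (1 - y)) := by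
  obtain ⟨a, ha⟩ : ∃ a, a = x / (1 - x) := ⟨_, rfl⟩
  obtain ⟨b, hb⟩ : ∃ b, b = y / (1 - y) := ⟨_, rfl⟩
  have ha0 : 0 < a := ha ▸ div_pos hx0 (by linarith)
  have hb0 : 0 < b := hb ▸ div_pos hy0 (by linarith)
  have hxa : x = a / (1 + a) := by
    have : 1 - x ≠ 0 := by linarith
    rw [ha]; field_simp; ring
  have hyb : y = b / (1 + b) := by
    have : 1 - y ≠ 0 := by linarith
    rw [hb]; field_simp; ring
  have hs : skewFactor x y = 1 + 2 * (a + b) := by rw [skewFactor, ha, hb]; ring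
  have hconc : x + y ≤ 2 * (a + b) / (2 + (a + b)) := by
    rw [hxa, hyb, div_add_div _ _ (by linarith) (by linarith),
      div_le_div_iff₀ (by positivity) (by positivity)]
    nlinarith [mul_nonneg (add_pos ha0 hb0).le (sq_nonneg (a - b)), sq_nonneg (a - b)]
  rw [← ha, ← hb, hs]
  rw [hs] at h
  calc (1 + 2 * (a + b)) * (x + y) ≤ (1 + 2 * (a + b)) * (2 * (a + b) / (2 + (a + b))) := by
        gcongr
    _ ≤ 2 * (a + b) := by
        rw [← mul_div_assoc, div_le_iff₀ (by positivity)]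
        nlinarith

variable {ι : Type} [Fintype ι] [DecidableEq ι] {w h : ι → ℝ}

lemma optg_le_three_add_four_mul_opt (hw : ∀ i, 0 < w i ∧ w i ≤ 1) (hh : ∀ i, 0 < h i ∧ h i ≤ 1) :
    (optg w h : ℝ) ≤ 3 + 4 * opt w h := by
  obtain ⟨P⟩ := nonempty_binPacking_opt (fun i => (hw i).2) fun i => (hh i).2
  obtain ⟨M, hM, hM'⟩ := exists_binPack_of_area hw hh Finset.univ
  have h1 : (optg w h : ℝ) ≤ M :=
    Nat.cast_le.2 (hM.optg_le (fun i => (hw i).1) fun i => (hh i).1)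
  have h2 := P.area_le (fun i => (hw i).1) fun i => (hh i).1
  linarith

lemma optg_lt_of_skewed (hw : ∀ i, 0 < w i ∧ w i ≤ 1) (hh : ∀ i, 0 < h i ∧ h i ≤ 1)
    {x y : ℝ} (hx0 : 0 < x) (hx1 : x < 1) (hy0 : 0 < y) (hy1 : y < 1)
    (hskew : ∀ i, w i ≤ y ∨ h i ≤ x) {K : ℕ} (hK : 0 < K) :
    (optg w h : ℝ) <
      4 / 3 * skewFactor x y * ((1 + 4 / K) * opt w h + (2 * K + 2) * (x + y) + 2) + 2 := by
  have hw0 : ∀ i, 0 < w i := fun i => (hw i).1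
  have hh0 : ∀ i, 0 < h i := fun i => (hh i).1
  have hκ1 := one_add_le_skewFactor hx0 hx1 hy0 hy1
  have hK0 : (0 : ℝ) < K := Nat.cast_pos.2 hK
  obtain ⟨P⟩ := nonempty_binPacking_opt (fun i => (hw i).2) fun i => (hh i).2
  let S₁ : Finset ι := Finset.univ.filter fun i => h i ≤ x
  let S₂ : Finset ι := Finset.univ.filter fun i => ¬ h i ≤ x
  obtain ⟨r₁, ty₁, Φ₁, A₁, hr₁, hst₁, hA₁, hΦ₁⟩ := P.exists_strip hw hh0 hx0 hK S₁
    fun i hi => (Finset.mem_filter.1 hi).2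
  obtain ⟨r₂, ty₂, Φ₂, A₂, hr₂, hst₂, hA₂, hΦ₂⟩ := P.transpose.exists_strip hh hw0 hy0 hK S₂
    fun i hi => (hskew i).resolve_right (Finset.mem_filter.1 hi).2
  have hsplit : ∑ i ∈ S₁, w i * h i + ∑ i ∈ S₂, h i * w i ≤ opt w h := by
    simp only [mul_comm (h _)]
    exact (Finset.sum_filter_add_sum_filter_not _ _ _).trans_le (P.area_le hw0 hh0)
  have ha₁ : 0 ≤ ∑ i ∈ S₁, w i * h i :=
    Finset.sum_nonneg fun i _ => mul_nonneg (hw0 i).le (hh0 i).le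
  have ha₂ : 0 ≤ ∑ i ∈ S₂, h i * w i :=
    Finset.sum_nonneg fun i _ => mul_nonneg (hh0 i).le (hw0 i).le
  set κ := skewFactor x y with hκ
  set N : ℝ := (opt w h : ℝ) with hN
  set U : ℝ := (1 + 4 / K) * N + (2 * K + 2) * (x + y) + 2 with hU
  have hA₁0 : 0 ≤ A₁ := by
    obtain ⟨h1, -, -, h2⟩ := hst₁.bounds hx0
    linarith
  have hA₂0 : 0 ≤ A₂ := by
    obtain ⟨h1, -, -, h2⟩ := hst₂.bounds hy0
    linarith
  have h4K : 0 < 4 / (K : ℝ) := by positivity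
  have hmono : 4 / (K : ℝ) * (∑ i ∈ S₁, w i * h i) + 4 / (K : ℝ) * (∑ i ∈ S₂, h i * w i) ≤
      4 / K * N := by
    rw [← mul_add]
    exact mul_le_mul_of_nonneg_left hsplit h4K.le
  have h₁0 : 0 ≤ 4 / (K : ℝ) * (∑ i ∈ S₁, w i * h i) := mul_nonneg h4K.le ha₁
  have h₂0 : 0 ≤ 4 / (K : ℝ) * (∑ i ∈ S₂, h i * w i) := mul_nonneg h4K.le ha₂
  have hKx : 0 ≤ (K : ℝ) * x := by positivity
  have hKy : 0 ≤ (K : ℝ) * y := by positivity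
  have hN0 : 0 ≤ N := Nat.cast_nonneg _
  have hA : A₁ + A₂ + 2 ≤ U := by rw [hU]; linarith
  have hΦ₁U : Φ₁ ≤ 4 / 3 * U := hΦ₁.trans (max_le (by rw [hU]; linarith) (by linarith))
  have hΦ₂U : Φ₂ ≤ 4 / 3 * U := hΦ₂.trans (max_le (by rw [hU]; linarith) (by linarith))
  have hκ0 : 0 ≤ κ := by linarith
  have hM := Nat.le_ceil (4 / 3 * κ * U)
  have hM' := Nat.ceil_lt_add_one (a := 4 / 3 * κ * U) (by
    have : 0 ≤ U := by linarith
    positivity)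
  have hbound : ∀ z, z ≤ 4 / 3 * U → κ * z ≤ ⌈4 / 3 * κ * U⌉₊ := fun z hz =>
    (mul_le_mul_of_nonneg_left hz hκ0).trans (by linarith)
  have hpack := Cuttable.binPack_union hw0 hh0 hx0 hx1 hy0 hy1
    (Strip.cuttable hw0 hh0 hx0 hr₁ ty₁) (Strip.cuttable hh0 hw0 hy0 hr₂ ty₂)
    ⌈4 / 3 * κ * U⌉₊ S₁ S₂ Φ₁ Φ₂ _ _ 1 1 (Finset.disjoint_filter_filter_not _ _ _) hst₁ hst₂
    (hbound _ hΦ₁U) (hbound _ hΦ₂U) (by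
      have := hbound (4 / 3 * (A₁ + 1 + (A₂ + 1))) (by linarith)
      rw [← hκ]
      linarith)
  rw [Finset.filter_union_filter_not_eq] at hpack
  have hle : (optg w h : ℝ) ≤ (⌈4 / 3 * κ * U⌉₊ + 1 : ℕ) :=
    Nat.cast_le.2 (hpack.optg_le hw0 hh0)
  push_cast at hle
  linarith

end Bound

/-- Guarantee of `skewedGPack` for `(δ_W, δ_H)`-skewed items:
with `Δ := (δ_H/(1−δ_H) + δ_W/(1−δ_W))/2`, `α := (4/3)(1+4Δ)(1+3ε)` and
`β := 2Δ(1+ε)/ε² + 10/3 + 19Δ/3 + 16Δε/3`, we have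
`opt_g(I) < α(1+ε)·opt(I) + 2β`. -/
theorem skewedGPack_strong_guarantee
    (ε δW δH : ℝ) (hε0 : 0 < ε) (hε1 : ε < 1) (hεint : ∃ z : ℤ, 1/ε = (z : ℝ))
    (hδW0 : 0 < δW) (hδW1 : δW < 1) (hδH0 : 0 < δH) (hδH1 : δH < 1)
    (n : ℕ) (w h : Fin n → ℝ)
    (hw : ∀ i, 0 < w i ∧ w i ≤ 1) (hh : ∀ i, 0 < h i ∧ h i ≤ 1)
    (hskew : ∀ i, w i ≤ δW ∨ h i ≤ δH)
    (Δ α β : ℝ)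
    (hΔ : Δ = (δH/(1-δH) + δW/(1-δW))/2)
    (hα : α = 4/3 * (1 + 4*Δ) * (1 + 3*ε))
    (hβ : β = 2*Δ*(1+ε)/ε^2 + 10/3 + 19*Δ/3 + 16*Δ*ε/3) :
    (optg w h : ℝ) < α * (1+ε) * (opt w h : ℝ) + 2*β := by
  obtain ⟨z, hz⟩ := hεint
  have hz1 : (1 : ℝ) < z := by rw [← hz, lt_div_iff₀ hε0]; linarith
  have hz1' : 1 < z := by exact_mod_cast hz1
  lift z to ℕ using by omega with k
  rw [Int.cast_natCast] at hz hz1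
  have hε : ε = 1 / k := by rw [← hz, one_div_one_div]
  have hκ : skewFactor δH δW = 1 + 4 * Δ := by rw [skewFactor, hΔ]; ring
  have hΔ0 : 0 < Δ := by
    have := div_pos hδH0 (sub_pos.2 hδH1)
    have := div_pos hδW0 (sub_pos.2 hδW1)
    rw [hΔ]
    linarith
  have hΔε : 0 < Δ * ε := mul_pos hΔ0 hε0
  have hβ' : 2 * β = 4 * Δ * (k * (k + 1)) + 20 / 3 + 38 * Δ / 3 + 32 * (Δ * ε) / 3 := by
    have hk : (k : ℝ) ≠ 0 := by linarith
    rw [hβ, hε]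
    field_simp
    ring
  have hΔk : 0 < 4 * Δ * (k * (k + 1)) := by positivity
  set N : ℝ := (opt w h : ℝ) with hN
  have hN0 : 0 ≤ N := Nat.cast_nonneg _
  rcases le_or_gt 3 ((1 + 4 * Δ) * ((1 + 3 * ε) * (1 + ε))) with hbig | hsmall
  · have h1 := optg_le_three_add_four_mul_opt hw hh
    have h2 : 3 * N ≤ (1 + 4 * Δ) * ((1 + 3 * ε) * (1 + ε)) * N :=
      mul_le_mul_of_nonneg_right hbig hN0
    rw [hβ', hα]
    linarith
  · have hε' : (1 + 3 * ε) * (1 + ε) < 3 := by nlinarith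
    have hk3 : (3 : ℝ) ≤ k := by
      have : k ≠ 2 := by
        rintro rfl
        norm_num [hε] at hε'
      exact_mod_cast (by omega : 3 ≤ k)
    have hκ3 : 1 + 4 * Δ ≤ 3 := by nlinarith
    have h1 := optg_lt_of_skewed hw hh hδH0 hδH1 hδW0 hδW1 hskew (K := k) (by omega)
    have h2 := skewFactor_mul_add_le hδH0 hδH1 hδW0 hδW1 (hκ.trans_le hκ3)
    rw [show δH / (1 - δH) + δW / (1 - δW) = 2 * Δ by rw [hΔ]; ring, hκ] at h2
    rw [hκ, show 4 / (k : ℝ) = 4 * ε by rw [hε]; ring] at h1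
    have h3 : (1 + 4 * Δ) * (δH + δW) * (k + 1) ≤ 2 * (2 * Δ) * (k + 1) :=
      mul_le_mul_of_nonneg_right h2 (by linarith)
    have h4 : 0 ≤ Δ * (k + 1) * (k - 3) :=
      mul_nonneg (mul_nonneg hΔ0.le (by linarith)) (by linarith)
    have h5 : 0 ≤ (1 + 4 * Δ) * ε ^ 2 * N := by positivity
    have h6 : 0 ≤ Δ * (k + 1) := by positivity
    rw [hβ', hα]
    linarith
end

section
/- Let δ_W, δ_H, W, H be positive reals with δ_W < W and δ_H < H. Let I be a finite set of items, each with width at most δ_W and height at most δ_H. If a(I) ≤ (W − δ_W)·(H − δ_H), then all items of I can be packed, axis-aligned, pairwise interior-disjoint and without rotation, into a single rectangular bin of width W and height H. -/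
/-- The packing invariant of the next-fit decreasing height algorithm. The current shelf has base `b`
and height `t` and is filled up to abscissa `c`, and all remaining heights are at most `m ≤ t`. If
`c * m` plus the remaining area is at most `(H - b - t) * (W - δ)`, then the remaining items fit
into the unused part of the bin. -/
theorem exists_shelf_packing {ι : Type*} [DecidableEq ι] {δ W H : ℝ} (hδW : δ < W)
    {w h : ι → ℝ} (hw : ∀ i, 0 < w i ∧ w i ≤ δ) (hh : ∀ i, 0 < h i) (s : Finset ι) :
    ∀ m c b t : ℝ, (∀ i ∈ s, h i ≤ m) → 0 ≤ m → m ≤ t → 0 ≤ c → 0 ≤ b →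
      c * m + ∑ i ∈ s, w i * h i ≤ (H - b - t) * (W - δ) →
      ∃ x y : ι → ℝ,
        (∀ i ∈ s, 0 ≤ x i ∧ x i + w i ≤ W ∧ b ≤ y i ∧ y i + h i ≤ H ∧
          (c ≤ x i ∨ b + t ≤ y i)) ∧
        (∀ i ∈ s, ∀ j ∈ s, i ≠ j →
          x i + w i ≤ x j ∨ x j + w j ≤ x i ∨ y i + h i ≤ y j ∨ y j + h j ≤ y i) := by
  induction s using Finset.induction_on_max_value h with
  | empty => exact fun _ _ _ _ _ _ _ _ _ _ => ⟨0, 0, by simp, by simp⟩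
  | insert a s has hmax ih =>
    have hwa := hw a
    have hha := hh a
    have harea : 0 ≤ ∑ i ∈ s, w i * h i :=
      Finset.sum_nonneg fun i _ => (mul_pos (hw i).1 (hh i)).le
    have hprod : 0 < w a * h a := mul_pos hwa.1 hha
    -- If `a` fits on the current shelf, it goes to `(c, b)`.
    have place : ∀ m c b t : ℝ, h a ≤ m → m ≤ t → 0 ≤ c → 0 ≤ b →
        c * m + (w a * h a + ∑ i ∈ s, w i * h i) ≤ (H - b - t) * (W - δ) → c + w a ≤ W →
        ∃ x y : ι → ℝ,
          (∀ i ∈ insert a s, 0 ≤ x i ∧ x i + w i ≤ W ∧ b ≤ y i ∧ y i + h i ≤ H ∧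
            (c ≤ x i ∨ b + t ≤ y i)) ∧
          (∀ i ∈ insert a s, ∀ j ∈ insert a s, i ≠ j →
            x i + w i ≤ x j ∨ x j + w j ≤ x i ∨ y i + h i ≤ y j ∨ y j + h j ≤ y i) := by
      intro m c b t ham hmt hc hb hsum hfit
      have hcm : c * h a ≤ c * m := mul_le_mul_of_nonneg_left ham hc
      have hca : 0 ≤ c * h a := mul_nonneg hc hha.le
      have htop : 0 ≤ H - b - t :=
        nonneg_of_mul_nonneg_left (by linarith) (sub_pos.2 hδW)
      obtain ⟨x, y, hxy, hsep⟩ := ih (h a) (c + w a) b t hmax hha.le (ham.trans hmt)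
        (by linarith) hb (by linarith [add_mul c (w a) (h a)])
      have hne : ∀ i ∈ s, i ≠ a := fun i hi hia => has (hia ▸ hi)
      refine ⟨Function.update x a c, Function.update y a b, ?_, ?_⟩
      · intro i hi
        rcases Finset.mem_insert.1 hi with rfl | hi
        · simp only [Function.update_self]
          exact ⟨hc, hfit, le_rfl, by linarith, Or.inl le_rfl⟩
        · obtain ⟨h1, h2, h3, h4, h5⟩ := hxy i hi
          simp only [Function.update_of_ne (hne i hi)]
          exact ⟨h1, h2, h3, h4, h5.imp_left fun hr => by linarith⟩
      · intro i hi j hj hij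
        rcases Finset.mem_insert.1 hi with rfl | his <;>
          rcases Finset.mem_insert.1 hj with rfl | hjs
        · exact absurd rfl hij
        · simp only [Function.update_self, Function.update_of_ne (hne j hjs)]
          rcases (hxy j hjs).2.2.2.2 with hr | hr
          · exact Or.inl hr
          · exact Or.inr (Or.inr (Or.inl (by linarith)))
        · simp only [Function.update_self, Function.update_of_ne (hne i his)]
          rcases (hxy i his).2.2.2.2 with hr | hr
          · exact Or.inr (Or.inl hr)
          · exact Or.inr (Or.inr (Or.inr (by linarith)))
        · simp only [Function.update_of_ne (hne i his), Function.update_of_ne (hne j hjs)]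
          exact hsep i his j hjs hij
    intro m c b t hm hm0 hmt hc hb hsum
    rw [Finset.sum_insert has] at hsum
    have ham := hm a (Finset.mem_insert_self a s)
    by_cases hfit : c + w a ≤ W
    · exact place m c b t ham hmt hc hb hsum hfit
    · -- Otherwise the current shelf is filled beyond `W - δ`, and `a` opens a new one.
      have hcm : (W - δ) * m ≤ c * m := mul_le_mul_of_nonneg_right (by linarith) hm0
      have hma : (W - δ) * h a ≤ (W - δ) * m :=
        mul_le_mul_of_nonneg_left ham (sub_pos.2 hδW).le
      obtain ⟨x, y, hxy, hsep⟩ := place (h a) 0 (b + t) (h a) le_rfl le_rfl le_rfl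
        (by linarith) (by nlinarith) (by linarith)
      refine ⟨x, y, fun i hi => ?_, hsep⟩
      obtain ⟨h1, h2, h3, h4, -⟩ := hxy i hi
      exact ⟨h1, h2, by linarith, h4, Or.inr h3⟩


/-- If every item has width at most `δ_W` and height at most
`δ_H`, and the total area is at most `(W − δ_W)(H − δ_H)`, then all items can
be packed (axis-aligned, pairwise interior-disjoint, without rotation) into a
single rectangular bin of width `W` and height `H`. -/
theorem small_items_fit_in_bin
    (δW δH W H : ℝ) (hδW0 : 0 < δW) (hδWW : δW < W) (hδH0 : 0 < δH) (hδHH : δH < H)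
    (n : ℕ) (w h : Fin n → ℝ)
    (hw : ∀ i, 0 < w i ∧ w i ≤ δW) (hh : ∀ i, 0 < h i ∧ h i ≤ δH)
    (harea : ∑ i, w i * h i ≤ (W - δW) * (H - δH)) :
    ∃ x y : Fin n → ℝ,
      (∀ i, 0 ≤ x i ∧ x i + w i ≤ W ∧ 0 ≤ y i ∧ y i + h i ≤ H) ∧
      (∀ i j, i ≠ j →
        (Set.Ioo (x i) (x i + w i) ×ˢ Set.Ioo (y i) (y i + h i)) ∩
          (Set.Ioo (x j) (x j + w j) ×ˢ Set.Ioo (y j) (y j + h j)) = ∅) := by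
  obtain ⟨x, y, hxy, hsep⟩ := exists_shelf_packing (H := H) hδWW hw (fun i => (hh i).1)
    Finset.univ δH 0 0 δH (fun i _ => (hh i).2) hδH0.le le_rfl le_rfl le_rfl (by linarith)
  refine ⟨x, y, fun i => ?_, fun i j hij => ?_⟩
  · obtain ⟨h1, h2, h3, h4, -⟩ := hxy i (Finset.mem_univ i)
    exact ⟨h1, h2, h3, h4⟩
  · refine Set.eq_empty_iff_forall_notMem.2 ?_
    rintro ⟨p, q⟩ ⟨⟨⟨h1, h2⟩, h3, h4⟩, ⟨h5, h6⟩, h7, h8⟩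
    dsimp only at *
    rcases hsep i (Finset.mem_univ i) j (Finset.mem_univ j) hij with h | h | h | h <;> linarith
end

section
/- Let δ ∈ (0,1) and let I be a finite set of items, each with width in (0,1] and height at most δ. Then there exists a packing of I into fewer than (2·a(I) + 1)/(1 − δ) unit square bins. -/
/-- A partial shelf packing of the items in `s`. Bins `0, …, B` are in use; the open shelf lies in
bin `B`, has its bottom at height `y₀`, has height `H`, and is filled up to width `u`. -/
structure ShelfPacking {ι : Type} (w h : ι → ℝ) (s : Finset ι) (B : ℕ) (y₀ H u : ℝ) where
  bin : ι → ℕ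
  x : ι → ℝ
  y : ι → ℝ
  y₀_nonneg : 0 ≤ y₀
  y₀_add_le : y₀ + H ≤ 1
  u_nonneg : 0 ≤ u
  bin_le : ∀ i ∈ s, bin i ≤ B
  x_nonneg : ∀ i ∈ s, 0 ≤ x i
  y_nonneg : ∀ i ∈ s, 0 ≤ y i
  x_add_le : ∀ i ∈ s, x i + w i ≤ 1
  y_add_le : ∀ i ∈ s, y i + h i ≤ 1
  below : ∀ i ∈ s, bin i = B → y i + h i ≤ y₀ ∨ (x i + w i ≤ u ∧ y i + h i ≤ y₀ + H)
  separated : ∀ i ∈ s, ∀ j ∈ s, i ≠ j → bin i = bin j →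
    x i + w i ≤ x j ∨ x j + w j ≤ x i ∨ y i + h i ≤ y j ∨ y j + h j ≤ y i

/-- Place one more item into a shelf packing, at a position lying to the right of or above all
items in its bin. -/
def ShelfPacking.insertItem {ι : Type} [DecidableEq ι] {w h : ι → ℝ} {s : Finset ι} {B : ℕ}
    {y₀ H u : ℝ} (P : ShelfPacking w h s B y₀ H u) {a : ι} (ha : a ∉ s)
    (B' : ℕ) (y₁ H' x₁ : ℝ) (hB : B ≤ B') (hx : 0 ≤ x₁) (hy : 0 ≤ y₁) (hw : 0 ≤ w a)
    (hxw : x₁ + w a ≤ 1) (hyH : y₁ + H' ≤ 1) (hH : h a ≤ H')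
    (hold : ∀ i ∈ s, P.bin i = B' →
      P.y i + h i ≤ y₁ ∨ (P.x i + w i ≤ x₁ ∧ P.y i + h i ≤ y₁ + H')) :
    ShelfPacking w h (insert a s) B' y₁ H' (x₁ + w a) where
  bin := Function.update P.bin a B'
  x := Function.update P.x a x₁
  y := Function.update P.y a y₁
  y₀_nonneg := hy
  y₀_add_le := hyH
  u_nonneg := by linarith
  bin_le := by
    intro i hi
    by_cases hia : i = a
    · subst hia; simp
    · simpa [hia] using (P.bin_le i (Finset.mem_of_mem_insert_of_ne hi hia)).trans hB
  x_nonneg := by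
    intro i hi
    by_cases hia : i = a
    · subst hia; simpa using hx
    · simpa [hia] using P.x_nonneg i (Finset.mem_of_mem_insert_of_ne hi hia)
  y_nonneg := by
    intro i hi
    by_cases hia : i = a
    · subst hia; simpa using hy
    · simpa [hia] using P.y_nonneg i (Finset.mem_of_mem_insert_of_ne hi hia)
  x_add_le := by
    intro i hi
    by_cases hia : i = a
    · subst hia; simpa using hxw
    · simpa [hia] using P.x_add_le i (Finset.mem_of_mem_insert_of_ne hi hia)
  y_add_le := by
    intro i hi
    by_cases hia : i = a
    · subst hia; simp; linarith
    · simpa [hia] using P.y_add_le i (Finset.mem_of_mem_insert_of_ne hi hia)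
  below := by
    intro i hi hb
    by_cases hia : i = a
    · subst hia; right; simp; linarith
    · simp only [Function.update_of_ne hia] at hb ⊢
      rcases hold i (Finset.mem_of_mem_insert_of_ne hi hia) hb with h1 | ⟨h1, h2⟩
      · exact .inl h1
      · exact .inr ⟨by linarith, h2⟩
  separated := by
    intro i hi j hj hij hb
    by_cases hia : i = a
    · have hja : j ≠ a := fun hja => hij (hia.trans hja.symm)
      subst hia
      simp only [Function.update_of_ne hja, Function.update_self] at hb ⊢
      have := hold j (Finset.mem_of_mem_insert_of_ne hj hja) hb.symm
      tauto
    · by_cases hja : j = a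
      · subst hja
        simp only [Function.update_of_ne hia, Function.update_self] at hb ⊢
        have := hold i (Finset.mem_of_mem_insert_of_ne hi hia) hb
        tauto
      · simp only [Function.update_of_ne hia, Function.update_of_ne hja] at hb ⊢
        exact P.separated i (Finset.mem_of_mem_insert_of_ne hi hia) j
          (Finset.mem_of_mem_insert_of_ne hj hja) hij hb

/-- Placing the items shelf by shelf, in order of decreasing height, the total height used is
bounded by twice the area of the items. -/
theorem exists_shelfPacking {ι : Type} [DecidableEq ι] {δ : ℝ} (hδ0 : 0 < δ) (hδ1 : δ < 1)
    {w h : ι → ℝ} (hw : ∀ i, 0 < w i ∧ w i ≤ 1) (hh : ∀ i, 0 < h i ∧ h i ≤ δ) (s : Finset ι) :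
    ∃ (B : ℕ) (y₀ H u : ℝ), Nonempty (ShelfPacking w h s B y₀ H u) ∧ 0 < H ∧
      ∀ g ≤ δ, (∀ i ∈ s, g ≤ h i) →
        g ≤ H ∧ (1 - δ) * B + y₀ + H + u * g ≤ δ + 2 * ∑ i ∈ s, w i * h i := by
  induction s using Finset.induction_on_min_value h with
  | empty =>
    refine ⟨0, 0, δ, 0, ⟨?_⟩, hδ0, fun g hg _ => ⟨hg, by simp⟩⟩
    exact
      { bin := 0, x := 0, y := 0, y₀_nonneg := le_rfl, y₀_add_le := by linarith
        u_nonneg := le_rfl, bin_le := by simp, x_nonneg := by simp, y_nonneg := by simp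
        x_add_le := by simp, y_add_le := by simp, below := by simp, separated := by simp }
  | insert a s ha hmin ih =>
    obtain ⟨B, y₀, H, u, ⟨P⟩, hH, hP⟩ := ih
    obtain ⟨hHa, hpot⟩ := hP (h a) (hh a).2 hmin
    obtain ⟨hw0, hw1⟩ := hw a
    obtain ⟨hh0, hh1⟩ := hh a
    have hy₀ := P.y₀_nonneg
    have hu₀ := P.u_nonneg
    rw [Finset.sum_insert ha]
    by_cases hu : u + w a ≤ 1
    · refine ⟨B, y₀, H, u + w a, ⟨P.insertItem ha B y₀ H u le_rfl hu₀ hy₀ hw0.le hu P.y₀_add_le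
        hHa (fun i hi hb => P.below i hi hb)⟩, hH, fun g _ hg => ?_⟩
      have hga := hg a (Finset.mem_insert_self a s)
      refine ⟨hga.trans hHa, ?_⟩
      nlinarith [mul_le_mul_of_nonneg_left hga (add_nonneg hu₀ hw0.le), mul_pos hw0 hh0]
    · have hfull : h a ≤ u * h a + w a * h a := by nlinarith
      by_cases hy : y₀ + H + h a ≤ 1
      · refine ⟨B, y₀ + H, h a, 0 + w a, ⟨P.insertItem ha B (y₀ + H) (h a) 0 le_rfl le_rfl
          (by linarith) hw0.le (by linarith) hy le_rfl (fun i hi hb => ?_)⟩, hh0, fun g _ hg => ?_⟩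
        · rcases P.below i hi hb with h1 | h1
          · left; linarith
          · exact .inl h1.2
        · have hga := hg a (Finset.mem_insert_self a s)
          exact ⟨hga, by nlinarith [mul_le_mul_of_nonneg_left hga hw0.le]⟩
      · refine ⟨B + 1, 0, h a, 0 + w a, ⟨P.insertItem ha (B + 1) 0 (h a) 0 (by omega) le_rfl
          le_rfl hw0.le (by linarith) (by linarith) le_rfl (fun i hi hb => ?_)⟩, hh0,
          fun g _ hg => ?_⟩
        · have := P.bin_le i hi
          omega
        · have hga := hg a (Finset.mem_insert_self a s)
          refine ⟨hga, ?_⟩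
          push_cast
          nlinarith [mul_le_mul_of_nonneg_left hga hw0.le]

/-- A shelf packing of all items is a bin packing. -/
def ShelfPacking.toBinPacking {ι : Type} [Fintype ι] {w h : ι → ℝ} {B : ℕ} {y₀ H u : ℝ}
    (P : ShelfPacking w h Finset.univ B y₀ H u) : BinPacking w h (B + 1) where
  bin i := ⟨P.bin i, Nat.lt_succ_of_le (P.bin_le i (Finset.mem_univ i))⟩
  x := P.x
  y := P.y
  x_nonneg i := P.x_nonneg i (Finset.mem_univ i)
  y_nonneg i := P.y_nonneg i (Finset.mem_univ i)
  x_add_le i := P.x_add_le i (Finset.mem_univ i)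
  y_add_le i := P.y_add_le i (Finset.mem_univ i)
  disj i j hij hb := by
    ext ⟨p, q⟩
    simp only [Set.mem_inter_iff, Set.mem_prod, Set.mem_Ioo, Set.mem_empty_iff_false, iff_false]
    rintro ⟨⟨⟨_, _⟩, _, _⟩, ⟨_, _⟩, _, _⟩
    rcases P.separated i (Finset.mem_univ i) j (Finset.mem_univ j) hij (Fin.mk.inj_iff.mp hb)
      with h1 | h1 | h1 | h1 <;> linarith

/-- Items with height at most `δ` can be packed into fewer
than `(2·a(I) + 1)/(1 − δ)` unit square bins. -/
theorem pack_short_items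
    (δ : ℝ) (hδ0 : 0 < δ) (hδ1 : δ < 1)
    (n : ℕ) (w h : Fin n → ℝ)
    (hw : ∀ i, 0 < w i ∧ w i ≤ 1) (hh : ∀ i, 0 < h i ∧ h i ≤ δ) :
    ∃ N : ℕ, Nonempty (BinPacking w h N) ∧
      (N : ℝ) < (2 * (∑ i, w i * h i) + 1) / (1 - δ) := by
  obtain ⟨B, y₀, H, u, ⟨P⟩, hH, hP⟩ := exists_shelfPacking hδ0 hδ1 hw hh Finset.univ
  refine ⟨B + 1, ⟨P.toBinPacking⟩, ?_⟩
  have hpot := (hP 0 hδ0.le fun i _ => (hh i).1.le).2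
  have hy₀ := P.y₀_nonneg
  rw [lt_div_iff₀ (by linarith)]
  push_cast
  linarith
end

section
/- Let δ ∈ (0,1) and let I be a finite set of items, each with height in (0,1] and width at most δ. Then there exists a packing of I into fewer than 2·a(I)/(1 − δ) + 3 unit square bins. -/
/-- A packing into a strip of width `1` and height `S`, cut at the integer heights, yields a packing
into `2 * ⌈S⌉₊ - 1` unit bins: one bin for each unit slab, and one for the items crossing each cut. -/
theorem BinPacking.nonempty_of_strip {ι : Type} [Fintype ι] {w h x y : ι → ℝ} {S : ℝ}
    (hh : ∀ i, 0 < h i ∧ h i ≤ 1) (hx : ∀ i, 0 ≤ x i) (hxw : ∀ i, x i + w i ≤ 1)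
    (hy : ∀ i, 0 ≤ y i) (hyh : ∀ i, y i + h i ≤ S)
    (hdisj : ∀ i j, i ≠ j →
      x i + w i ≤ x j ∨ x j + w j ≤ x i ∨ y i + h i ≤ y j ∨ y j + h j ≤ y i) :
    Nonempty (BinPacking w h (2 * ⌈S⌉₊ - 1)) := by
  have hfl : ∀ i, (⌊y i⌋₊ : ℝ) ≤ y i := fun i => Nat.floor_le (hy i)
  have hlt : ∀ i, y i < ⌊y i⌋₊ + 1 := fun i => Nat.lt_floor_add_one (y i)
  refine ⟨{
    bin := fun i => ⟨if y i + h i ≤ ⌊y i⌋₊ + 1 then 2 * ⌊y i⌋₊ else 2 * ⌊y i⌋₊ + 1, ?_⟩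
    x := x
    y := fun i => if y i + h i ≤ ⌊y i⌋₊ + 1 then y i - ⌊y i⌋₊ else 0
    x_nonneg := hx
    y_nonneg := ?_
    x_add_le := hxw
    y_add_le := ?_
    disj := ?_ }⟩
  · split_ifs with hc
    · have : ⌊y i⌋₊ < ⌈S⌉₊ := by
        rw [Nat.lt_ceil]; linarith [hfl i, (hh i).1, hyh i]
      omega
    · have : ⌊y i⌋₊ + 1 < ⌈S⌉₊ := by
        rw [Nat.lt_ceil]; push_cast; linarith [hyh i]
      omega
  · intro i
    split_ifs
    · linarith [hfl i]
    · exact le_rfl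
  · intro i
    split_ifs
    · linarith
    · linarith [(hh i).2]
  · intro i j hij hb
    rw [Set.eq_empty_iff_forall_notMem]
    rintro ⟨a, b⟩ ⟨⟨⟨ha1, ha2⟩, hb1, hb2⟩, ⟨ha3, ha4⟩, hb3, hb4⟩
    simp only [Fin.mk.injEq] at hb
    dsimp only at ha1 ha2 ha3 ha4 hb1 hb2 hb3 hb4
    have hfi := hlt i
    have hfj := hlt j
    split_ifs at hb hb1 hb2 hb3 hb4 with hci hcj hcj
    · have e : ⌊y i⌋₊ = ⌊y j⌋₊ := by omega
      rw [e] at hb1 hb2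
      rcases hdisj i j hij with h1 | h1 | h1 | h1 <;> linarith
    · omega
    · omega
    · have e : ⌊y i⌋₊ = ⌊y j⌋₊ := by omega
      rw [e] at hci hfi
      rcases hdisj i j hij with h1 | h1 | h1 | h1 <;> linarith

/-- Packings can be transported along a permutation of the items. -/
theorem BinPacking.nonempty_of_comp_perm {ι : Type} [Fintype ι] {w h : ι → ℝ} {N : ℕ}
    (σ : Equiv.Perm ι) (P : BinPacking (w ∘ σ) (h ∘ σ) N) : Nonempty (BinPacking w h N) := by
  refine ⟨{
    bin := P.bin ∘ σ.symm
    x := P.x ∘ σ.symm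
    y := P.y ∘ σ.symm
    x_nonneg := fun i => P.x_nonneg _
    y_nonneg := fun i => P.y_nonneg _
    x_add_le := fun i => by simpa using P.x_add_le (σ.symm i)
    y_add_le := fun i => by simpa using P.y_add_le (σ.symm i)
    disj := fun i j hij hb => by
      simpa using P.disj (σ.symm i) (σ.symm j) (fun e => hij (σ.symm.injective e)) hb }⟩

/-- Items of width at most `δ`, listed by decreasing height, can be packed on shelves into a strip
of width `1` and height at most `a / (1 - δ) + 1`, where `a` is their total area. -/
theorem exists_strip_packing {δ : ℝ} (hδ1 : δ < 1) {w h : ℕ → ℝ} (n : ℕ)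
    (hw : ∀ i, 0 ≤ w i ∧ w i ≤ δ) (hwpos : ∀ i < n, 0 < w i) (hh : ∀ i, 0 ≤ h i ∧ h i ≤ 1)
    (hanti : Antitone h) :
    ∃ (S : ℝ) (x y : ℕ → ℝ), 0 ≤ S ∧ S ≤ (∑ i ∈ Finset.range n, w i * h i) / (1 - δ) + 1 ∧
      ∀ i < n, 0 ≤ x i ∧ x i + w i ≤ 1 ∧ 0 ≤ y i ∧ y i + h i ≤ S ∧
        ∀ j, i < j → x i + w i ≤ x j ∨ y i + h i ≤ y j := by
  have hc : 0 < 1 - δ := by linarith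
  set X : ℕ → ℝ := fun p => ∑ i ∈ Finset.range p, w i with hX
  have X0 : X 0 = 0 := by simp [hX]
  have Xs : ∀ p, X (p + 1) = X p + w p := fun p => Finset.sum_range_succ _ _
  have Xmono : Monotone X := monotone_nat_of_le_succ fun p => by linarith [Xs p, (hw p).1]
  set m : ℕ → ℤ := fun p => ⌈X p / (1 - δ)⌉ with hm
  have m0 : m 0 = 0 := by simp [hm, X0]
  have mmono : Monotone m := fun p q hpq =>
    Int.ceil_mono (div_le_div_of_nonneg_right (Xmono hpq) hc.le)
  have mle : ∀ p, X p ≤ m p * (1 - δ) := fun p => (div_le_iff₀ hc).1 (Int.le_ceil _)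
  have mlt : ∀ p, (m p : ℝ) * (1 - δ) < X p + (1 - δ) := fun p => by
    have h1 : (m p : ℝ) - 1 < X p / (1 - δ) := by
      linarith [Int.ceil_lt_add_one (X p / (1 - δ))]
    have := (lt_div_iff₀ hc).1 h1
    linarith
  -- `F (i + 1)` is the top of the shelf holding item `i`.
  set F : ℕ → ℝ := fun p => ∑ i ∈ Finset.range p, ((m (i + 1) : ℝ) - m i) * h i with hF
  have F0 : F 0 = 0 := by simp [hF]
  have Fs : ∀ p, F (p + 1) = F p + ((m (p + 1) : ℝ) - m p) * h p :=
    fun p => Finset.sum_range_succ _ _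
  have mstep : ∀ p, (0 : ℝ) ≤ (m (p + 1) : ℝ) - m p := fun p =>
    sub_nonneg.2 (Int.cast_le.2 (mmono p.le_succ))
  have Fmono : Monotone F := monotone_nat_of_le_succ fun p => by
    linarith [Fs p, mul_nonneg (mstep p) (hh p).1]
  have Fgap : ∀ q p j, q ≤ p → p ≤ j + 1 → ((m p : ℝ) - m q) * h j ≤ F p - F q := by
    intro q p j hqp
    induction p, hqp using Nat.le_induction with
    | base => intro _; simp
    | succ p _ ih =>
      intro hpj
      have h1 := ih (by omega)
      have h2 := mul_le_mul_of_nonneg_left (hanti (show p ≤ j by omega)) (mstep p)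
      rw [Fs]
      linarith
  have Fle : ∀ p, F p * (1 - δ) ≤ (∑ i ∈ Finset.range p, w i * h i) + (1 - δ)
      - h p * (X p + (1 - δ) - m p * (1 - δ)) := by
    intro p
    induction p with
    | zero =>
      simp only [F0, X0, m0, Finset.range_zero, Finset.sum_empty, Int.cast_zero]
      nlinarith [(hh 0).2]
    | succ p ih =>
      rw [Finset.sum_range_succ, Fs]
      have h1 := mul_le_mul_of_nonneg_right (hanti p.le_succ) (sub_nonneg.2 (mlt (p + 1)).le)
      rw [Xs] at h1 ⊢
      linarith
  refine ⟨F n, fun i => X i - m (i + 1) * (1 - δ) + 1, fun i => F (i + 1) - h i, ?_, ?_, ?_⟩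
  · rw [← F0]; exact Fmono n.zero_le
  · rw [div_add_one hc.ne', le_div_iff₀ hc]
    linarith [Fle n, mul_nonneg (hh n).1 (sub_nonneg.2 (mlt n).le)]
  intro i hi
  refine ⟨?_, ?_, ?_, ?_, ?_⟩
  · linarith [mlt (i + 1), Xs i, (hw i).2]
  · linarith [mle (i + 1), Xs i]
  · have hpos : 0 < X (i + 1) := by
      have := Xmono i.zero_le
      linarith [Xs i, hwpos i hi]
    have h1 : (1 : ℝ) ≤ m (i + 1) := by
      exact_mod_cast Int.one_le_ceil_iff.2 (div_pos hpos hc)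
    have h2 := Fgap 0 (i + 1) i (Nat.zero_le _) le_rfl
    rw [F0, m0, Int.cast_zero, sub_zero, sub_zero] at h2
    nlinarith [(hh i).1]
  · linarith [Fmono (show i + 1 ≤ n from hi)]
  · intro j hij
    rcases (mmono (show i + 1 ≤ j + 1 by omega)).eq_or_lt with e | hlt
    · left
      dsimp only
      rw [← e]
      linarith [Xmono (show i + 1 ≤ j from hij), Xs i]
    · right
      have h1 : (1 : ℝ) ≤ (m (j + 1) : ℝ) - m (i + 1) := by
        have : m (i + 1) + 1 ≤ m (j + 1) := hlt
        have : (m (i + 1) : ℝ) + 1 ≤ m (j + 1) := by exact_mod_cast this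
        linarith
      have h2 := Fgap (i + 1) (j + 1) j (by omega) le_rfl
      nlinarith [(hh j).1]

/-- The bound of `pack_narrow_items` for items listed by decreasing height. -/
theorem exists_binPacking_of_antitone {δ : ℝ} (hδ0 : 0 < δ) (hδ1 : δ < 1) {n : ℕ}
    {w h : Fin n → ℝ} (hw : ∀ i, 0 < w i ∧ w i ≤ δ) (hh : ∀ i, 0 < h i ∧ h i ≤ 1)
    (hanti : Antitone h) :
    ∃ N : ℕ, Nonempty (BinPacking w h N) ∧
      (N : ℝ) < 2 * (∑ i, w i * h i) / (1 - δ) + 3 := by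
  let w' : ℕ → ℝ := fun i => if hi : i < n then w ⟨i, hi⟩ else 0
  let h' : ℕ → ℝ := fun i => if hi : i < n then h ⟨i, hi⟩ else 0
  have ew : ∀ i : Fin n, w' i = w i := fun i => by simp [w']
  have eh : ∀ i : Fin n, h' i = h i := fun i => by simp [h']
  obtain ⟨S, x, y, hS0, hS, hxy⟩ := exists_strip_packing (w := w') (h := h') hδ1 n
    (fun i => by
      by_cases hi : i < n
      · simpa [w', hi] using ⟨(hw ⟨i, hi⟩).1.le, (hw ⟨i, hi⟩).2⟩
      · simpa [w', hi] using hδ0.le)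
    (fun i hi => by simpa [w', hi] using (hw ⟨i, hi⟩).1)
    (fun i => by
      by_cases hi : i < n
      · simpa [h', hi] using ⟨(hh ⟨i, hi⟩).1.le, (hh ⟨i, hi⟩).2⟩
      · simp [h', hi])
    (fun i j hij => by
      by_cases hj : j < n
      · have hi : i < n := hij.trans_lt hj
        simpa [h', hi, hj] using hanti (show (⟨i, hi⟩ : Fin n) ≤ ⟨j, hj⟩ from hij)
      · by_cases hi : i < n
        · simpa [h', hi, hj] using (hh ⟨i, hi⟩).1.le
        · simp [h', hi, hj])
  rw [← Fin.sum_univ_eq_sum_range (fun i => w' i * h' i) n] at hS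
  simp only [ew, eh] at hS
  have key : ∀ i : Fin n, 0 ≤ x i ∧ x i + w i ≤ 1 ∧ 0 ≤ y i ∧ y i + h i ≤ S ∧
      ∀ j : Fin n, i < j → x i + w i ≤ x j ∨ y i + h i ≤ y j := fun i => by
    obtain ⟨h1, h2, h3, h4, h5⟩ := hxy i i.2
    rw [ew] at h2
    rw [eh] at h4
    refine ⟨h1, h2, h3, h4, fun j hij => ?_⟩
    have := h5 j hij
    rwa [ew, eh] at this
  refine ⟨2 * ⌈S⌉₊ - 1, BinPacking.nonempty_of_strip (x := fun i : Fin n => x i)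
    (y := fun i : Fin n => y i) hh
    (fun i => (key i).1) (fun i => (key i).2.1) (fun i => (key i).2.2.1)
    (fun i => (key i).2.2.2.1) (fun i j hij => ?_), ?_⟩
  · rcases lt_or_gt_of_ne hij with hlt | hlt
    · have := (key i).2.2.2.2 j hlt
      tauto
    · have := (key j).2.2.2.2 i hlt
      tauto
  · have h1 := Nat.ceil_lt_add_one hS0
    have h2 : ((2 * ⌈S⌉₊ - 1 : ℕ) : ℝ) < 2 * S + 1 := by
      rcases Nat.eq_zero_or_pos ⌈S⌉₊ with h0 | h0
      · rw [h0]; norm_num; linarith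
      · rw [Nat.cast_sub (by omega)]; push_cast; linarith
    rw [mul_div_assoc]
    linarith

/-- Items with width at most `δ` can be packed into fewer
than `2·a(I)/(1 − δ) + 3` unit square bins. -/
theorem pack_narrow_items
    (δ : ℝ) (hδ0 : 0 < δ) (hδ1 : δ < 1)
    (n : ℕ) (w h : Fin n → ℝ)
    (hw : ∀ i, 0 < w i ∧ w i ≤ δ) (hh : ∀ i, 0 < h i ∧ h i ≤ 1) :
    ∃ N : ℕ, Nonempty (BinPacking w h N) ∧
      (N : ℝ) < 2 * (∑ i, w i * h i) / (1 - δ) + 3 := by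
  let σ := Tuple.sort fun i => -h i
  obtain ⟨N, ⟨P⟩, hN⟩ := exists_binPacking_of_antitone (w := w ∘ σ) (h := h ∘ σ) hδ0 hδ1
    (fun i => hw _) (fun i => hh _)
    (fun i j hij => neg_le_neg_iff.1 (Tuple.monotone_sort (fun i => -h i) hij))
  refine ⟨N, BinPacking.nonempty_of_comp_perm σ P, ?_⟩
  rwa [← Equiv.sum_comp σ fun i => w i * h i]
end

section
/- Let ε and W be positive reals with ε < W, and let I be a nonempty finite set of items each having width at most ε. Then all items of I can be packed, axis-aligned, pairwise interior-disjoint and without rotation, into the rectangle of width W and height a(I)/(W − ε) + max_{i∈I} h(i). -/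
/-- Two axis-aligned rectangles with lower left corners `(x, y)`, `(x', y')` are separated by a
horizontal or vertical line. -/
def RectSeparated (x y w h x' y' w' h' : ℝ) : Prop :=
  x + w ≤ x' ∨ x' + w' ≤ x ∨ y + h ≤ y' ∨ y' + h' ≤ y

theorem RectSeparated.symm {x y w h x' y' w' h' : ℝ} (H : RectSeparated x y w h x' y' w' h') :
    RectSeparated x' y' w' h' x y w h := by
  unfold RectSeparated at *
  tauto

theorem RectSeparated.inter_eq_empty {x y w h x' y' w' h' : ℝ}
    (H : RectSeparated x y w h x' y' w' h') :
    (Set.Ioo x (x + w) ×ˢ Set.Ioo y (y + h)) ∩ (Set.Ioo x' (x' + w') ×ˢ Set.Ioo y' (y' + h')) =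
      ∅ := by
  ext ⟨p, q⟩
  simp only [Set.mem_inter_iff, Set.mem_prod, Set.mem_Ioo, Set.mem_empty_iff_false, iff_false]
  rintro ⟨⟨⟨_, _⟩, _, _⟩, ⟨_, _⟩, _, _⟩
  rcases H with H | H | H | H <;> linarith

/-- The state of the Next-Fit-Decreasing-Height algorithm after packing the items of `s` at the
positions `(x, y)`: the open shelf starts at height `Y`, has height `H` and is filled up to
abscissa `X`; `M` bounds the height of all items. -/
structure ShelfPacking_s5 {ι : Type*} (ε W M : ℝ) (w h : ι → ℝ) (s : Finset ι) (x y : ι → ℝ)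
    (X Y H : ℝ) : Prop where
  X_nonneg : 0 ≤ X
  Y_nonneg : 0 ≤ Y
  H_nonneg : 0 ≤ H
  mem_strip : ∀ i ∈ s, 0 ≤ x i ∧ x i + w i ≤ W ∧ 0 ≤ y i ∧ y i + h i ≤ Y + H
  below_or_left : ∀ i ∈ s, y i + h i ≤ Y ∨ x i + w i ≤ X
  separated : ∀ i ∈ s, ∀ j ∈ s, i ≠ j →
    RectSeparated (x i) (y i) (w i) (h i) (x j) (y j) (w j) (h j)
  le_H : ∀ c ≤ M, (∀ i ∈ s, c ≤ h i) → c ≤ H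
  area : ∀ c, 0 ≤ c → c ≤ M → (∀ i ∈ s, c ≤ h i) →
    (W - ε) * (Y + H - M) + X * c ≤ ∑ i ∈ s, w i * h i

theorem separated_update_insert {ι : Type*} [DecidableEq ι] {w h x y : ι → ℝ} {s : Finset ι}
    {a : ι} {u v : ℝ} (ha : a ∉ s)
    (hs : ∀ i ∈ s, ∀ j ∈ s, i ≠ j →
      RectSeparated (x i) (y i) (w i) (h i) (x j) (y j) (w j) (h j))
    (hsa : ∀ i ∈ s, RectSeparated (x i) (y i) (w i) (h i) u v (w a) (h a)) :
    ∀ i ∈ insert a s, ∀ j ∈ insert a s, i ≠ j →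
      RectSeparated (Function.update x a u i) (Function.update y a v i) (w i) (h i)
        (Function.update x a u j) (Function.update y a v j) (w j) (h j) := by
  have hne : ∀ i ∈ s, i ≠ a := fun i hi hia => ha (hia ▸ hi)
  intro i hi j hj hij
  rcases Finset.mem_insert.1 hi with rfl | his <;> rcases Finset.mem_insert.1 hj with rfl | hjs
  · exact absurd rfl hij
  · simpa [Function.update_of_ne (hne j hjs)] using (hsa j hjs).symm
  · simpa [Function.update_of_ne (hne i his)] using hsa i his
  · simpa [Function.update_of_ne (hne i his), Function.update_of_ne (hne j hjs)] using
      hs i his j hjs hij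

theorem forall_mem_insert_update {ι : Type*} [DecidableEq ι] {x y : ι → ℝ} {s : Finset ι}
    {a : ι} {u v : ℝ} (ha : a ∉ s) {P : ι → ℝ → ℝ → Prop} (hPa : P a u v)
    (hP : ∀ i ∈ s, P i (x i) (y i)) :
    ∀ i ∈ insert a s, P i (Function.update x a u i) (Function.update y a v i) := by
  intro i hi
  rcases Finset.mem_insert.1 hi with rfl | hi
  · simpa using hPa
  · have hia : i ≠ a := fun hia => ha (hia ▸ hi)
    simpa [Function.update_of_ne hia] using hP i hi

namespace ShelfPacking_s5

variable {ι : Type*} [DecidableEq ι] {ε W M : ℝ} {w h : ι → ℝ} {s : Finset ι} {x y : ι → ℝ}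
  {X Y H : ℝ} {a : ι}

/-- Place the next item on the open shelf. -/
theorem insert_same_shelf (S : ShelfPacking_s5 ε W M w h s x y X Y H) (ha : a ∉ s)
    (hwa : 0 < w a) (hmin : ∀ i ∈ s, h a ≤ h i) (haM : h a ≤ M) (hfit : X + w a ≤ W) :
    ShelfPacking_s5 ε W M w h (insert a s) (Function.update x a X) (Function.update y a Y)
      (X + w a) Y H where
  X_nonneg := add_nonneg S.X_nonneg hwa.le
  Y_nonneg := S.Y_nonneg
  H_nonneg := S.H_nonneg
  mem_strip := forall_mem_insert_update ha
    (P := fun i u v => 0 ≤ u ∧ u + w i ≤ W ∧ 0 ≤ v ∧ v + h i ≤ Y + H)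
    ⟨S.X_nonneg, hfit, S.Y_nonneg, by linarith [S.le_H (h a) haM hmin]⟩ S.mem_strip
  below_or_left := forall_mem_insert_update ha
    (P := fun i u v => v + h i ≤ Y ∨ u + w i ≤ X + w a) (Or.inr le_rfl)
    fun i hi => (S.below_or_left i hi).imp id fun hx => by linarith
  separated := separated_update_insert ha S.separated fun i hi => by
    unfold RectSeparated
    rcases S.below_or_left i hi with hy | hx <;> tauto
  le_H c hcM hc := S.le_H c hcM fun i hi => hc i (Finset.mem_insert_of_mem hi)
  area c hc0 hcM hc := by
    rw [Finset.sum_insert ha]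
    have h1 := S.area c hc0 hcM fun i hi => hc i (Finset.mem_insert_of_mem hi)
    have h2 := mul_le_mul_of_nonneg_left (hc a (Finset.mem_insert_self a s)) hwa.le
    linarith

/-- Close the open shelf and place the next item on a new one. -/
theorem insert_new_shelf (S : ShelfPacking_s5 ε W M w h s x y X Y H) (ha : a ∉ s)
    (hεW : ε < W) (hwa : 0 < w a) (hwε : w a ≤ ε) (hha : 0 < h a)
    (hmin : ∀ i ∈ s, h a ≤ h i) (haM : h a ≤ M) (hfull : W < X + w a) :
    ShelfPacking_s5 ε W M w h (insert a s) (Function.update x a 0) (Function.update y a (Y + H))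
      (w a) (Y + H) (h a) where
  X_nonneg := hwa.le
  Y_nonneg := add_nonneg S.Y_nonneg S.H_nonneg
  H_nonneg := hha.le
  mem_strip := forall_mem_insert_update ha
    (P := fun i u v => 0 ≤ u ∧ u + w i ≤ W ∧ 0 ≤ v ∧ v + h i ≤ Y + H + h a)
    ⟨le_rfl, by linarith, add_nonneg S.Y_nonneg S.H_nonneg, le_rfl⟩ fun i hi => by
      obtain ⟨h1, h2, h3, h4⟩ := S.mem_strip i hi
      exact ⟨h1, h2, h3, by linarith⟩
  below_or_left := forall_mem_insert_update ha
    (P := fun i u v => v + h i ≤ Y + H ∨ u + w i ≤ w a) (Or.inr (zero_add _).le)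
    fun i hi => Or.inl (S.mem_strip i hi).2.2.2
  separated := separated_update_insert ha S.separated fun i hi =>
    Or.inr (Or.inr (Or.inl (S.mem_strip i hi).2.2.2))
  le_H c _ hc := hc a (Finset.mem_insert_self a s)
  area c _ _ hc := by
    rw [Finset.sum_insert ha]
    have h1 := S.area (h a) hha.le haM hmin
    have h2 := mul_le_mul_of_nonneg_left (hc a (Finset.mem_insert_self a s)) hwa.le
    have h3 := mul_le_mul_of_nonneg_right (show W - ε ≤ X by linarith) hha.le
    linarith

end ShelfPacking_s5

theorem exists_shelfPacking_s5 {ι : Type*} {ε W M : ℝ} (hεW : ε < W) (hM : 0 ≤ M) {w h : ι → ℝ}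
    (hw : ∀ i, 0 < w i ∧ w i ≤ ε) (hh : ∀ i, 0 < h i) (hhM : ∀ i, h i ≤ M) (s : Finset ι) :
    ∃ x y X Y H, ShelfPacking_s5 ε W M w h s x y X Y H := by
  classical
  induction s using Finset.induction_on_min_value h with
  | empty =>
    exact ⟨0, 0, 0, 0, M, le_rfl, le_rfl, hM, by simp, by simp, by simp, fun c hc _ => hc,
      by simp⟩
  | insert a s ha hmin ih =>
    obtain ⟨x, y, X, Y, H, S⟩ := ih
    rcases le_or_gt (X + w a) W with hX | hX
    · exact ⟨_, _, _, _, _, S.insert_same_shelf ha (hw a).1 hmin (hhM a) hX⟩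
    · exact ⟨_, _, _, _, _,
        S.insert_new_shelf ha hεW (hw a).1 (hw a).2 (hh a) hmin (hhM a) hX⟩


/-- A nonempty finite set of items, each of width at most
`ε < W`, can be packed (axis-aligned, pairwise interior-disjoint, without
rotation) into the rectangle of width `W` and height
`a(I)/(W − ε) + max_{i∈I} h(i)`. -/
theorem narrow_items_strip_packing
    (ε W : ℝ) (hε0 : 0 < ε) (hεW : ε < W)
    (n : ℕ) (hn : 0 < n) (w h : Fin n → ℝ)
    (hw : ∀ i, 0 < w i ∧ w i ≤ ε) (hh : ∀ i, 0 < h i) :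
    ∃ x y : Fin n → ℝ,
      (∀ i, 0 ≤ x i ∧ x i + w i ≤ W ∧ 0 ≤ y i ∧
        y i + h i ≤ (∑ j, w j * h j) / (W - ε) + ⨆ j, h j) ∧
      (∀ i j, i ≠ j →
        (Set.Ioo (x i) (x i + w i) ×ˢ Set.Ioo (y i) (y i + h i)) ∩
          (Set.Ioo (x j) (x j + w j) ×ˢ Set.Ioo (y j) (y j + h j)) = ∅) := by
  have hhM : ∀ i, h i ≤ ⨆ j, h j := fun i => le_ciSup (Set.finite_range h).bddAbove i
  have hM : 0 ≤ ⨆ j, h j := (hh ⟨0, hn⟩).le.trans (hhM _)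
  obtain ⟨x, y, X, Y, H, S⟩ := exists_shelfPacking_s5 hεW hM hw hh hhM Finset.univ
  refine ⟨x, y, fun i => ?_, fun i j hij =>
    (S.separated i (Finset.mem_univ i) j (Finset.mem_univ j) hij).inter_eq_empty⟩
  obtain ⟨hx, hxW, hy, hyH⟩ := S.mem_strip i (Finset.mem_univ i)
  have harea := S.area 0 le_rfl hM fun i _ => (hh i).le
  have hdiv : Y + H - (⨆ j, h j) ≤ (∑ j, w j * h j) / (W - ε) := by
    rw [le_div_iff₀ (sub_pos.2 hεW)]
    linarith
  exact ⟨hx, hxW, hy, by linarith⟩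
end

section
/- Let δ_W, δ_H ∈ (0,1) and let I be a finite set of items, each with width at most δ_W and height at most δ_H. Then there exists a packing of I into fewer than a(I)/((1 − δ_W)(1 − δ_H)) + 1/(1 − δ_H) unit square bins. -/
/-- The position of an item in a shelf packing: its bin, the horizontal coordinate of the item,
and the bottom and the height of its shelf. -/
structure ShelfState where
  bin : ℕ
  x : ℝ
  y : ℝ
  height : ℝ

/-- The next-fit shelf packing of a sequence of items with widths `w` and heights `h`: an item
goes to the right of its predecessor if it fits there, else it opens a new shelf in the same bin
if that fits, else it opens a new bin. -/
noncomputable def nextFitShelf (w h : ℕ → ℝ) : ℕ → ShelfState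
  | 0 => ⟨0, 0, 0, h 0⟩
  | i + 1 =>
    let s := nextFitShelf w h i
    if s.x + w i + w (i + 1) ≤ 1 then ⟨s.bin, s.x + w i, s.y, s.height⟩
    else if s.y + s.height + h (i + 1) ≤ 1 then ⟨s.bin, 0, s.y + s.height, h (i + 1)⟩
    else ⟨s.bin + 1, 0, 0, h (i + 1)⟩

section NextFitShelf

variable {w h : ℕ → ℝ}

theorem nextFitShelf_succ_cases (w h : ℕ → ℝ) (i : ℕ) :
    ((nextFitShelf w h i).x + w i + w (i + 1) ≤ 1 ∧
      nextFitShelf w h (i + 1) = ⟨(nextFitShelf w h i).bin, (nextFitShelf w h i).x + w i,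
        (nextFitShelf w h i).y, (nextFitShelf w h i).height⟩) ∨
    (1 < (nextFitShelf w h i).x + w i + w (i + 1) ∧
      (nextFitShelf w h i).y + (nextFitShelf w h i).height + h (i + 1) ≤ 1 ∧
      nextFitShelf w h (i + 1) = ⟨(nextFitShelf w h i).bin, 0,
        (nextFitShelf w h i).y + (nextFitShelf w h i).height, h (i + 1)⟩) ∨
    (1 < (nextFitShelf w h i).x + w i + w (i + 1) ∧
      1 < (nextFitShelf w h i).y + (nextFitShelf w h i).height + h (i + 1) ∧
      nextFitShelf w h (i + 1) = ⟨(nextFitShelf w h i).bin + 1, 0, 0, h (i + 1)⟩) := by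
  rw [nextFitShelf]
  split_ifs with h₁ h₂
  · exact Or.inl ⟨h₁, rfl⟩
  · exact Or.inr (Or.inl ⟨not_le.1 h₁, h₂, rfl⟩)
  · exact Or.inr (Or.inr ⟨not_le.1 h₁, not_le.1 h₂, rfl⟩)

theorem nextFitShelf_mem_bin (hw : ∀ i, 0 ≤ w i ∧ w i ≤ 1) (hh : ∀ i, 0 ≤ h i ∧ h i ≤ 1)
    (hanti : ∀ i, h (i + 1) ≤ h i) (i : ℕ) :
    0 ≤ (nextFitShelf w h i).x ∧ (nextFitShelf w h i).x + w i ≤ 1 ∧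
      0 ≤ (nextFitShelf w h i).y ∧
      (nextFitShelf w h i).y + (nextFitShelf w h i).height ≤ 1 ∧
      h i ≤ (nextFitShelf w h i).height := by
  induction i with
  | zero => simp [nextFitShelf, hw 0, hh 0]
  | succ i ih =>
    obtain ⟨ih₁, ih₂, ih₃, ih₄, ih₅⟩ := ih
    have := hw i; have := hw (i + 1); have := hh i; have := hh (i + 1); have := hanti i
    rcases nextFitShelf_succ_cases w h i with ⟨_, e⟩ | ⟨_, _, e⟩ | ⟨_, _, e⟩ <;> rw [e] <;>
      dsimp only <;> refine ⟨?_, ?_, ?_, ?_, ?_⟩ <;> linarith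

theorem nextFitShelf_bin_mono (w h : ℕ → ℝ) : Monotone fun i => (nextFitShelf w h i).bin := by
  refine monotone_nat_of_le_succ fun i => ?_
  rcases nextFitShelf_succ_cases w h i with ⟨_, e⟩ | ⟨_, _, e⟩ | ⟨_, _, e⟩ <;> simp [e]

/-- A later item in the same bin lies either further right in the same shelf, or in a shelf
above. -/
theorem nextFitShelf_separated (hw : ∀ i, 0 ≤ w i ∧ w i ≤ 1) (hh : ∀ i, 0 ≤ h i ∧ h i ≤ 1)
    (hanti : ∀ i, h (i + 1) ≤ h i) {i j : ℕ} (hij : i < j)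
    (hbin : (nextFitShelf w h i).bin = (nextFitShelf w h j).bin) :
    ((nextFitShelf w h i).y + (nextFitShelf w h i).height =
        (nextFitShelf w h j).y + (nextFitShelf w h j).height ∧
      (nextFitShelf w h i).x + w i ≤ (nextFitShelf w h j).x) ∨
    (nextFitShelf w h i).y + (nextFitShelf w h i).height ≤ (nextFitShelf w h j).y := by
  induction j, hij using Nat.le_induction with
  | base =>
    rcases nextFitShelf_succ_cases w h i with ⟨_, e⟩ | ⟨_, _, e⟩ | ⟨_, _, e⟩ <;>
      simp_all
  | succ j hij ih =>
    have hmono : (nextFitShelf w h i).bin ≤ (nextFitShelf w h j).bin :=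
      nextFitShelf_bin_mono w h (Nat.le_of_succ_le hij)
    have := hw j
    have := hh j
    obtain ⟨_, _, _, _, _⟩ := nextFitShelf_mem_bin hw hh hanti j
    rcases nextFitShelf_succ_cases w h j with ⟨_, e⟩ | ⟨_, _, e⟩ | ⟨_, _, e⟩ <;>
      rw [e] at hbin ⊢ <;> dsimp only at hbin ⊢
    · rcases ih hbin with ⟨_, _⟩ | _
      · left; constructor <;> linarith
      · right; linarith
    · right
      rcases ih hbin with ⟨_, _⟩ | _ <;> linarith
    · omega

/-- The area bound for the next-fit shelf packing by decreasing heights. -/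
theorem nextFitShelf_area {δW δH : ℝ} (hδW : δW ≤ 1) (hw : ∀ i, 0 ≤ w i ∧ w i ≤ δW)
    (hh : ∀ i, 0 ≤ h i ∧ h i ≤ δH) (hδH : δH ≤ 1) (hanti : ∀ i, h (i + 1) ≤ h i) (i : ℕ) :
    (1 - δW) * ((nextFitShelf w h i).bin * (1 - δH) + (nextFitShelf w h i).y +
        (nextFitShelf w h i).height) + (nextFitShelf w h i).x * h i ≤
      ∑ k ∈ Finset.range i, w k * h k + (1 - δW) * h 0 := by
  induction i with
  | zero => simp [nextFitShelf]
  | succ i ih =>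
    rw [Finset.sum_range_succ]
    obtain ⟨hx, -⟩ := nextFitShelf_mem_bin (fun i => ⟨(hw i).1, (hw i).2.trans hδW⟩)
      (fun i => ⟨(hh i).1, (hh i).2.trans hδH⟩) hanti i
    have hrow : ((nextFitShelf w h i).x + w i) * h (i + 1) ≤
        ((nextFitShelf w h i).x + w i) * h i :=
      mul_le_mul_of_nonneg_left (hanti i) (add_nonneg hx (hw i).1)
    have hfull : 1 < (nextFitShelf w h i).x + w i + w (i + 1) →
        (1 - δW) * h (i + 1) ≤ ((nextFitShelf w h i).x + w i) * h (i + 1) := fun hlt =>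
      mul_le_mul_of_nonneg_right (by linarith [(hw (i + 1)).2]) (hh (i + 1)).1
    rcases nextFitShelf_succ_cases w h i with ⟨_, e⟩ | ⟨hlt, _, e⟩ | ⟨hlt, hlt', e⟩ <;>
      rw [e] <;> dsimp only
    · linarith
    · linarith [hfull hlt]
    · have hbin : (1 - δW) * (1 - δH) ≤
          (1 - δW) * ((nextFitShelf w h i).y + (nextFitShelf w h i).height) :=
        mul_le_mul_of_nonneg_left (by linarith [(hh (i + 1)).2]) (by linarith)
      push_cast
      linarith [hfull hlt]

end NextFitShelf

/-- Extension of a finite sequence by zero. -/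
noncomputable def extendZero {n : ℕ} (f : Fin n → ℝ) (k : ℕ) : ℝ :=
  if hk : k < n then f ⟨k, hk⟩ else 0

theorem extendZero_val {n : ℕ} (f : Fin n → ℝ) (i : Fin n) : extendZero f i = f i := by
  simp [extendZero]

theorem extendZero_mem {n : ℕ} {f : Fin n → ℝ} {δ : ℝ} (hδ : 0 ≤ δ)
    (hf : ∀ i, 0 < f i ∧ f i ≤ δ) (k : ℕ) : 0 ≤ extendZero f k ∧ extendZero f k ≤ δ := by
  unfold extendZero
  split_ifs with hk
  · exact ⟨(hf _).1.le, (hf _).2⟩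
  · exact ⟨le_rfl, hδ⟩

theorem extendZero_succ_le {n : ℕ} {f : Fin n → ℝ} (hf : ∀ i, 0 < f i) (hanti : Antitone f)
    (k : ℕ) : extendZero f (k + 1) ≤ extendZero f k := by
  unfold extendZero
  split_ifs with h₁ h₂ h₂
  · exact hanti (Nat.le_succ k)
  · omega
  · exact (hf _).le
  · exact le_rfl

theorem prod_Ioo_inter_eq_empty {a₁ b₁ c₁ d₁ a₂ b₂ c₂ d₂ : ℝ} (hsep : b₁ ≤ a₂ ∨ d₁ ≤ c₂) :
    (Set.Ioo a₁ b₁ ×ˢ Set.Ioo c₁ d₁) ∩ (Set.Ioo a₂ b₂ ×ˢ Set.Ioo c₂ d₂) = ∅ := by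
  refine Set.eq_empty_of_forall_notMem ?_
  rintro ⟨u, v⟩ ⟨⟨⟨_, _⟩, _, _⟩, ⟨_, _⟩, _, _⟩
  dsimp only at *
  rcases hsep with _ | _ <;> linarith

/-- Packings can be transported along a permutation of the items. -/
def BinPacking.ofPerm {n N : ℕ} {w h : Fin n → ℝ} (σ : Equiv.Perm (Fin n))
    (P : BinPacking (w ∘ σ) (h ∘ σ) N) : BinPacking w h N where
  bin i := P.bin (σ.symm i)
  x i := P.x (σ.symm i)
  y i := P.y (σ.symm i)
  x_nonneg i := P.x_nonneg _
  y_nonneg i := P.y_nonneg _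
  x_add_le i := by simpa using P.x_add_le (σ.symm i)
  y_add_le i := by simpa using P.y_add_le (σ.symm i)
  disj i j hij hb := by
    simpa using P.disj (σ.symm i) (σ.symm j) (fun he => hij (σ.symm.injective he)) hb

/-- Items sorted by decreasing height are packed by the next-fit shelf packing. -/
theorem pack_small_items_of_antitone {δW δH : ℝ} (hδW0 : 0 < δW) (hδW1 : δW < 1) (hδH0 : 0 < δH)
    (hδH1 : δH < 1) {n : ℕ} {w h : Fin n → ℝ} (hw : ∀ i, 0 < w i ∧ w i ≤ δW)
    (hh : ∀ i, 0 < h i ∧ h i ≤ δH) (hanti : Antitone h) :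
    ∃ N : ℕ, Nonempty (BinPacking w h N) ∧
      (N : ℝ) < (∑ i, w i * h i) / ((1 - δW) * (1 - δH)) + 1 / (1 - δH) := by
  have hW : 0 < 1 - δW := sub_pos.2 hδW1
  have hH : 0 < 1 - δH := sub_pos.2 hδH1
  rcases n with _ | m
  · refine ⟨0, ⟨⟨id, fun _ => 0, fun _ => 0, fun i => i.elim0, fun i => i.elim0,
      fun i => i.elim0, fun i => i.elim0, fun i => i.elim0⟩⟩, ?_⟩
    simpa using hδH1
  have hw' := extendZero_mem hδW0.le hw
  have hh' := extendZero_mem hδH0.le hh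
  have hw₁ : ∀ k, 0 ≤ extendZero w k ∧ extendZero w k ≤ 1 :=
    fun k => ⟨(hw' k).1, (hw' k).2.trans hδW1.le⟩
  have hh₁ : ∀ k, 0 ≤ extendZero h k ∧ extendZero h k ≤ 1 :=
    fun k => ⟨(hh' k).1, (hh' k).2.trans hδH1.le⟩
  have hanti' := extendZero_succ_le (fun i => (hh i).1) hanti
  have hmem := nextFitShelf_mem_bin hw₁ hh₁ hanti'
  set S := nextFitShelf (extendZero w) (extendZero h) with hS
  have hsep : ∀ i j : Fin (m + 1), i < j → (S i).bin = (S j).bin →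
      (S i).x + w i ≤ (S j).x ∨ (S i).y + h i ≤ (S j).y := by
    intro i j hij hb
    have hi := (hmem i).2.2.2.2
    rw [extendZero_val] at hi
    rcases nextFitShelf_separated hw₁ hh₁ hanti' hij hb with ⟨_, hx⟩ | hy
    · rw [extendZero_val] at hx
      exact Or.inl hx
    · exact Or.inr (by linarith)
  refine ⟨(S m).bin + 1, ⟨{
    bin := fun i => ⟨(S i).bin, Nat.lt_succ_of_le
      (nextFitShelf_bin_mono _ _ (Nat.le_of_lt_succ i.2))⟩
    x := fun i => (S i).x
    y := fun i => (S i).y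
    x_nonneg := fun i => (hmem i).1
    y_nonneg := fun i => (hmem i).2.2.1
    x_add_le := fun i => by simpa only [extendZero_val] using (hmem i).2.1
    y_add_le := fun i => by
      have := (hmem i).2.2.2
      rw [extendZero_val] at this
      linarith
    disj := fun i j hij hb => by
      have hb' := congrArg Fin.val hb
      rcases lt_or_gt_of_ne hij with hlt | hlt
      · exact prod_Ioo_inter_eq_empty (hsep i j hlt hb')
      · rw [Set.inter_comm]
        exact prod_Ioo_inter_eq_empty (hsep j i hlt hb'.symm) }⟩, ?_⟩
  have harea := nextFitShelf_area hδW1.le hw' hh' hδH1.le hanti' m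
  have hsum : ∑ i, w i * h i =
      ∑ k ∈ Finset.range m, extendZero w k * extendZero h k +
        w (Fin.last m) * h (Fin.last m) := by
    rw [Fin.sum_univ_castSucc, ← Fin.sum_univ_eq_sum_range
      (fun k => extendZero w k * extendZero h k)]
    congr 1
    refine Finset.sum_congr rfl fun i _ => ?_
    rw [← extendZero_val w, ← extendZero_val h, Fin.val_castSucc]
  obtain ⟨hx, -, hy, -, hheight⟩ := hmem m
  have hlast : 0 < w (Fin.last m) * h (Fin.last m) := mul_pos (hw _).1 (hh _).1
  have hx' : 0 ≤ (S m).x * extendZero h m := mul_nonneg hx (hh' m).1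
  have hshelf : 0 ≤ (1 - δW) * ((S m).y + (S m).height) :=
    mul_nonneg hW.le (by linarith [(hh' m).1])
  have hfirst : (1 - δW) * extendZero h 0 ≤ (1 - δW) * δH :=
    mul_le_mul_of_nonneg_left (hh' 0).2 hW.le
  have hbound : ((S m).bin + 1 : ℝ) * ((1 - δW) * (1 - δH)) < ∑ i, w i * h i + (1 - δW) := by
    linarith
  have hrhs : (∑ i, w i * h i) / ((1 - δW) * (1 - δH)) + 1 / (1 - δH) =
      (∑ i, w i * h i + (1 - δW)) / ((1 - δW) * (1 - δH)) := by
    field_simp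
  rw [hrhs, lt_div_iff₀ (mul_pos hW hH)]
  exact_mod_cast hbound

/-- Items with width at most `δ_W` and height at most `δ_H`
can be packed into fewer than `a(I)/((1 − δ_W)(1 − δ_H)) + 1/(1 − δ_H)` unit
square bins. -/
theorem pack_small_items
    (δW δH : ℝ) (hδW0 : 0 < δW) (hδW1 : δW < 1) (hδH0 : 0 < δH) (hδH1 : δH < 1)
    (n : ℕ) (w h : Fin n → ℝ)
    (hw : ∀ i, 0 < w i ∧ w i ≤ δW) (hh : ∀ i, 0 < h i ∧ h i ≤ δH) :
    ∃ N : ℕ, Nonempty (BinPacking w h N) ∧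
      (N : ℝ) < (∑ i, w i * h i) / ((1 - δW) * (1 - δH)) + 1 / (1 - δH) := by
  let σ := Tuple.sort fun i => -h i
  have hanti : Antitone (h ∘ σ) := fun i j hij =>
    neg_le_neg_iff.1 (Tuple.monotone_sort (fun i => -h i) hij)
  obtain ⟨N, ⟨P⟩, hN⟩ := pack_small_items_of_antitone hδW0 hδW1 hδH0 hδH1
    (fun i => hw (σ i)) (fun i => hh (σ i)) hanti
  refine ⟨N, ⟨P.ofPerm σ⟩, ?_⟩
  rwa [Equiv.sum_comp σ fun i => w i * h i] at hN
end
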